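/- There exists a polynomial Q₄(t) of degree 3 with real coefficients such that for every ε > 0 one has Σ_{n ≤ x} d₄(n + a(n)) = x·Q₄(log x) + O_ε(x^{3/4 + ε}) as x → ∞, where d₄(m) is the number of ordered quadruples of positive integers with product m and the implied constant depends only on ε. -/

import Mathlib

/-- `abelianCount n` is the number of isomorphism classes of abelian groups of order `n`:
the multiplicative function with `abelianCount (p^α) = P(α)`, the number of partitions of `α`. -/
def abelianCount (n : ℕ) : ℕ :=
  n.factorization.prod fun _ α => Fintype.card (Nat.Partition α)

/-- `d₄ m` is the number of ordered quadruples of positive integers with product `m`. -/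
noncomputable def d4 (m : ℕ) : ℕ :=
  Nat.card {t : Fin 4 → ℕ // (∀ i, 0 < t i) ∧ (∏ i, t i) = m}

lemma prod_factorization_le_rpow {h : ℕ → ℝ} (hpos : ∀ a, 0 ≤ h a)
    (hh : ∀ r : ℝ, 1 < r → ∃ C : ℝ, ∀ a, h a ≤ C * r ^ a) {ε : ℝ} (hε : 0 < ε) :
    ∃ C : ℝ, 0 < C ∧ ∀ n : ℕ, n ≠ 0 → (n.factorization.prod fun _ a => h a) ≤ C * (n : ℝ) ^ ε := by
  obtain ⟨C₀, hC₀⟩ := hh ((2 : ℝ) ^ ε) (Real.one_lt_rpow (by norm_num) hε)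
  set C := max C₀ 1
  have hC1 : 1 ≤ C := le_max_right _ _
  have hC : ∀ a, h a ≤ C * ((2 : ℝ) ^ ε) ^ a := fun a =>
    (hC₀ a).trans (by gcongr; exact le_max_left _ _)
  obtain ⟨P, hP⟩ := Filter.eventually_atTop.1
    ((tendsto_rpow_atTop hε).comp tendsto_natCast_atTop_atTop |>.eventually_ge_atTop
      (C * (2 : ℝ) ^ ε))
  refine ⟨C ^ P, by positivity, fun n hn => ?_⟩
  have key : ∀ p ∈ n.primeFactors, h (n.factorization p) ≤
      (if p < P then C else 1) * ((p : ℝ) ^ n.factorization p) ^ ε := by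
    intro p hp
    have hpp := Nat.prime_of_mem_primeFactors hp
    have ha : n.factorization p ≠ 0 := by
      rw [← Nat.support_factorization] at hp
      exact Finsupp.mem_support_iff.1 hp
    set a := n.factorization p
    have e1 : ((p : ℝ) ^ a) ^ ε = ((p : ℝ) ^ ε) ^ a := by
      rw [← Real.rpow_natCast, ← Real.rpow_natCast, ← Real.rpow_mul (by positivity),
        ← Real.rpow_mul (by positivity), mul_comm]
    rw [e1]
    split_ifs with hlt
    · refine (hC a).trans ?_
      gcongr
      exact_mod_cast hpp.two_le
    · have h2 : C * (2 : ℝ) ^ ε ≤ (p : ℝ) ^ ε := hP p (not_lt.1 hlt)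
      calc h a ≤ C * ((2 : ℝ) ^ ε) ^ a := hC a
        _ ≤ C ^ a * ((2 : ℝ) ^ ε) ^ a := by
            gcongr
            exact le_self_pow₀ hC1 ha
        _ = (C * (2 : ℝ) ^ ε) ^ a := (mul_pow _ _ _).symm
        _ ≤ 1 * ((p : ℝ) ^ ε) ^ a := by rw [one_mul]; gcongr
  calc (n.factorization.prod fun _ a => h a)
      = ∏ p ∈ n.primeFactors, h (n.factorization p) := by
        rw [Finsupp.prod, Nat.support_factorization]
    _ ≤ ∏ p ∈ n.primeFactors, (if p < P then C else 1) * ((p : ℝ) ^ n.factorization p) ^ ε :=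
        Finset.prod_le_prod (fun _ _ => hpos _) key
    _ = (∏ p ∈ n.primeFactors, if p < P then C else 1) *
          (∏ p ∈ n.primeFactors, (p : ℝ) ^ n.factorization p) ^ ε := by
        rw [Finset.prod_mul_distrib, Real.finsetProd_rpow _ _ (fun _ _ => by positivity)]
    _ ≤ C ^ P * (n : ℝ) ^ ε := by
        have e2 : (∏ p ∈ n.primeFactors, (p : ℝ) ^ n.factorization p) = n := by
          conv_rhs => rw [← Nat.prod_factorization_pow_eq_self hn]
          rw [Finsupp.prod, Nat.support_factorization]
          push_cast
          rfl
        rw [e2]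
        gcongr
        rw [← Finset.prod_filter, Finset.prod_const]
        refine pow_le_pow_right₀ hC1 ?_
        calc _ ≤ (Finset.range P).card := Finset.card_le_card fun p hp => by
                simp at hp ⊢; exact hp.2
          _ = P := Finset.card_range P

lemma exists_natCast_add_one_le_mul_pow {r : ℝ} (hr : 1 < r) :
    ∃ C : ℝ, ∀ a : ℕ, ((a + 1 : ℕ) : ℝ) ≤ C * r ^ a := by
  refine ⟨1 + (r - 1)⁻¹, fun a => ?_⟩
  have h1 : 0 < r - 1 := by linarith
  have h2 := one_add_mul_le_pow (a := r - 1) (by linarith) a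
  have h3 : 1 ≤ r ^ a := one_le_pow₀ hr.le
  have h4 : (a : ℝ) ≤ (r - 1)⁻¹ * r ^ a := by
    rw [inv_mul_eq_div, le_div_iff₀ h1]
    have : 1 + (r - 1) = r := by ring
    rw [this] at h2; linarith
  push_cast; linarith

lemma card_divisors_le_rpow {ε : ℝ} (hε : 0 < ε) :
    ∃ C : ℝ, 0 < C ∧ ∀ n : ℕ, n ≠ 0 → (n.divisors.card : ℝ) ≤ C * (n : ℝ) ^ ε := by
  obtain ⟨C, hC, h⟩ := prod_factorization_le_rpow (h := fun a => ((a + 1 : ℕ) : ℝ))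
    (fun a => by positivity) (fun r hr => exists_natCast_add_one_le_mul_pow hr) hε
  refine ⟨C, hC, fun n hn => ?_⟩
  refine le_of_eq_of_le ?_ (h n hn)
  rw [Nat.card_divisors hn, Finsupp.prod, Nat.support_factorization]
  push_cast
  rfl

lemma card_partition_le_mul_pow {r : ℝ} (hr : 1 < r) :
    ∃ C : ℝ, ∀ n : ℕ, (Fintype.card (Nat.Partition n) : ℝ) ≤ C * r ^ n := by
  set z := r⁻¹ with hz
  have hz0 : 0 < z := by positivity
  have hz1 : z < 1 := inv_lt_one_of_one_lt₀ hr
  refine ⟨Real.exp ((1 - z)⁻¹ * (1 - z)⁻¹), fun n => ?_⟩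
  have hsum : ∀ π : Nat.Partition n, ∑ i : Fin n, π.parts.count (i.1 + 1) * (i.1 + 1) = n := by
    intro π
    have h1 := Finset.sum_multiset_count_of_subset π.parts ((Finset.range n).image (· + 1)) (by
      intro i hi
      have hmem := Multiset.mem_toFinset.1 hi
      have h2 := Multiset.le_sum_of_mem hmem
      rw [π.parts_sum] at h2
      have h3 := π.parts_pos hmem
      exact Finset.mem_image.2 ⟨i - 1, Finset.mem_range.2 (by omega), by omega⟩)
    rw [π.parts_sum, Finset.sum_image (fun a _ b _ h => by simpa using h)] at h1
    rw [Fin.sum_univ_eq_sum_range (fun i => π.parts.count (i + 1) * (i + 1))]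
    simpa using h1.symm
  let c : Nat.Partition n → Fin n → Fin (n + 1) := fun π i =>
    ⟨π.parts.count (i.1 + 1), Nat.lt_succ_of_le (by
      have h1 := Finset.single_le_sum (f := fun i : Fin n => π.parts.count (i.1 + 1) * (i.1 + 1))
        (fun _ _ => Nat.zero_le _) (Finset.mem_univ i)
      rw [hsum π] at h1
      nlinarith [Nat.zero_le (π.parts.count (i.1 + 1) * i.1)])⟩
  have hinj : Function.Injective c := by
    intro π σ hπσ
    ext1
    ext i
    by_cases hi : 0 < i ∧ i ≤ n
    · have := congrFun hπσ ⟨i - 1, by omega⟩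
      simp only [c, Fin.mk.injEq] at this
      rwa [Nat.sub_add_cancel hi.1] at this
    · have aux : ∀ τ : Nat.Partition n, τ.parts.count i = 0 := by
        intro τ
        rw [Multiset.count_eq_zero]
        intro hmem
        exact hi ⟨τ.parts_pos hmem, by
          have := Multiset.le_sum_of_mem hmem
          rwa [τ.parts_sum] at this⟩
      rw [aux, aux]
  have hpi : ∀ i : Fin n, ∑ k : Fin (n + 1), z ^ (k.1 * (i.1 + 1)) ≤
      Real.exp ((1 - z)⁻¹ * z ^ i.1) := by
    intro i
    have hy1 : z ^ (i.1 + 1) < 1 := pow_lt_one₀ hz0.le hz1 (by omega)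
    have hyz : z ^ (i.1 + 1) ≤ z := pow_le_of_le_one hz0.le hz1.le (by omega)
    have h1 : ∑ k : Fin (n + 1), z ^ (k.1 * (i.1 + 1)) ≤ (1 - z ^ (i.1 + 1))⁻¹ := by
      rw [Fin.sum_univ_eq_sum_range (fun k => z ^ (k * (i.1 + 1)))]
      have : ∀ k, z ^ (k * (i.1 + 1)) = (z ^ (i.1 + 1)) ^ k := fun k => by
        rw [← pow_mul, mul_comm]
      simp_rw [this]
      rw [← tsum_geometric_of_lt_one (by positivity) hy1]
      exact (summable_geometric_of_lt_one (by positivity) hy1).sum_le_tsum _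
        (fun _ _ => by positivity)
    refine h1.trans ?_
    have h2 : (1 - z ^ (i.1 + 1))⁻¹ ≤ 1 + (1 - z)⁻¹ * z ^ i.1 := by
      have hpos : 0 < 1 - z ^ (i.1 + 1) := by linarith
      have h3 : (1 - z ^ (i.1 + 1))⁻¹ = 1 + (1 - z ^ (i.1 + 1))⁻¹ * z ^ (i.1 + 1) := by
        field_simp; ring
      rw [h3]
      have h5 : 0 < 1 - z := by linarith
      refine add_le_add le_rfl (mul_le_mul ?_ (pow_le_pow_of_le_one hz0.le hz1.le
        (Nat.le_succ i.1)) (by positivity) (inv_nonneg.2 h5.le))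
      exact inv_anti₀ h5 (by linarith)
    refine h2.trans ?_
    rw [add_comm]
    exact Real.add_one_le_exp _
  have hmain : (Fintype.card (Nat.Partition n) : ℝ) * z ^ n ≤
      Real.exp ((1 - z)⁻¹ * (1 - z)⁻¹) := by
    calc (Fintype.card (Nat.Partition n) : ℝ) * z ^ n
        = ∑ π : Nat.Partition n, ∏ i : Fin n, z ^ ((c π i).1 * (i.1 + 1)) := by
          rw [Finset.sum_congr rfl (g := fun _ => z ^ n)]
          · simp
          · intro π _
            rw [Finset.prod_pow_eq_pow_sum]
            congr 1
            exact hsum π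
      _ = ∑ f ∈ Finset.univ.image c, ∏ i : Fin n, z ^ ((f i).1 * (i.1 + 1)) := by
          rw [Finset.sum_image (fun a _ b _ h => hinj h)]
      _ ≤ ∑ f : Fin n → Fin (n + 1), ∏ i : Fin n, z ^ ((f i).1 * (i.1 + 1)) :=
          Finset.sum_le_sum_of_subset_of_nonneg (Finset.subset_univ _)
            (fun _ _ _ => by positivity)
      _ = ∏ i : Fin n, ∑ k : Fin (n + 1), z ^ (k.1 * (i.1 + 1)) := by
          rw [Finset.prod_univ_sum, Fintype.piFinset_univ]
      _ ≤ ∏ i : Fin n, Real.exp ((1 - z)⁻¹ * z ^ i.1) :=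
          Finset.prod_le_prod (fun _ _ => by positivity) (fun i _ => hpi i)
      _ = Real.exp ((1 - z)⁻¹ * ∑ i : Fin n, z ^ i.1) := by
          rw [← Real.exp_sum, Finset.mul_sum]
      _ ≤ Real.exp ((1 - z)⁻¹ * (1 - z)⁻¹) := by
          have h5 : 0 < 1 - z := by linarith
          gcongr
          rw [Fin.sum_univ_eq_sum_range (fun i => z ^ i), ← tsum_geometric_of_lt_one hz0.le hz1]
          exact (summable_geometric_of_lt_one hz0.le hz1).sum_le_tsum _
            (fun _ _ => by positivity)
  have hrz : r ^ n * z ^ n = 1 := by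
    rw [← mul_pow, hz, mul_inv_cancel₀ (by positivity), one_pow]
  calc (Fintype.card (Nat.Partition n) : ℝ)
      = (Fintype.card (Nat.Partition n) : ℝ) * z ^ n * r ^ n := by
        rw [mul_assoc, mul_comm (z ^ n), hrz, mul_one]
    _ ≤ _ := by gcongr

lemma abelianCount_le_rpow {ε : ℝ} (hε : 0 < ε) :
    ∃ C : ℝ, 0 < C ∧ ∀ n : ℕ, n ≠ 0 → (abelianCount n : ℝ) ≤ C * (n : ℝ) ^ ε := by
  obtain ⟨C, hC, h⟩ := prod_factorization_le_rpow
    (h := fun a => (Fintype.card (Nat.Partition a) : ℝ))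
    (fun a => by positivity) (fun r hr => card_partition_le_mul_pow hr) hε
  refine ⟨C, hC, fun n hn => ?_⟩
  refine le_of_eq_of_le ?_ (h n hn)
  rw [abelianCount, Finsupp.prod, Finsupp.prod]
  push_cast
  rfl

lemma abelianCount_pos (n : ℕ) : 0 < abelianCount n := by
  rw [abelianCount, Finsupp.prod]
  exact Finset.prod_pos fun p _ => Fintype.card_pos_iff.2 ⟨Nat.Partition.indiscrete _⟩

lemma card_divisorsAntidiagonal (n : ℕ) : n.divisorsAntidiagonal.card = n.divisors.card := by
  rw [Finset.card_eq_sum_ones, Finset.card_eq_sum_ones,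
    Nat.sum_divisorsAntidiagonal (fun _ _ => 1)]

/-- `d4` as a Dirichlet convolution of two copies of the divisor function. -/
lemma d4_eq_sum_divisorsAntidiagonal (m : ℕ) (hm : m ≠ 0) :
    d4 m = ∑ p ∈ m.divisorsAntidiagonal, p.1.divisors.card * p.2.divisors.card := by
  have e : {t : Fin 4 → ℕ // (∀ i, 0 < t i) ∧ (∏ i, t i) = m} ≃
      (m.divisorsAntidiagonal.sigma fun p =>
        p.1.divisorsAntidiagonal ×ˢ p.2.divisorsAntidiagonal) :=
    { toFun := fun t => ⟨⟨(t.1 0 * t.1 1, t.1 2 * t.1 3), ((t.1 0, t.1 1), (t.1 2, t.1 3))⟩, by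
        have h0 := t.2.1 0
        have h1 := t.2.1 1
        have h2 := t.2.1 2
        have h3 := t.2.1 3
        have h4 := t.2.2
        simp only [Fin.prod_univ_four] at h4
        simp only [Finset.mem_sigma, Nat.mem_divisorsAntidiagonal, Finset.mem_product]
        exact ⟨⟨by linarith, hm⟩, ⟨trivial, by positivity⟩, trivial, by positivity⟩⟩
      invFun := fun s => ⟨![s.1.2.1.1, s.1.2.1.2, s.1.2.2.1, s.1.2.2.2], by
        obtain ⟨⟨⟨u, v⟩, ⟨⟨a, b⟩, ⟨c, d⟩⟩⟩, h⟩ := s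
        simp only [Finset.mem_sigma, Nat.mem_divisorsAntidiagonal, Finset.mem_product] at h
        obtain ⟨⟨h1, h2⟩, ⟨h3, h4⟩, h5, h6⟩ := h
        subst h3 h5
        simp only [ne_eq, mul_eq_zero, not_or] at h4 h6
        refine ⟨?_, ?_⟩
        · intro i
          fin_cases i <;> simp <;> omega
        · simp [Fin.prod_univ_four, ← h1]; ring⟩
      left_inv := fun t => by
        ext i
        fin_cases i <;> rfl
      right_inv := fun s => by
        obtain ⟨⟨⟨u, v⟩, ⟨⟨a, b⟩, ⟨c, d⟩⟩⟩, h⟩ := s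
        simp only [Finset.mem_sigma, Nat.mem_divisorsAntidiagonal, Finset.mem_product] at h
        obtain ⟨⟨h1, h2⟩, ⟨h3, h4⟩, h5, h6⟩ := h
        subst h3 h5
        rfl }
  rw [d4, Nat.card_congr e, Nat.card_eq_fintype_card, Fintype.card_coe, Finset.card_sigma]
  refine Finset.sum_congr rfl fun p _ => ?_
  rw [Finset.card_product, card_divisorsAntidiagonal, card_divisorsAntidiagonal]

lemma d4_zero : d4 0 = 0 := by
  rw [d4, Nat.card_eq_zero]
  left
  refine ⟨fun t => ?_⟩
  exact absurd t.2.2 (Finset.prod_ne_zero_iff.2 fun i _ => (t.2.1 i).ne')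

lemma d4_le_card_divisors_pow (m : ℕ) (hm : m ≠ 0) : d4 m ≤ m.divisors.card ^ 3 := by
  rw [d4_eq_sum_divisorsAntidiagonal m hm]
  calc _ ≤ ∑ p ∈ m.divisorsAntidiagonal, m.divisors.card * m.divisors.card := by
        refine Finset.sum_le_sum fun p hp => ?_
        have h1 := Nat.mem_divisorsAntidiagonal.1 hp
        gcongr
        · exact ⟨_, h1.1.symm⟩
        · exact ⟨p.1, by rw [← h1.1]; ring⟩
    _ = m.divisors.card ^ 3 := by
        rw [Finset.sum_const, card_divisorsAntidiagonal, smul_eq_mul]; ring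

lemma d4_le_rpow {ε : ℝ} (hε : 0 < ε) :
    ∃ C : ℝ, 0 < C ∧ ∀ n : ℕ, n ≠ 0 → (d4 n : ℝ) ≤ C * (n : ℝ) ^ ε := by
  obtain ⟨C, hC, h⟩ := card_divisors_le_rpow (ε := ε / 3) (by positivity)
  refine ⟨C ^ 3, by positivity, fun n hn => ?_⟩
  calc (d4 n : ℝ) ≤ (n.divisors.card : ℝ) ^ 3 := by exact_mod_cast d4_le_card_divisors_pow n hn
    _ ≤ (C * (n : ℝ) ^ (ε / 3)) ^ 3 := by gcongr; exact h n hn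
    _ = C ^ 3 * (n : ℝ) ^ ε := by
        rw [mul_pow, ← Real.rpow_natCast (_ ^ (ε / 3)), ← Real.rpow_mul (by positivity)]
        norm_num

open Finset in
lemma sum_le_mul_sum_of_fiber_card_le {α β : Type*} [DecidableEq β] {s : Finset α} {t : Finset β}
    {f : α → ℝ} {g : β → ℝ} (i : α → β) (K : ℝ) (hi : ∀ a ∈ s, i a ∈ t)
    (hfib : ∀ b ∈ t, ((s.filter fun a => i a = b).card : ℝ) ≤ K)
    (hfg : ∀ a ∈ s, f a ≤ g (i a)) (hg : ∀ b ∈ t, 0 ≤ g b) :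
    ∑ a ∈ s, f a ≤ K * ∑ b ∈ t, g b := by
  rw [← Finset.sum_fiberwise_of_maps_to hi, Finset.mul_sum]
  refine Finset.sum_le_sum fun b hb => ?_
  calc ∑ a ∈ s.filter (fun a => i a = b), f a
      ≤ ∑ a ∈ s.filter (fun a => i a = b), g b := by
        refine Finset.sum_le_sum fun a ha => ?_
        rw [Finset.mem_filter] at ha
        rw [← ha.2]
        exact hfg a ha.1
    _ = ((s.filter fun a => i a = b).card : ℝ) * g b := by rw [Finset.sum_const, nsmul_eq_mul]
    _ ≤ K * g b := mul_le_mul_of_nonneg_right (hfib b hb) (hg b hb)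

lemma sum_le_sum_of_injOn {α β : Type*} {s : Finset α} {t : Finset β}
    {f : α → ℝ} {g : β → ℝ} (i : α → β) (hi : ∀ a ∈ s, i a ∈ t) (hinj : Set.InjOn i s)
    (hfg : ∀ a ∈ s, f a ≤ g (i a)) (hg : ∀ b ∈ t, 0 ≤ g b) :
    ∑ a ∈ s, f a ≤ ∑ b ∈ t, g b := by
  classical
  calc ∑ a ∈ s, f a ≤ ∑ a ∈ s, g (i a) := Finset.sum_le_sum hfg
    _ = ∑ b ∈ s.image i, g b := (Finset.sum_image hinj).symm
    _ ≤ ∑ b ∈ t, g b := Finset.sum_le_sum_of_subset_of_nonneg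
        (Finset.image_subset_iff.2 hi) fun b hb _ => hg b hb

/-- Sums over `n ≤ N` of sums over factorizations of `n`, as sums over a hyperbolic region. -/
lemma sum_Icc_sum_divisorsAntidiagonal (H : ℕ → ℕ → ℝ) (N : ℕ) :
    ∑ n ∈ Finset.Icc 1 N, ∑ p ∈ n.divisorsAntidiagonal, H p.1 p.2 =
      ∑ u ∈ Finset.Icc 1 N, ∑ v ∈ Finset.Icc 1 (N / u), H u v := by
  rw [Finset.sum_sigma', Finset.sum_sigma']
  refine Finset.sum_bij' (fun x _ => ⟨x.2.1, x.2.2⟩) (fun y _ => ⟨y.1 * y.2, (y.1, y.2)⟩)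
    ?_ ?_ ?_ ?_ ?_
  · rintro ⟨n, u, v⟩ h
    simp only [Finset.mem_sigma, Finset.mem_Icc, Nat.mem_divisorsAntidiagonal] at h ⊢
    obtain ⟨⟨h1, h2⟩, h3, h4⟩ := h
    subst h3
    have hu : 0 < u := Nat.pos_of_ne_zero (by rintro rfl; simp at h4)
    have hv : 0 < v := Nat.pos_of_ne_zero (by rintro rfl; simp at h4)
    refine ⟨⟨hu, by nlinarith⟩, hv, ?_⟩
    rw [Nat.le_div_iff_mul_le hu]; linarith
  · rintro ⟨u, v⟩ h
    simp only [Finset.mem_sigma, Finset.mem_Icc, Nat.mem_divisorsAntidiagonal] at h ⊢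
    obtain ⟨⟨h1, h2⟩, h3, h4⟩ := h
    rw [Nat.le_div_iff_mul_le h1] at h4
    have : 0 < u * v := by positivity
    refine ⟨⟨this, by linarith⟩, trivial, this.ne'⟩
  · rintro ⟨n, u, v⟩ h
    simp only [Finset.mem_sigma, Finset.mem_Icc, Nat.mem_divisorsAntidiagonal] at h ⊢
    obtain ⟨_, h3, h4⟩ := h
    subst h3
    rfl
  · rintro ⟨u, v⟩ h
    rfl
  · rintro ⟨n, u, v⟩ h
    rfl

/-- The Dirichlet hyperbola method for a symmetric summand. -/
lemma sum_hyperbola (H : ℕ → ℕ → ℝ) (hH : ∀ u v, H u v = H v u) (N : ℕ) :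
    ∑ n ∈ Finset.Icc 1 N, ∑ p ∈ n.divisorsAntidiagonal, H p.1 p.2 =
      2 * ∑ u ∈ Finset.Icc 1 N.sqrt, ∑ v ∈ Finset.Icc 1 (N / u), H u v -
      ∑ u ∈ Finset.Icc 1 N.sqrt, ∑ v ∈ Finset.Icc 1 N.sqrt, H u v := by
  rw [sum_Icc_sum_divisorsAntidiagonal]
  set s := N.sqrt
  have hs1 : s * s ≤ N := Nat.sqrt_le N
  have hs2 : N < (s + 1) * (s + 1) := Nat.lt_succ_sqrt N
  have e1 : ∑ u ∈ Finset.Icc 1 N, ∑ v ∈ Finset.Icc 1 (N / u), H u v =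
      ∑ x ∈ (Finset.Icc 1 N ×ˢ Finset.Icc 1 N).filter (fun x => x.1 * x.2 ≤ N), H x.1 x.2 := by
    rw [Finset.sum_filter, Finset.sum_product]
    refine Finset.sum_congr rfl fun u hu => ?_
    rw [← Finset.sum_filter]
    refine Finset.sum_congr ?_ fun _ _ => rfl
    ext v
    simp only [Finset.mem_Icc, Finset.mem_filter] at hu ⊢
    rw [Nat.le_div_iff_mul_le (by omega)]
    constructor
    · rintro ⟨h1, h2⟩; exact ⟨⟨h1, by nlinarith⟩, by linarith⟩
    · rintro ⟨⟨h1, _⟩, h2⟩; exact ⟨h1, by linarith⟩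
  set P := (Finset.Icc 1 N ×ˢ Finset.Icc 1 N).filter (fun x => x.1 * x.2 ≤ N) with hP
  have e2 : ∑ u ∈ Finset.Icc 1 s, ∑ v ∈ Finset.Icc 1 (N / u), H u v =
      ∑ x ∈ P.filter (fun x => x.1 ≤ s), H x.1 x.2 := by
    rw [Finset.sum_sigma']
    refine Finset.sum_bij' (fun x _ => (x.1, x.2)) (fun y _ => ⟨y.1, y.2⟩) ?_ ?_ ?_ ?_ ?_
    · rintro ⟨u, v⟩ h
      simp only [Finset.mem_sigma, Finset.mem_Icc, hP, Finset.mem_filter, Finset.mem_product]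
        at h ⊢
      obtain ⟨⟨h1, h2⟩, h3, h4⟩ := h
      rw [Nat.le_div_iff_mul_le h1] at h4
      exact ⟨⟨⟨⟨h1, by nlinarith⟩, h3, by nlinarith⟩, by linarith⟩, h2⟩
    · rintro ⟨u, v⟩ h
      simp only [Finset.mem_sigma, Finset.mem_Icc, hP, Finset.mem_filter, Finset.mem_product]
        at h ⊢
      obtain ⟨⟨⟨⟨h1, h2⟩, h3, h4⟩, h5⟩, h6⟩ := h
      rw [Nat.le_div_iff_mul_le h1]
      exact ⟨⟨h1, h6⟩, h3, by linarith⟩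
    · rintro ⟨u, v⟩ _; rfl
    · rintro ⟨u, v⟩ _; rfl
    · rintro ⟨u, v⟩ _; rfl
  have e3 : ∑ x ∈ P.filter (fun x => x.2 ≤ s), H x.1 x.2 =
      ∑ x ∈ P.filter (fun x => x.1 ≤ s), H x.1 x.2 := by
    refine Finset.sum_bij' (fun x _ => (x.2, x.1)) (fun x _ => (x.2, x.1)) ?_ ?_ ?_ ?_ ?_
    · rintro ⟨u, v⟩ h
      simp only [hP, Finset.mem_filter, Finset.mem_product] at h ⊢
      rw [mul_comm]; tauto
    · rintro ⟨u, v⟩ h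
      simp only [hP, Finset.mem_filter, Finset.mem_product] at h ⊢
      rw [mul_comm]; tauto
    · rintro ⟨u, v⟩ _; rfl
    · rintro ⟨u, v⟩ _; rfl
    · rintro ⟨u, v⟩ _; exact hH _ _
  have e4 : P.filter (fun x => x.1 ≤ s) ∪ P.filter (fun x => x.2 ≤ s) = P := by
    rw [← Finset.filter_or, Finset.filter_eq_self]
    rintro ⟨u, v⟩ h
    simp only [hP, Finset.mem_filter, Finset.mem_product] at h ⊢
    by_contra! hc
    have := Nat.mul_le_mul hc.1 hc.2
    simp only [Nat.succ_eq_add_one] at this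
    omega
  have e5 : P.filter (fun x => x.1 ≤ s) ∩ P.filter (fun x => x.2 ≤ s) =
      Finset.Icc 1 s ×ˢ Finset.Icc 1 s := by
    ext ⟨u, v⟩
    simp only [hP, Finset.mem_inter, Finset.mem_filter, Finset.mem_product, Finset.mem_Icc]
    constructor
    · tauto
    · rintro ⟨⟨h1, h2⟩, h3, h4⟩
      have := Nat.mul_le_mul h2 h4
      have hss : s ≤ s * s := Nat.le_mul_self s
      refine ⟨⟨⟨⟨⟨h1, ?_⟩, h3, ?_⟩, ?_⟩, h2⟩, ⟨⟨⟨h1, ?_⟩, h3, ?_⟩, ?_⟩, h4⟩ <;> linarith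
  have e6 := Finset.sum_union_inter (s₁ := P.filter (fun x => x.1 ≤ s))
    (s₂ := P.filter (fun x => x.2 ≤ s)) (f := fun x => H x.1 x.2)
  rw [e4, e5, e3, Finset.sum_product] at e6
  rw [e1, e2]
  linarith

open Complex in
/-- Parseval's identity on `ZMod q`. -/
lemma ZMod.sum_norm_sq_sum_stdAddChar (q : ℕ) [NeZero q] (F : ZMod q → ℝ) :
    ∑ k : ZMod q, ‖∑ b : ZMod q, (F b : ℂ) * ZMod.stdAddChar (b * k)‖ ^ 2 =
      q * ∑ b : ZMod q, F b ^ 2 := by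
  have h : ((∑ k : ZMod q, ‖∑ b : ZMod q, (F b : ℂ) * ZMod.stdAddChar (b * k)‖ ^ 2 : ℝ) : ℂ) =
      ((q * ∑ b : ZMod q, F b ^ 2 : ℝ) : ℂ) := by
    push_cast
    have e1 : ∀ k : ZMod q, (‖∑ b : ZMod q, (F b : ℂ) * ZMod.stdAddChar (b * k)‖ : ℂ) ^ 2 =
        ∑ b : ZMod q, ∑ c : ZMod q, (F b * F c : ℂ) * ZMod.stdAddChar (k * (b - c)) := by
      intro k
      rw [← Complex.mul_conj', map_sum, Finset.sum_mul_sum]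
      refine Finset.sum_congr rfl fun b _ => Finset.sum_congr rfl fun c _ => ?_
      rw [RingHom.map_mul, Complex.conj_ofReal, ← AddChar.map_neg_eq_conj]
      rw [mul_mul_mul_comm, ← AddChar.map_add_eq_mul]
      congr 2
      ring
    simp_rw [e1]
    rw [Finset.sum_comm, Finset.mul_sum]
    refine Finset.sum_congr rfl fun b _ => ?_
    rw [Finset.sum_comm]
    simp_rw [← Finset.mul_sum, AddChar.sum_mulShift _ (ZMod.isPrimitive_stdAddChar q)]
    simp [sub_eq_zero, ZMod.card]
    ring
  exact_mod_cast h

lemma ZMod.norm_sum_stdAddChar_le_card (q : ℕ) [NeZero q] (k : ZMod q) (L : ℕ) :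
    ‖∑ n ∈ Finset.Icc 1 L, ZMod.stdAddChar ((n : ZMod q) * k)‖ ≤ L := by
  refine (norm_sum_le _ _).trans ?_
  simp

lemma ZMod.norm_sum_stdAddChar_le (q : ℕ) [NeZero q] (k : ZMod q) (hk : k ≠ 0) (L : ℕ) :
    ‖∑ n ∈ Finset.Icc 1 L, ZMod.stdAddChar ((n : ZMod q) * k)‖ ≤
      q / (2 * (k.valMinAbs.natAbs : ℝ)) := by
  set h := k.valMinAbs with hh
  have hq : (0 : ℝ) < q := by exact_mod_cast NeZero.pos q
  have h0 : h ≠ 0 := by rwa [hh, Ne, ZMod.valMinAbs_eq_zero]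
  have hpos : (0 : ℝ) < (h.natAbs : ℝ) := by exact_mod_cast Int.natAbs_pos.2 h0
  have hle : (h.natAbs : ℝ) * 2 ≤ q := by
    have := ZMod.natAbs_valMinAbs_le k
    rw [Nat.le_div_two_iff_mul_two_le] at this
    exact_mod_cast this
  set z : ℂ := ZMod.stdAddChar k with hz
  have hz1 : ‖z‖ = 1 := by simp [hz]
  have hsum : ∑ n ∈ Finset.Icc 1 L, ZMod.stdAddChar ((n : ZMod q) * k) =
      ∑ n ∈ Finset.range L, z ^ (n + 1) := by
    rw [Finset.range_eq_Ico, Finset.sum_Ico_add' (fun n => z ^ n) 0 L 1]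
    refine Finset.sum_congr (by ext; simp) fun n _ => ?_
    rw [← nsmul_eq_mul, AddChar.map_nsmul_eq_pow]
  have hnum : ‖(∑ n ∈ Finset.Icc 1 L, ZMod.stdAddChar ((n : ZMod q) * k)) * (z - 1)‖ ≤ 2 := by
    rw [hsum]
    have : (∑ n ∈ Finset.range L, z ^ (n + 1)) * (z - 1) = z * (z ^ L - 1) := by
      rw [← geom_sum_mul]
      simp_rw [pow_succ', ← Finset.mul_sum]
      ring
    rw [this, norm_mul, hz1, one_mul]
    calc _ ≤ ‖z ^ L‖ + ‖(1 : ℂ)‖ := norm_sub_le _ _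
      _ = 2 := by rw [norm_pow, hz1]; norm_num
  have hden : 4 * (h.natAbs : ℝ) / q ≤ ‖z - 1‖ := by
    have e : z = Complex.exp (Complex.I * ((2 * Real.pi * h / q : ℝ) : ℂ)) := by
      rw [hz, ← ZMod.coe_valMinAbs k, ZMod.stdAddChar_coe]
      congr 1
      push_cast
      rw [← hh]
      ring
    have hab : |Real.sin (Real.pi * h / q)| = Real.sin (Real.pi * (h.natAbs : ℝ) / q) := by
      have hnn : 0 ≤ Real.sin (Real.pi * (h.natAbs : ℝ) / q) := by
        apply Real.sin_nonneg_of_nonneg_of_le_pi (by positivity)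
        rw [div_le_iff₀ hq]
        have := Real.pi_pos
        nlinarith
      rcases Int.natAbs_eq h with h2 | h2
      · have : (h : ℝ) = (h.natAbs : ℝ) := by
          rw [← Int.cast_natCast (R := ℝ) h.natAbs, ← h2]
        rw [this, abs_of_nonneg hnn]
      · have : (h : ℝ) = -(h.natAbs : ℝ) := by
          rw [← Int.cast_natCast (R := ℝ) h.natAbs, ← Int.cast_neg, ← h2]
        rw [this, mul_neg, neg_div, Real.sin_neg, abs_neg, abs_of_nonneg hnn]
    rw [e, Complex.norm_exp_I_mul_ofReal_sub_one, Real.norm_eq_abs, abs_mul]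
    have e2 : 2 * Real.pi * h / q / 2 = Real.pi * h / q := by ring
    rw [e2, hab]
    have := Real.mul_le_sin (x := Real.pi * (h.natAbs : ℝ) / q) (by positivity) (by
      rw [div_le_div_iff₀ hq two_pos]
      have := Real.pi_pos
      nlinarith)
    have e3 : 2 / Real.pi * (Real.pi * (h.natAbs : ℝ) / q) = 2 * (h.natAbs : ℝ) / q := by
      have := Real.pi_pos.ne'
      field_simp
    rw [e3] at this
    rw [abs_two]
    calc _ = 2 * (2 * (h.natAbs : ℝ) / q) := by ring
      _ ≤ _ := by gcongr
  rw [norm_mul] at hnum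
  have h3 := (mul_le_mul_of_nonneg_left hden (norm_nonneg _)).trans hnum
  rw [mul_div_assoc', div_le_iff₀ hq] at h3
  rw [le_div_iff₀ (by positivity)]
  linarith

lemma sum_Icc_one_div_le (N : ℕ) : ∑ n ∈ Finset.Icc 1 N, (1 : ℝ) / n ≤ 1 + Real.log N := by
  have := harmonic_le_one_add_log N
  rw [harmonic_eq_sum_Icc] at this
  push_cast at this
  simpa [one_div] using this

lemma one_add_log_le_rpow {ε : ℝ} (hε : 0 < ε) :
    ∃ C : ℝ, 0 < C ∧ ∀ x : ℝ, 1 ≤ x → 1 + Real.log x ≤ C * x ^ ε := by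
  refine ⟨1 + 1 / ε, by positivity, fun x hx => ?_⟩
  have h1 := Real.log_le_rpow_div (x := x) (by linarith) hε
  have h2 := Real.one_le_rpow hx hε.le
  calc _ ≤ x ^ ε + x ^ ε / ε := by linarith
    _ = _ := by ring

lemma sum_one_div_mul_le_of_lt (q : ℕ) (hq : 0 < q) (Z : ℕ) :
    ∑ x ∈ (Finset.Icc 1 Z ×ˢ Finset.Icc 1 Z).filter
      (fun x => x.1 < x.2 ∧ (q ∣ x.2 - x.1 ∨ q ∣ x.1 + x.2)), (1 : ℝ) / (x.1 * x.2) ≤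
      4 / q * (1 + Real.log (2 * Z : ℕ)) ^ 2 := by
  have hq' : (0 : ℝ) < q := by exact_mod_cast hq
  calc _ ≤ ∑ y ∈ Finset.Icc 1 Z ×ˢ (Finset.Icc 1 (2 * Z) ×ˢ (Finset.univ : Finset Bool)),
        2 / q * (1 / (y.1 : ℝ) * (1 / (y.2.1 : ℝ))) := by
        refine sum_le_sum_of_injOn (fun x => (x.1, (if q ∣ x.2 - x.1 then (x.2 - x.1) / q else
          (x.1 + x.2) / q), decide (q ∣ x.2 - x.1))) ?_ ?_ ?_ ?_
        · rintro ⟨a, b⟩ h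
          simp only [Finset.mem_filter, Finset.mem_product, Finset.mem_Icc] at h
          obtain ⟨⟨⟨h1, h2⟩, h3, h4⟩, h5, h6⟩ := h
          simp only [Finset.mem_product, Finset.mem_Icc, Finset.mem_univ, and_true]
          refine ⟨⟨h1, h2⟩, ?_⟩
          split_ifs with h7
          · exact ⟨Nat.div_pos (Nat.le_of_dvd (by omega) h7) hq,
              (Nat.div_le_self _ _).trans (by omega)⟩
          · have h8 := h6.resolve_left h7
            exact ⟨Nat.div_pos (Nat.le_of_dvd (by omega) h8) hq,
              (Nat.div_le_self _ _).trans (by omega)⟩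
        · rintro ⟨a, b⟩ h ⟨a', b'⟩ h' heq
          simp only [Finset.coe_filter, Set.mem_ofPred_eq, Finset.mem_product, Finset.mem_Icc]
            at h h'
          obtain ⟨⟨⟨h1, h2⟩, h3, h4⟩, h5, h6⟩ := h
          obtain ⟨⟨⟨h1', h2'⟩, h3', h4'⟩, h5', h6'⟩ := h'
          simp only [Prod.mk.injEq] at heq
          obtain ⟨e1, e2, e3⟩ := heq
          subst e1
          by_cases h7 : q ∣ b - a
          · have h7' : q ∣ b' - a := by simpa [h7] using e3
            rw [if_pos h7, if_pos h7'] at e2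
            have := (Nat.div_left_inj h7 h7').1 e2
            rw [Prod.mk.injEq]; omega
          · have h7' : ¬ q ∣ b' - a := by simpa [h7] using e3
            rw [if_neg h7, if_neg h7'] at e2
            have := (Nat.div_left_inj (h6.resolve_left h7) (h6'.resolve_left h7')).1 e2
            rw [Prod.mk.injEq]; omega
        · rintro ⟨a, b⟩ h
          simp only [Finset.mem_filter, Finset.mem_product, Finset.mem_Icc] at h
          obtain ⟨⟨⟨h1, h2⟩, h3, h4⟩, h5, h6⟩ := h
          set j := if q ∣ b - a then (b - a) / q else (a + b) / q with hj
          have hqj : 0 < j ∧ q * j ≤ 2 * b := by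
            rw [hj]
            split_ifs with h7
            · exact ⟨Nat.div_pos (Nat.le_of_dvd (by omega) h7) hq, by
                rw [Nat.mul_div_cancel' h7]; omega⟩
            · have h8 := h6.resolve_left h7
              exact ⟨Nat.div_pos (Nat.le_of_dvd (by omega) h8) hq, by
                rw [Nat.mul_div_cancel' h8]; omega⟩
          have ha : (0 : ℝ) < a := by exact_mod_cast h1
          have hb : (0 : ℝ) < b := by exact_mod_cast h3
          have hj0 : (0 : ℝ) < j := by exact_mod_cast hqj.1
          have hj1 : (q : ℝ) * j ≤ 2 * b := by exact_mod_cast hqj.2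
          show (1 : ℝ) / (a * b) ≤ 2 / q * (1 / (a : ℝ) * (1 / (j : ℝ)))
          have e : 2 / (q : ℝ) * (1 / (a : ℝ) * (1 / (j : ℝ))) = 2 / (a * (q * j)) := by
            field_simp
          rw [e, div_le_div_iff₀ (by positivity) (by positivity)]
          nlinarith [mul_le_mul_of_nonneg_left hj1 ha.le]
        · intro y _; positivity
    _ = 4 / q * ((∑ a ∈ Finset.Icc 1 Z, 1 / (a : ℝ)) *
          ∑ j ∈ Finset.Icc 1 (2 * Z), 1 / (j : ℝ)) := by
        rw [← Finset.mul_sum, Finset.sum_product, Finset.sum_mul_sum]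
        simp_rw [Finset.sum_product]
        simp only [Finset.sum_const, Finset.card_univ, Fintype.card_bool, nsmul_eq_mul]
        push_cast
        simp_rw [← Finset.mul_sum]
        ring
    _ ≤ 4 / q * ((1 + Real.log (2 * Z : ℕ)) * (1 + Real.log (2 * Z : ℕ))) := by
        have h1 := sum_Icc_one_div_le (2 * Z)
        have h2 : ∑ a ∈ Finset.Icc 1 Z, 1 / (a : ℝ) ≤ ∑ j ∈ Finset.Icc 1 (2 * Z), 1 / (j : ℝ) :=
          Finset.sum_le_sum_of_subset_of_nonneg (Finset.Icc_subset_Icc_right (by omega))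
            (fun _ _ _ => by positivity)
        have h3 : 0 ≤ ∑ a ∈ Finset.Icc 1 Z, 1 / (a : ℝ) :=
          Finset.sum_nonneg fun _ _ => by positivity
        have h4 : 0 ≤ ∑ j ∈ Finset.Icc 1 (2 * Z), 1 / (j : ℝ) :=
          Finset.sum_nonneg fun _ _ => by positivity
        have := mul_le_mul (h2.trans h1) h1 h4 (by linarith)
        gcongr
    _ = _ := by ring

lemma sum_one_div_mul_le (q : ℕ) (hq : 0 < q) (Z : ℕ) :
    ∑ x ∈ (Finset.Icc 1 Z ×ˢ Finset.Icc 1 Z).filter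
      (fun x => x.1 ≠ x.2 ∧ ((q : ℤ) ∣ x.1 - x.2 ∨ (q : ℤ) ∣ x.1 + x.2)),
        (1 : ℝ) / (x.1 * x.2) ≤ 8 / q * (1 + Real.log (2 * Z : ℕ)) ^ 2 := by
  have hS := sum_one_div_mul_le_of_lt q hq Z
  rw [← Finset.sum_filter_add_sum_filter_not _ (fun x => x.1 < x.2)]
  have h1 : ∀ a b : ℕ, a < b → ((q : ℤ) ∣ a - b ∨ (q : ℤ) ∣ a + b) → (q ∣ b - a ∨ q ∣ a + b) := by
    rintro a b hab (h | h)
    · left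
      rw [← Int.natCast_dvd_natCast, Nat.cast_sub hab.le]
      rwa [← dvd_neg, neg_sub] at h
    · right; exact_mod_cast h
  have hA : ∑ x ∈ ((Finset.Icc 1 Z ×ˢ Finset.Icc 1 Z).filter
      (fun x => x.1 ≠ x.2 ∧ ((q : ℤ) ∣ x.1 - x.2 ∨ (q : ℤ) ∣ x.1 + x.2))).filter
        (fun x => x.1 < x.2), (1 : ℝ) / (x.1 * x.2) ≤ 4 / q * (1 + Real.log (2 * Z : ℕ)) ^ 2 := by
    refine le_trans (sum_le_sum_of_injOn (fun x => x) ?_ (fun _ _ _ _ h => h) (fun _ _ => le_rfl)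
      (fun _ _ => by positivity)) hS
    rintro ⟨a, b⟩ h
    simp only [Finset.mem_filter] at h ⊢
    exact ⟨h.1.1, h.2, h1 a b h.2 h.1.2.2⟩
  have hB : ∑ x ∈ ((Finset.Icc 1 Z ×ˢ Finset.Icc 1 Z).filter
      (fun x => x.1 ≠ x.2 ∧ ((q : ℤ) ∣ x.1 - x.2 ∨ (q : ℤ) ∣ x.1 + x.2))).filter
        (fun x => ¬ x.1 < x.2), (1 : ℝ) / (x.1 * x.2) ≤
        4 / q * (1 + Real.log (2 * Z : ℕ)) ^ 2 := by
    refine le_trans (sum_le_sum_of_injOn Prod.swap ?_ Prod.swap_injective.injOn ?_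
      (fun _ _ => by positivity)) hS
    · rintro ⟨a, b⟩ h
      simp only [Finset.mem_filter, Finset.mem_product, Prod.swap_prod_mk] at h ⊢
      have hlt : b < a := by omega
      refine ⟨⟨h.1.1.2, h.1.1.1⟩, hlt, h1 b a hlt ?_⟩
      rcases h.1.2.2 with h3 | h3
      · left; rwa [← dvd_neg, neg_sub] at h3
      · right; rwa [add_comm] at h3
    · rintro ⟨a, b⟩ _
      simp [mul_comm]
  have := add_le_add hA hB
  refine this.trans (le_of_eq ?_)
  ring

/-- The frequencies `(k, m, m')` with prescribed products `|k m| m'` and `|k m'| m`. -/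
lemma card_filter_valMinAbs_le (q : ℕ) [NeZero q] (U : Finset ℕ)
    (hU : ∀ m ∈ U, 0 < m ∧ m.Coprime q) (s₁ s₂ : ℕ) (hs₁ : 0 < s₁) (hs₂ : 0 < s₂) :
    (((Finset.univ : Finset (ZMod q)) ×ˢ (U ×ˢ U)).filter (fun x =>
      ((x.1 * x.2.1).valMinAbs.natAbs * x.2.2, (x.1 * x.2.2).valMinAbs.natAbs * x.2.1) =
        (s₁, s₂))).card ≤ 2 * (s₁.divisors.card * s₂.divisors.card) := by
  have : 2 * (s₁.divisors.card * s₂.divisors.card) =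
      ((Finset.univ : Finset Bool) ×ˢ (s₁.divisors ×ˢ s₂.divisors)).card := by
    simp [Finset.card_product]
  rw [this]
  refine Finset.card_le_card_of_injOn
    (fun x => (decide (0 ≤ (x.1 * x.2.1).valMinAbs), x.2.2, x.2.1)) ?_ ?_
  · rintro ⟨k, m, m'⟩ h
    simp only [Finset.coe_filter, Finset.mem_product, Set.mem_ofPred_eq, Prod.mk.injEq] at h
    simp only [Finset.coe_product, Set.mem_prod, Finset.mem_coe, Finset.mem_univ, true_and,
      Nat.mem_divisors]
    exact ⟨⟨Dvd.intro_left _ h.2.1, hs₁.ne'⟩, Dvd.intro_left _ h.2.2, hs₂.ne'⟩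
  · rintro ⟨k, m, m'⟩ h ⟨l, n, n'⟩ h' heq
    simp only [Finset.coe_filter, Finset.mem_product, Set.mem_ofPred_eq, Prod.mk.injEq] at h h' heq
    obtain ⟨e1, e2, e3⟩ := heq
    subst e2 e3
    have hm' := (hU m' h.1.2.2).1
    have hm := (hU m h.1.2.1).2
    have e4 : (k * m).valMinAbs.natAbs = (l * m).valMinAbs.natAbs :=
      Nat.eq_of_mul_eq_mul_right hm' (h.2.1.trans h'.2.1.symm)
    have e5 : (k * m).valMinAbs = (l * m).valMinAbs := by
      rw [decide_eq_decide] at e1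
      omega
    rw [ZMod.valMinAbs_inj] at e5
    have hu : IsUnit (m : ZMod q) := (ZMod.isUnit_iff_coprime m q).2 hm
    rw [hu.mul_left_inj] at e5
    rw [e5]

lemma dvd_sub_or_dvd_add_of_valMinAbs (q : ℕ) [NeZero q] (k : ZMod q) (m m' : ℕ) :
    (q : ℤ) ∣ ((k * m).valMinAbs.natAbs * m' : ℕ) - ((k * m').valMinAbs.natAbs * m : ℕ) ∨
    (q : ℤ) ∣ ((k * m).valMinAbs.natAbs * m' : ℕ) + ((k * m').valMinAbs.natAbs * m : ℕ) := by
  have h1 : ∀ x : ZMod q, ((x.valMinAbs.natAbs : ℕ) : ZMod q) = x ∨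
      ((x.valMinAbs.natAbs : ℕ) : ZMod q) = -x := by
    intro x
    rw [ZMod.natCast_natAbs_valMinAbs]
    split_ifs <;> simp
  rw [← ZMod.intCast_zmod_eq_zero_iff_dvd, ← ZMod.intCast_zmod_eq_zero_iff_dvd]
  push_cast
  simp only [← Int.natCast_natAbs, Int.cast_natCast]
  rcases h1 (k * m) with h | h <;> rcases h1 (k * m') with h' | h' <;> rw [h, h']
  · left; ring
  · right; ring
  · right; ring
  · left; ring

/-- The sum of the divisor function over `n ≤ N` in the residue class `b`. -/
noncomputable def divisorSumAP (q N : ℕ) (b : ZMod q) : ℝ :=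
  ∑ n ∈ Finset.Icc 1 N, if (n : ZMod q) = b then (n.divisors.card : ℝ) else 0

lemma divisorSumAP_eq (q : ℕ) [NeZero q] (N : ℕ) (b : ZMod q) (hb : IsUnit b) :
    divisorSumAP q N b = ∑ m ∈ (Finset.Icc 1 N.sqrt).filter (fun m => m.Coprime q),
      (2 * (∑ n ∈ Finset.Icc 1 (N / m), if (n : ZMod q) * (m : ZMod q) = b then (1 : ℝ) else 0) -
        ∑ n ∈ Finset.Icc 1 N.sqrt, if (n : ZMod q) * (m : ZMod q) = b then (1 : ℝ) else 0) := by
  have h1 : divisorSumAP q N b = ∑ n ∈ Finset.Icc 1 N, ∑ p ∈ n.divisorsAntidiagonal,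
      if (p.2 : ZMod q) * (p.1 : ZMod q) = b then (1 : ℝ) else 0 := by
    refine Finset.sum_congr rfl fun n _ => ?_
    rw [← card_divisorsAntidiagonal]
    have : ∀ p ∈ n.divisorsAntidiagonal, (if (p.2 : ZMod q) * (p.1 : ZMod q) = b then (1 : ℝ)
        else 0) = if (n : ZMod q) = b then (1 : ℝ) else 0 := by
      intro p hp
      rw [← (Nat.mem_divisorsAntidiagonal.1 hp).1, mul_comm (p.2 : ZMod q)]
      push_cast
      rfl
    rw [Finset.sum_congr rfl this, Finset.sum_const, nsmul_eq_mul, mul_ite, mul_one, mul_zero]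
  rw [h1, sum_hyperbola (fun u v => if (v : ZMod q) * (u : ZMod q) = b then (1 : ℝ) else 0)
    (fun u v => by simp only [mul_comm])]
  rw [Finset.mul_sum, ← Finset.sum_sub_distrib]
  symm
  refine Finset.sum_subset (Finset.filter_subset _ _) fun m hm hm' => ?_
  have hnc : ¬ m.Coprime q := fun h => hm' (Finset.mem_filter.2 ⟨hm, h⟩)
  have hz : ∀ n : ℕ, (if (n : ZMod q) * (m : ZMod q) = b then (1 : ℝ) else 0) = 0 := by
    intro n
    rw [if_neg]
    rintro rfl
    exact hnc ((ZMod.isUnit_iff_coprime m q).1 (isUnit_of_mul_isUnit_right hb))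
  simp [hz]

lemma sum_mul_stdAddChar_of_count (q : ℕ) [NeZero q] (L m : ℕ) (k : ZMod q) :
    ∑ b : ZMod q, (((∑ n ∈ Finset.Icc 1 L, if (n : ZMod q) * (m : ZMod q) = b then (1 : ℝ) else 0) : ℝ) : ℂ) *
      ZMod.stdAddChar (b * k) =
    ∑ n ∈ Finset.Icc 1 L, ZMod.stdAddChar ((n : ZMod q) * (k * (m : ZMod q))) := by
  simp only [Complex.ofReal_sum, Finset.sum_mul]
  rw [Finset.sum_comm]
  refine Finset.sum_congr rfl fun n _ => ?_
  rw [Finset.sum_eq_single ((n : ZMod q) * (m : ZMod q))]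
  · rw [if_pos rfl, Complex.ofReal_one, one_mul]
    congr 1; ring
  · intro b _ hb
    rw [if_neg hb.symm, Complex.ofReal_zero, zero_mul]
  · intro h; exact absurd (Finset.mem_univ _) h

/-- The majorant for the Fourier coefficients of the divisor function in residue classes. -/
lemma sum_sq_sum_min_le {ε : ℝ} (hε : 0 < ε) :
    ∃ C : ℝ, 0 < C ∧ ∀ (q : ℕ) [NeZero q] (N : ℕ), 1 ≤ N →
      ∑ k ∈ (Finset.univ : Finset (ZMod q)).erase 0,
        (∑ m ∈ (Finset.Icc 1 N.sqrt).filter (fun m => m.Coprime q),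
          min ((N : ℝ) / m) (q / (2 * ((k * (m : ZMod q)).valMinAbs.natAbs : ℝ)))) ^ 2 ≤
        C * (q * N : ℝ) ^ ε * (N * q) := by
  obtain ⟨Cd, hCd, hd⟩ := card_divisors_le_rpow (ε := ε / 4) (by positivity)
  obtain ⟨Cl, hCl, hl⟩ := one_add_log_le_rpow (ε := ε / 4) (by positivity)
  refine ⟨2 * Cd ^ 2 * (9 * (Cl * (2 : ℝ) ^ (ε / 4)) ^ 2), by positivity, ?_⟩
  intro q _ N hN
  have hq0 := NeZero.pos q
  have hq : (0 : ℝ) < q := by exact_mod_cast hq0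
  have hN' : (0 : ℝ) < N := by exact_mod_cast hN
  have hqN1 : (1 : ℝ) ≤ q * N := by exact_mod_cast Nat.mul_pos hq0 hN
  set s := N.sqrt with hs
  have hss : s * s ≤ N := Nat.sqrt_le N
  have hsN : s ≤ N := Nat.sqrt_le_self N
  set U := (Finset.Icc 1 s).filter (fun m => m.Coprime q) with hU
  have hUprop : ∀ m ∈ U, 0 < m ∧ m.Coprime q := fun m hm => by
    simp only [hU, Finset.mem_filter, Finset.mem_Icc] at hm
    exact ⟨by omega, hm.2⟩
  have hUs : ∀ m ∈ U, m ≤ s := fun m hm => by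
    simp only [hU, Finset.mem_filter, Finset.mem_Icc] at hm
    exact hm.1.2
  set Z := q * N with hZ
  have hZ1 : 1 ≤ Z := Nat.mul_pos hq0 hN
  set M : ℕ → ZMod q → ℝ := fun m x => min ((N : ℝ) / m) (q / (2 * (x.valMinAbs.natAbs : ℝ)))
    with hM
  have hM0 : ∀ m x, 0 ≤ M m x := fun m x => le_min (by positivity) (by positivity)
  set Y := (Finset.Icc 1 Z ×ˢ Finset.Icc 1 Z).filter
    (fun x => (x.1 = x.2) ∨ (x.1 ≠ x.2 ∧ ((q : ℤ) ∣ x.1 - x.2 ∨ (q : ℤ) ∣ x.1 + x.2))) with hY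
  set g : ℕ × ℕ → ℝ := fun x => if x.1 = x.2 then N * q / (x.1 : ℝ) else
    (q : ℝ) ^ 2 * N * (1 / (x.1 * x.2)) with hg
  have hLHS : ∑ k ∈ (Finset.univ : Finset (ZMod q)).erase 0, (∑ m ∈ U, M m (k * (m : ZMod q))) ^ 2 =
      ∑ x ∈ ((Finset.univ : Finset (ZMod q)).erase 0) ×ˢ (U ×ˢ U),
        M x.2.1 (x.1 * x.2.1) * M x.2.2 (x.1 * x.2.2) := by
    rw [Finset.sum_product]
    refine Finset.sum_congr rfl fun k _ => ?_
    rw [sq, Finset.sum_mul_sum, Finset.sum_product]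
  have hne : ∀ k : ZMod q, k ≠ 0 → ∀ m ∈ U, 0 < (k * (m : ZMod q)).valMinAbs.natAbs := by
    intro k hk m hm
    rw [Int.natAbs_pos, Ne, ZMod.valMinAbs_eq_zero]
    intro h0
    have hu : IsUnit (m : ZMod q) := (ZMod.isUnit_iff_coprime m q).2 (hUprop m hm).2
    exact hk ((hu.mul_left_eq_zero).1 h0)
  have hmain : ∑ x ∈ ((Finset.univ : Finset (ZMod q)).erase 0) ×ˢ (U ×ˢ U),
        M x.2.1 (x.1 * x.2.1) * M x.2.2 (x.1 * x.2.2) ≤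
      (2 * (Cd * (Z : ℝ) ^ (ε / 4)) ^ 2) * ∑ y ∈ Y, g y := by
    refine sum_le_mul_sum_of_fiber_card_le (fun x => ((x.1 * x.2.1).valMinAbs.natAbs * x.2.2,
      (x.1 * x.2.2).valMinAbs.natAbs * x.2.1)) _ ?_ ?_ ?_ ?_
    · rintro ⟨k, m, m'⟩ h
      simp only [Finset.mem_product, Finset.mem_erase] at h
      obtain ⟨⟨hk, _⟩, hm, hm'⟩ := h
      have h1 := hne k hk m hm
      have h2 := hne k hk m' hm'
      have h3 : (k * (m : ZMod q)).valMinAbs.natAbs ≤ q :=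
        (ZMod.natAbs_valMinAbs_le _).trans (Nat.div_le_self _ _)
      have h4 : (k * (m' : ZMod q)).valMinAbs.natAbs ≤ q :=
        (ZMod.natAbs_valMinAbs_le _).trans (Nat.div_le_self _ _)
      simp only [hY, Finset.mem_filter, Finset.mem_product, Finset.mem_Icc]
      refine ⟨⟨⟨Nat.mul_pos h1 (hUprop m' hm').1, ?_⟩, Nat.mul_pos h2 (hUprop m hm).1, ?_⟩, ?_⟩
      · exact Nat.mul_le_mul h3 ((hUs m' hm').trans hsN)
      · exact Nat.mul_le_mul h4 ((hUs m hm).trans hsN)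
      · by_cases h5 : (k * (m : ZMod q)).valMinAbs.natAbs * m' = (k * (m' : ZMod q)).valMinAbs.natAbs * m
        · exact Or.inl h5
        · exact Or.inr ⟨h5, dvd_sub_or_dvd_add_of_valMinAbs q k m m'⟩
    · rintro ⟨s₁, s₂⟩ h
      simp only [hY, Finset.mem_filter, Finset.mem_product, Finset.mem_Icc] at h
      obtain ⟨⟨⟨h1, h2⟩, h3, h4⟩, _⟩ := h
      have hc := card_filter_valMinAbs_le q U hUprop s₁ s₂ h1 h3
      have hc' : (((Finset.univ.erase (0 : ZMod q)) ×ˢ (U ×ˢ U)).filter (fun x =>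
          ((x.1 * x.2.1).valMinAbs.natAbs * x.2.2, (x.1 * x.2.2).valMinAbs.natAbs * x.2.1) =
          (s₁, s₂))).card ≤ 2 * (s₁.divisors.card * s₂.divisors.card) :=
        (Finset.card_le_card (Finset.filter_subset_filter _
          (Finset.product_subset_product_left (Finset.erase_subset _ _)))).trans hc
      have hdz : ∀ t : ℕ, 1 ≤ t → t ≤ Z → (t.divisors.card : ℝ) ≤ Cd * (Z : ℝ) ^ (ε / 4) := by
        intro t ht1 ht2
        refine (hd t (by omega)).trans ?_
        gcongr
      calc _ ≤ ((2 * (s₁.divisors.card * s₂.divisors.card) : ℕ) : ℝ) := by exact_mod_cast hc'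
        _ = 2 * ((s₁.divisors.card : ℝ) * (s₂.divisors.card : ℝ)) := by push_cast; ring
        _ ≤ 2 * ((Cd * (Z : ℝ) ^ (ε / 4)) * (Cd * (Z : ℝ) ^ (ε / 4))) := by
            gcongr
            · exact hdz s₁ h1 h2
            · exact hdz s₂ h3 h4
        _ = _ := by ring
    · rintro ⟨k, m, m'⟩ h
      simp only [Finset.mem_product, Finset.mem_erase] at h
      obtain ⟨⟨hk, _⟩, hm, hm'⟩ := h
      have h1 : (0 : ℝ) < (k * (m : ZMod q)).valMinAbs.natAbs := by exact_mod_cast hne k hk m hm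
      have h2 : (0 : ℝ) < (k * (m' : ZMod q)).valMinAbs.natAbs := by exact_mod_cast hne k hk m' hm'
      have h3 : (0 : ℝ) < m := by exact_mod_cast (hUprop m hm).1
      have h4 : (0 : ℝ) < m' := by exact_mod_cast (hUprop m' hm').1
      have h5 : (m : ℝ) * m' ≤ N := by
        exact_mod_cast (Nat.mul_le_mul (hUs m hm) (hUs m' hm')).trans hss
      simp only [hg]
      split_ifs with he
      · have he' : ((k * (m : ZMod q)).valMinAbs.natAbs : ℝ) * m' = (k * (m' : ZMod q)).valMinAbs.natAbs * m := by
          exact_mod_cast he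
        calc M m (k * (m : ZMod q)) * M m' (k * (m' : ZMod q)) ≤ (N / m) * (q / (2 * ((k * (m' : ZMod q)).valMinAbs.natAbs : ℝ))) :=
              mul_le_mul (min_le_left _ _) (min_le_right _ _) (hM0 _ _) (by positivity)
          _ = (N * q) / (2 * (((k * (m' : ZMod q)).valMinAbs.natAbs : ℝ) * m)) := by field_simp
          _ ≤ (N * q) / (((k * (m' : ZMod q)).valMinAbs.natAbs : ℝ) * m) := by
              refine div_le_div_of_nonneg_left (by positivity) (by positivity) ?_
              linarith [mul_pos h2 h3]
          _ = _ := by rw [← he']; push_cast; rfl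
      · calc M m (k * (m : ZMod q)) * M m' (k * (m' : ZMod q)) ≤ (q / (2 * ((k * (m : ZMod q)).valMinAbs.natAbs : ℝ))) *
              (q / (2 * ((k * (m' : ZMod q)).valMinAbs.natAbs : ℝ))) :=
              mul_le_mul (min_le_right _ _) (min_le_right _ _) (hM0 _ _) (by positivity)
          _ = (q : ℝ) ^ 2 * (m * m') * (1 / ((((k * (m : ZMod q)).valMinAbs.natAbs : ℝ) * m') *
                (((k * (m' : ZMod q)).valMinAbs.natAbs : ℝ) * m))) / 4 := by field_simp; ring
          _ ≤ (q : ℝ) ^ 2 * (m * m') * (1 / ((((k * (m : ZMod q)).valMinAbs.natAbs : ℝ) * m') *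
                (((k * (m' : ZMod q)).valMinAbs.natAbs : ℝ) * m))) := by
              have : 0 ≤ (q : ℝ) ^ 2 * (m * m') * (1 / ((((k * (m : ZMod q)).valMinAbs.natAbs : ℝ) * m') *
                (((k * (m' : ZMod q)).valMinAbs.natAbs : ℝ) * m))) := by positivity
              linarith
          _ ≤ _ := by push_cast; gcongr
    · rintro ⟨s₁, s₂⟩ _
      simp only [hg]
      split_ifs <;> positivity
  have hlog : (1 + Real.log (2 * Z : ℕ)) ≤ (Cl * (2 : ℝ) ^ (ε / 4)) * (Z : ℝ) ^ (ε / 4) := by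
    have := hl (2 * Z : ℕ) (by exact_mod_cast (by omega : 1 ≤ 2 * Z))
    rw [mul_assoc, ← Real.mul_rpow (by norm_num) (by positivity)]
    exact_mod_cast this
  have hlog1 : 1 ≤ 1 + Real.log (2 * Z : ℕ) := by
    have := Real.log_natCast_nonneg (2 * Z); linarith
  have hYsum : ∑ y ∈ Y, g y ≤ 9 * (1 + Real.log (2 * Z : ℕ)) ^ 2 * (N * q) := by
    rw [hY, Finset.filter_or, Finset.sum_union (by
      rw [Finset.disjoint_filter]; intro x _ h; simp [h])]
    have hA : ∑ y ∈ (Finset.Icc 1 Z ×ˢ Finset.Icc 1 Z).filter (fun x => x.1 = x.2), g y ≤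
        (N * q) * (1 + Real.log (2 * Z : ℕ)) := by
      calc _ ≤ ∑ a ∈ Finset.Icc 1 Z, N * q / (a : ℝ) := by
            refine sum_le_sum_of_injOn Prod.fst ?_ ?_ ?_ (fun _ _ => by positivity)
            · rintro ⟨a, b⟩ h
              simp only [Finset.mem_filter, Finset.mem_product] at h
              exact h.1.1
            · rintro ⟨a, b⟩ h ⟨c, d⟩ h' e
              simp only [Finset.coe_filter, Set.mem_ofPred_eq] at h h' e
              rw [Prod.mk.injEq]; omega
            · rintro ⟨a, b⟩ h
              simp only [Finset.mem_filter] at h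
              simp [hg, h.2]
        _ = (N * q) * ∑ a ∈ Finset.Icc 1 Z, 1 / (a : ℝ) := by
            rw [Finset.mul_sum]; exact Finset.sum_congr rfl fun _ _ => by ring
        _ ≤ _ := by
            gcongr
            refine le_trans (Finset.sum_le_sum_of_subset_of_nonneg
              (Finset.Icc_subset_Icc_right (by omega)) (fun _ _ _ => by positivity))
              (sum_Icc_one_div_le (2 * Z))
    have hB : ∑ y ∈ (Finset.Icc 1 Z ×ˢ Finset.Icc 1 Z).filter
        (fun x => x.1 ≠ x.2 ∧ ((q : ℤ) ∣ x.1 - x.2 ∨ (q : ℤ) ∣ x.1 + x.2)), g y ≤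
        (q : ℝ) ^ 2 * N * (8 / q * (1 + Real.log (2 * Z : ℕ)) ^ 2) := by
      refine le_trans (le_of_eq ?_) (mul_le_mul_of_nonneg_left (sum_one_div_mul_le q hq0 Z)
        (by positivity))
      rw [Finset.mul_sum]
      refine Finset.sum_congr rfl fun x hx => ?_
      rw [Finset.mem_filter] at hx
      simp only [hg, if_neg hx.2.1]
    refine (add_le_add hA hB).trans ?_
    have e : (q : ℝ) ^ 2 * N * (8 / q * (1 + Real.log (2 * Z : ℕ)) ^ 2) =
      8 * (1 + Real.log (2 * Z : ℕ)) ^ 2 * (N * q) := by field_simp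
    rw [e]
    have : (1 + Real.log (2 * Z : ℕ)) ≤ (1 + Real.log (2 * Z : ℕ)) ^ 2 := by nlinarith
    have hNq : 0 ≤ (N : ℝ) * q := by positivity
    nlinarith [mul_le_mul_of_nonneg_left this hNq]
  rw [hLHS]
  calc _ ≤ _ := hmain
    _ ≤ (2 * (Cd * (Z : ℝ) ^ (ε / 4)) ^ 2) *
        (9 * ((Cl * (2 : ℝ) ^ (ε / 4)) * (Z : ℝ) ^ (ε / 4)) ^ 2 * (N * q)) := by
        refine mul_le_mul_of_nonneg_left (hYsum.trans ?_) (by positivity)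
        gcongr
    _ = 2 * Cd ^ 2 * (9 * (Cl * (2 : ℝ) ^ (ε / 4)) ^ 2) * ((Z : ℝ) ^ (ε / 4)) ^ 4 * (N * q) := by
        ring
    _ = _ := by
        congr 2
        rw [← Real.rpow_natCast, ← Real.rpow_mul (by positivity), hZ]
        push_cast
        congr 1; ring

/-- The variance of the divisor function over reduced residue classes. -/
lemma variance_divisorSumAP_le {ε : ℝ} (hε : 0 < ε) :
    ∃ C : ℝ, 0 < C ∧ ∀ (q : ℕ) [NeZero q] (N : ℕ), 1 ≤ N → ∃ c : ℝ,
      ∑ b : (ZMod q)ˣ,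
        (divisorSumAP q N b - c) ^ 2 ≤ C * (q * N : ℝ) ^ ε * N := by
  obtain ⟨C, hC, h⟩ := sum_sq_sum_min_le hε
  refine ⟨9 * C, by positivity, fun q _ N hN => ?_⟩
  have hq : (0 : ℝ) < q := by exact_mod_cast NeZero.pos q
  set F : ZMod q → ℝ := fun b => ∑ m ∈ (Finset.Icc 1 N.sqrt).filter (fun m => m.Coprime q),
      (2 * (∑ n ∈ Finset.Icc 1 (N / m), if (n : ZMod q) * (m : ZMod q) = b then (1 : ℝ) else 0) -
        ∑ n ∈ Finset.Icc 1 N.sqrt, if (n : ZMod q) * (m : ZMod q) = b then (1 : ℝ) else 0) with hF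
  refine ⟨(∑ b, F b) / q, ?_⟩
  have h1 : ∑ b : (ZMod q)ˣ,
      (divisorSumAP q N b - (∑ b, F b) / q) ^ 2 ≤ ∑ b : ZMod q, (F b - (∑ b, F b) / q) ^ 2 := by
    refine sum_le_sum_of_injOn (fun b : (ZMod q)ˣ => (b : ZMod q)) (fun _ _ => Finset.mem_univ _)
      (fun a _ b _ h => Units.ext h) (fun b _ => ?_) (fun _ _ => sq_nonneg _)
    rw [divisorSumAP_eq q N b b.isUnit]
  have h2 : ∑ b : ZMod q, (F b - (∑ b, F b) / q) ^ 2 =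
      ∑ b : ZMod q, F b ^ 2 - (∑ b, F b) ^ 2 / q := by
    simp_rw [sub_sq, Finset.sum_add_distrib, Finset.sum_sub_distrib]
    rw [← Finset.sum_mul, ← Finset.mul_sum]
    simp [ZMod.card]
    field_simp
    ring
  have h3 := ZMod.sum_norm_sq_sum_stdAddChar q F
  rw [← Finset.add_sum_erase _ _ (Finset.mem_univ (0 : ZMod q))] at h3
  have h4 : ‖∑ b : ZMod q, (F b : ℂ) * ZMod.stdAddChar (b * 0)‖ ^ 2 = (∑ b, F b) ^ 2 := by
    simp only [mul_zero, AddChar.map_zero_eq_one, mul_one]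
    rw [← Complex.ofReal_sum, Complex.norm_real, Real.norm_eq_abs, sq_abs]
  have h5 : ∑ k ∈ (Finset.univ : Finset (ZMod q)).erase 0,
      ‖∑ b : ZMod q, (F b : ℂ) * ZMod.stdAddChar (b * k)‖ ^ 2 ≤
      9 * (C * (q * N : ℝ) ^ ε * (N * q)) := by
    refine le_trans ?_ (mul_le_mul_of_nonneg_left (h q N hN) (by norm_num))
    rw [Finset.mul_sum]
    refine Finset.sum_le_sum fun k hk => ?_
    rw [← (by norm_num : (3 : ℝ) ^ 2 = 9), ← mul_pow]
    refine pow_le_pow_left₀ (norm_nonneg _) ?_ 2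
    have e : ∑ b : ZMod q, (F b : ℂ) * ZMod.stdAddChar (b * k) =
        ∑ m ∈ (Finset.Icc 1 N.sqrt).filter (fun m => m.Coprime q),
          (2 * (∑ n ∈ Finset.Icc 1 (N / m), ZMod.stdAddChar ((n : ZMod q) * (k * (m : ZMod q)))) -
          ∑ n ∈ Finset.Icc 1 N.sqrt, ZMod.stdAddChar ((n : ZMod q) * (k * (m : ZMod q)))) := by
      simp only [hF, Complex.ofReal_sum, Finset.sum_mul]
      rw [Finset.sum_comm]
      refine Finset.sum_congr rfl fun m _ => ?_
      rw [← sum_mul_stdAddChar_of_count, ← sum_mul_stdAddChar_of_count, Finset.mul_sum,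
        ← Finset.sum_sub_distrib]
      refine Finset.sum_congr rfl fun b _ => ?_
      push_cast
      ring
    rw [e, Finset.mul_sum]
    refine (norm_sum_le _ _).trans (Finset.sum_le_sum fun m hm => ?_)
    simp only [Finset.mem_filter, Finset.mem_Icc] at hm
    obtain ⟨⟨hm1, hm2⟩, hm3⟩ := hm
    have hm0 : (0 : ℝ) < m := by exact_mod_cast hm1
    have hne : k * (m : ZMod q) ≠ 0 := by
      intro h0
      have hu : IsUnit (m : ZMod q) := (ZMod.isUnit_iff_coprime m q).2 hm3
      exact (Finset.mem_erase.1 hk).1 ((hu.mul_left_eq_zero).1 h0)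
    have hb1 : ‖∑ n ∈ Finset.Icc 1 (N / m), ZMod.stdAddChar ((n : ZMod q) * (k * (m : ZMod q)))‖ ≤
        min ((N : ℝ) / m) (q / (2 * ((k * (m : ZMod q)).valMinAbs.natAbs : ℝ))) :=
      le_min ((ZMod.norm_sum_stdAddChar_le_card q _ _).trans Nat.cast_div_le)
        (ZMod.norm_sum_stdAddChar_le q _ hne _)
    have hb2 : ‖∑ n ∈ Finset.Icc 1 N.sqrt, ZMod.stdAddChar ((n : ZMod q) * (k * (m : ZMod q)))‖ ≤
        min ((N : ℝ) / m) (q / (2 * ((k * (m : ZMod q)).valMinAbs.natAbs : ℝ))) := by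
      refine le_min ((ZMod.norm_sum_stdAddChar_le_card q _ _).trans ?_)
        (ZMod.norm_sum_stdAddChar_le q _ hne _)
      rw [le_div_iff₀ hm0]
      exact_mod_cast (Nat.mul_le_mul_left _ hm2).trans (Nat.sqrt_le N)
    calc _ ≤ ‖2 * (∑ n ∈ Finset.Icc 1 (N / m), ZMod.stdAddChar ((n : ZMod q) * (k * (m : ZMod q))))‖ +
          ‖∑ n ∈ Finset.Icc 1 N.sqrt, ZMod.stdAddChar ((n : ZMod q) * (k * (m : ZMod q)))‖ := norm_sub_le _ _
      _ ≤ _ := by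
        rw [norm_mul, Complex.norm_ofNat]; linarith
  have h6 : ∑ b : ZMod q, (F b - (∑ b, F b) / q) ^ 2 ≤ 9 * C * (q * N : ℝ) ^ ε * N := by
    rw [h2]
    have : (q : ℝ) * (∑ b : ZMod q, F b ^ 2 - (∑ b, F b) ^ 2 / q) ≤
        q * (9 * C * (q * N : ℝ) ^ ε * N) := by
      rw [mul_sub, mul_div_cancel₀ _ hq.ne']
      rw [h4] at h3
      linarith
    exact le_of_mul_le_mul_left this hq
  exact h1.trans h6

lemma card_filter_Ioc_zmod_le (q : ℕ) [NeZero q] (A B : ℕ) (b : ZMod q) :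
    ((Finset.Ioc A B).filter (fun n : ℕ => (n : ZMod q) = b)).card ≤ (B - A) / q + 1 := by
  have hq := NeZero.pos q
  rw [← Finset.card_range ((B - A) / q + 1)]
  refine Finset.card_le_card_of_injOn (fun n => (n - A) / q) ?_ ?_
  · intro n hn
    simp only [Finset.coe_filter, Set.mem_ofPred_eq, Finset.mem_Ioc] at hn
    simp only [Finset.coe_range, Set.mem_Iio]
    exact Nat.lt_succ_of_le (Nat.div_le_div_right (by omega))
  · intro n hn m hm e
    simp only [Finset.coe_filter, Set.mem_ofPred_eq, Finset.mem_Ioc] at hn hm e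
    have h1 : n ≡ m [MOD q] := (ZMod.natCast_eq_natCast_iff _ _ _).1 (hn.2.trans hm.2.symm)
    have h2 : n - A ≡ m - A [MOD q] := by
      have : (n - A) + A ≡ (m - A) + A [MOD q] := by
        rwa [Nat.sub_add_cancel hn.1.1.le, Nat.sub_add_cancel hm.1.1.le]
      exact Nat.ModEq.add_right_cancel' A this
    have h3 : n - A = m - A := by
      rw [← Nat.div_add_mod (n - A) q, ← Nat.div_add_mod (m - A) q, e, h2]
    omega

lemma card_filter_Ioc_zmod_le_real (q : ℕ) [NeZero q] (A B : ℕ) (hAB : A ≤ B) (b : ZMod q) :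
    (((Finset.Ioc A B).filter (fun n : ℕ => (n : ZMod q) = b)).card : ℝ) ≤
      ((B : ℝ) - A) / q + 1 := by
  calc _ ≤ (((B - A) / q + 1 : ℕ) : ℝ) := by exact_mod_cast card_filter_Ioc_zmod_le q A B b
    _ ≤ _ := by
      push_cast
      have := Nat.cast_div_le (α := ℝ) (m := B - A) (n := q)
      rw [Nat.cast_sub hAB] at this
      linarith

lemma sum_Icc_eq_add_sum_Ioc (f : ℕ → ℝ) {A B : ℕ} (hAB : A ≤ B) :
    ∑ n ∈ Finset.Icc 1 B, f n = ∑ n ∈ Finset.Icc 1 A, f n + ∑ n ∈ Finset.Ioc A B, f n := by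
  rw [← Finset.sum_union]
  · congr 1
    ext n
    simp only [Finset.mem_union, Finset.mem_Icc, Finset.mem_Ioc]
    omega
  · rw [Finset.disjoint_left]
    intro n
    simp only [Finset.mem_Icc, Finset.mem_Ioc]
    omega

/-- A sum over part of a residue class of a function bounded by `M`. -/
lemma abs_sum_Ioc_ite_le (q : ℕ) [NeZero q] {A B : ℕ} (hAB : A ≤ B) (b : ZMod q) (f : ℕ → ℝ) (M : ℝ)
    (hf : ∀ n ∈ Finset.Ioc A B, |f n| ≤ M) (hM : 0 ≤ M) :
    |∑ n ∈ Finset.Ioc A B, if (n : ZMod q) = b then f n else 0| ≤ M * (((B : ℝ) - A) / q + 1) := by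
  rw [← Finset.sum_filter]
  refine (Finset.abs_sum_le_sum_abs _ _).trans ?_
  calc _ ≤ ∑ n ∈ (Finset.Ioc A B).filter (fun n : ℕ => (n : ZMod q) = b), M :=
        Finset.sum_le_sum fun n hn => hf n (Finset.mem_filter.1 hn).1
    _ = M * (((Finset.Ioc A B).filter (fun n : ℕ => (n : ZMod q) = b)).card : ℝ) := by
        rw [Finset.sum_const, nsmul_eq_mul, mul_comm]
    _ ≤ _ := by
        gcongr
        exact card_filter_Ioc_zmod_le_real q A B hAB b

/-- The unit of `ZMod q` given by `u`, or `1` if `u` is not coprime to `q`. -/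
noncomputable def natUnit (q u : ℕ) : (ZMod q)ˣ :=
  if h : u.Coprime q then ZMod.unitOfCoprime u h else 1

lemma coe_natUnit {q u : ℕ} (h : u.Coprime q) : ((natUnit q u : (ZMod q)ˣ) : ZMod q) = u := by
  rw [natUnit, dif_pos h, ZMod.coe_unitOfCoprime]

/-- The sum of `d4` over `n ≤ N` in the residue class `b`. -/
noncomputable def d4SumAP (q N : ℕ) (b : ZMod q) : ℝ :=
  ∑ n ∈ Finset.Icc 1 N, if (n : ZMod q) = b then (d4 n : ℝ) else 0

lemma d4SumAP_eq (q : ℕ) [NeZero q] (N : ℕ) (a : (ZMod q)ˣ) :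
    d4SumAP q N a = ∑ u ∈ (Finset.Icc 1 N.sqrt).filter (fun u => u.Coprime q),
      (u.divisors.card : ℝ) * (2 * divisorSumAP q (N / u) ((a * (natUnit q u)⁻¹ : (ZMod q)ˣ)) -
        divisorSumAP q N.sqrt ((a * (natUnit q u)⁻¹ : (ZMod q)ˣ))) := by
  have h1 : d4SumAP q N a = ∑ n ∈ Finset.Icc 1 N, ∑ p ∈ n.divisorsAntidiagonal,
      if (p.1 : ZMod q) * (p.2 : ZMod q) = a then
        (p.1.divisors.card : ℝ) * (p.2.divisors.card : ℝ) else 0 := by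
    refine Finset.sum_congr rfl fun n hn => ?_
    have hn0 : n ≠ 0 := by rw [Finset.mem_Icc] at hn; omega
    rw [d4_eq_sum_divisorsAntidiagonal n hn0]
    split_ifs with h
    · push_cast
      refine Finset.sum_congr rfl fun p hp => ?_
      rw [if_pos]
      rw [← h, ← (Nat.mem_divisorsAntidiagonal.1 hp).1]
      push_cast; rfl
    · symm
      refine Finset.sum_eq_zero fun p hp => ?_
      rw [if_neg]
      rw [← (Nat.mem_divisorsAntidiagonal.1 hp).1] at h
      push_cast at h; exact h
  rw [h1, sum_hyperbola (fun u v => if (u : ZMod q) * (v : ZMod q) = a then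
        (u.divisors.card : ℝ) * (v.divisors.card : ℝ) else 0)
    (fun u v => by simp only [mul_comm])]
  rw [Finset.mul_sum, ← Finset.sum_sub_distrib, Finset.sum_filter]
  refine Finset.sum_congr rfl fun u _ => ?_
  split_ifs with hu
  · have key : ∀ V : ℕ, (∑ v ∈ Finset.Icc 1 V, if (u : ZMod q) * (v : ZMod q) = a then
        (u.divisors.card : ℝ) * (v.divisors.card : ℝ) else 0) =
        (u.divisors.card : ℝ) * divisorSumAP q V ((a * (natUnit q u)⁻¹ : (ZMod q)ˣ)) := by
      intro V
      rw [divisorSumAP, Finset.mul_sum]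
      refine Finset.sum_congr rfl fun v _ => ?_
      have : ((u : ZMod q) * (v : ZMod q) = a) ↔
          ((v : ZMod q) = ((a * (natUnit q u)⁻¹ : (ZMod q)ˣ) : ZMod q)) := by
        rw [Units.val_mul, Units.eq_mul_inv_iff_mul_eq, coe_natUnit hu, mul_comm]
      simp only [this, mul_ite, mul_zero]
    rw [key, key]
    ring
  · have hz : ∀ v : ℕ, ¬ ((u : ZMod q) * (v : ZMod q) = a) := fun v h =>
      hu ((ZMod.isUnit_iff_coprime u q).1 (isUnit_of_mul_isUnit_left (h ▸ a.isUnit)))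
    simp [hz]

/-- Mean square of the error terms along a geometric subdivision of the range of `u`. -/
lemma sum_mul_sq_grid_le (q : ℕ) [NeZero q] {R δ : ℝ} (hR : 1 ≤ R) (hδ : δ = q / R) (hδ1 : δ ≤ 1)
    (a : (ZMod q)ˣ) (U : Finset ℕ) (hU : ∀ u ∈ U, 1 ≤ u ∧ (u : ℝ) ≤ R ∧ u.Coprime q)
    (E : ℕ → (ZMod q)ˣ → ℝ) (W : ℝ) (hW : ∀ i ≤ ⌊Real.log R / δ⌋₊,
      ∑ b, E i b ^ 2 ≤ W * Real.exp (-(i * δ))) (hW0 : 0 ≤ W) :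
    ∑ u ∈ U, (u : ℝ) * E ⌊Real.log u / δ⌋₊ (a * (natUnit q u)⁻¹) ^ 2 ≤
      12 * W * ((1 + Real.log R) * R / q) := by
  have hq : (0 : ℝ) < q := by exact_mod_cast NeZero.pos q
  have hδ0 : 0 < δ := by rw [hδ]; positivity
  have hδR : δ * R = q := by rw [hδ]; field_simp
  set I := ⌊Real.log R / δ⌋₊ with hI
  have hlogR : 0 ≤ Real.log R := Real.log_nonneg hR
  have hi1 : ∀ u ∈ U, Real.exp (⌊Real.log u / δ⌋₊ * δ) ≤ u := by
    intro u hu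
    have hu0 : (1 : ℝ) ≤ u := by exact_mod_cast (hU u hu).1
    rw [← Real.le_log_iff_exp_le (by linarith), ← le_div_iff₀ hδ0]
    exact Nat.floor_le (div_nonneg (Real.log_nonneg hu0) hδ0.le)
  have hi2 : ∀ u ∈ U, (u : ℝ) ≤ Real.exp ((⌊Real.log u / δ⌋₊ + 1) * δ) := by
    intro u hu
    have hu0 : (1 : ℝ) ≤ u := by exact_mod_cast (hU u hu).1
    rw [← Real.log_le_iff_le_exp (by linarith), ← div_le_iff₀ hδ0]
    exact (Nat.lt_floor_add_one _).le
  have hexp : Real.exp δ ≤ 1 + 2 * δ := by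
    have := Real.abs_exp_sub_one_le (x := δ) (by rw [abs_of_pos hδ0]; exact hδ1)
    rw [abs_of_pos hδ0] at this
    linarith [le_abs_self (Real.exp δ - 1)]
  have hmain : ∑ u ∈ U, (u : ℝ) * E ⌊Real.log u / δ⌋₊ (a * (natUnit q u)⁻¹) ^ 2 ≤
      4 * ∑ y ∈ Finset.range (I + 1) ×ˢ (Finset.univ : Finset (ZMod q)ˣ),
        Real.exp ((y.1 + 1) * δ) * E y.1 y.2 ^ 2 := by
    refine sum_le_mul_sum_of_fiber_card_le
      (fun u : ℕ => (⌊Real.log u / δ⌋₊, a * (natUnit q u)⁻¹)) 4 ?_ ?_ ?_ ?_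
    · intro u hu
      have hu0 : (1 : ℝ) ≤ u := by exact_mod_cast (hU u hu).1
      simp only [Finset.mem_product, Finset.mem_range, Finset.mem_univ, and_true]
      refine Nat.lt_succ_of_le (Nat.floor_le_floor ?_)
      have := Real.log_le_log (by linarith) (hU u hu).2.1
      gcongr
    · rintro ⟨i, b⟩ _
      set A := ⌈Real.exp (i * δ)⌉₊ - 1 with hA
      set B := ⌊min R (Real.exp ((i + 1) * δ))⌋₊ with hB
      have hsub : U.filter (fun u : ℕ => (⌊Real.log u / δ⌋₊, a * (natUnit q u)⁻¹) = (i, b)) ⊆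
          (Finset.Ioc A B).filter (fun u : ℕ => (u : ZMod q) = ((b⁻¹ * a : (ZMod q)ˣ) : ZMod q)) := by
        intro u hu
        rw [Finset.mem_filter, Prod.mk.injEq] at hu
        obtain ⟨huU, h1, h2⟩ := hu
        have h3 := hi1 u huU
        have h4 := hi2 u huU
        rw [h1] at h3 h4
        have h5 : ⌈Real.exp (i * δ)⌉₊ ≤ u := Nat.ceil_le.2 h3
        have h6 : 0 < ⌈Real.exp (i * δ)⌉₊ := Nat.ceil_pos.2 (Real.exp_pos _)
        have h7 : u ≤ B := Nat.le_floor (le_min (hU u huU).2.1 h4)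
        rw [Finset.mem_filter, Finset.mem_Ioc]
        refine ⟨⟨by omega, h7⟩, ?_⟩
        rw [← coe_natUnit (hU u huU).2.2, ← h2]
        congr 1
        group
      rcases Finset.eq_empty_or_nonempty
        (U.filter (fun u : ℕ => (⌊Real.log u / δ⌋₊, a * (natUnit q u)⁻¹) = (i, b))) with he | hne
      · rw [he]; norm_num
      obtain ⟨u, hu⟩ := hne
      have hAB : A ≤ B := by
        have := hsub hu
        rw [Finset.mem_filter, Finset.mem_Ioc] at this
        omega
      have hexpR : Real.exp (i * δ) ≤ R := by
        rw [Finset.mem_filter, Prod.mk.injEq] at hu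
        have h3 := hi1 u hu.1
        rw [hu.2.1] at h3
        exact h3.trans (hU u hu.1).2.1
      calc _ ≤ (((Finset.Ioc A B).filter (fun u : ℕ => (u : ZMod q) =
            ((b⁻¹ * a : (ZMod q)ˣ) : ZMod q))).card : ℝ) := by
              exact_mod_cast Finset.card_le_card hsub
        _ ≤ ((B : ℝ) - A) / q + 1 := card_filter_Ioc_zmod_le_real q A B hAB _
        _ ≤ 4 := by
          have h1 : (B : ℝ) ≤ Real.exp ((i + 1) * δ) :=
            (Nat.floor_le (le_min (by linarith) (Real.exp_pos _).le)).trans (min_le_right _ _)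
          have h2 : Real.exp (i * δ) - 1 ≤ A := by
            have h6 : 1 ≤ ⌈Real.exp (i * δ)⌉₊ := Nat.ceil_pos.2 (Real.exp_pos _)
            rw [hA, Nat.cast_sub h6]
            push_cast
            linarith [Nat.le_ceil (Real.exp (i * δ))]
          have h3 : Real.exp ((i + 1) * δ) = Real.exp (i * δ) * Real.exp δ := by
            rw [← Real.exp_add]; ring_nf
          have h4 : Real.exp (i * δ) * Real.exp δ ≤ Real.exp (i * δ) * (1 + 2 * δ) := by gcongr
          have h5 : Real.exp (i * δ) * (2 * δ) ≤ R * (2 * δ) := by gcongr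
          have h7 : (1 : ℝ) ≤ q := by exact_mod_cast NeZero.pos q
          have : ((B : ℝ) - A) / q ≤ 3 := by
            rw [div_le_iff₀ hq]
            nlinarith
          linarith
    · intro u hu
      have := hi2 u hu
      dsimp only
      gcongr
    · intro y _
      positivity
  refine hmain.trans ?_
  rw [Finset.sum_product]
  have hstep : ∀ i ∈ Finset.range (I + 1), ∑ b : (ZMod q)ˣ, Real.exp ((i + 1) * δ) * E i b ^ 2 ≤
      3 * W := by
    intro i hi
    rw [← Finset.mul_sum]
    have h1 := hW i (Nat.lt_succ_iff.1 (Finset.mem_range.1 hi))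
    calc _ ≤ Real.exp ((i + 1) * δ) * (W * Real.exp (-(i * δ))) := by gcongr
      _ = W * Real.exp δ := by
        rw [mul_left_comm, ← Real.exp_add]; ring_nf
      _ ≤ W * 3 := by gcongr; linarith
      _ = _ := by ring
  calc 4 * ∑ i ∈ Finset.range (I + 1), ∑ b : (ZMod q)ˣ, Real.exp ((i + 1) * δ) * E i b ^ 2
      ≤ 4 * ∑ i ∈ Finset.range (I + 1), 3 * W := by gcongr with i hi; exact hstep i hi
    _ = 12 * W * (I + 1) := by
        rw [Finset.sum_const, Finset.card_range, nsmul_eq_mul]; push_cast; ring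
    _ ≤ 12 * W * ((1 + Real.log R) * R / q) := by
        gcongr
        have h1 : (I : ℝ) ≤ Real.log R / δ := Nat.floor_le (by positivity)
        have h2 : Real.log R / δ = Real.log R * R / q := by rw [hδ]; field_simp
        have h3 : 1 ≤ R / q := by
          rw [one_le_div hq, ← hδR]; nlinarith
        calc (I : ℝ) + 1 ≤ Real.log R * R / q + R / q := by linarith
          _ = _ := by ring

lemma sum_sq_le_of_fiber (q : ℕ) [NeZero q] (a : (ZMod q)ˣ) (s : ℕ) (E : (ZMod q)ˣ → ℝ) :
    ∑ u ∈ (Finset.Icc 1 s).filter (fun u => u.Coprime q), E (a * (natUnit q u)⁻¹) ^ 2 ≤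
      ((s : ℝ) / q + 1) * ∑ b, E b ^ 2 := by
  refine sum_le_mul_sum_of_fiber_card_le (fun u => a * (natUnit q u)⁻¹) _
    (fun _ _ => Finset.mem_univ _) ?_ (fun _ _ => le_rfl) (fun _ _ => sq_nonneg _)
  intro b _
  have := card_filter_Ioc_zmod_le_real q 0 s (Nat.zero_le _) ((b⁻¹ * a : (ZMod q)ˣ) : ZMod q)
  rw [Nat.cast_zero, sub_zero] at this
  refine le_trans ?_ this
  have hsub : ((Finset.Icc 1 s).filter (fun u => u.Coprime q)).filter
      (fun u => a * (natUnit q u)⁻¹ = b) ⊆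
      (Finset.Ioc 0 s).filter (fun u : ℕ => (u : ZMod q) = ((b⁻¹ * a : (ZMod q)ˣ) : ZMod q)) := by
    intro u hu
    simp only [Finset.mem_filter, Finset.mem_Icc, Finset.mem_Ioc] at hu ⊢
    refine ⟨⟨by omega, hu.1.1.2⟩, ?_⟩
    rw [← coe_natUnit hu.1.2, ← hu.2]
    congr 1
    group
  exact_mod_cast Finset.card_le_card hsub

lemma abs_sum_mul_le_of_sq {ι : Type*} (s : Finset ι) (f g : ι → ℝ) (A B : ℝ)
    (hf : ∑ i ∈ s, f i ^ 2 ≤ A) (hg : ∑ i ∈ s, g i ^ 2 ≤ B) :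
    (∑ i ∈ s, f i * g i) ^ 2 ≤ A * B :=
  (Finset.sum_mul_sq_le_sq_mul_sq s f g).trans
    (mul_le_mul hf hg (Finset.sum_nonneg fun _ _ => sq_nonneg _)
      ((Finset.sum_nonneg fun _ _ => sq_nonneg _).trans hf))

set_option maxHeartbeats 1600000 in
/-- Equidistribution of `d4` in reduced residue classes, up to a main term which does not depend
on the class. -/
lemma d4SumAP_sub_const_le {ε : ℝ} (hε : 0 < ε) :
    ∃ C : ℝ, 0 < C ∧ ∀ (q : ℕ) [NeZero q] (X : ℕ), 1 ≤ X → ∃ K : ℝ, ∀ a : (ZMod q)ˣ,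
      |d4SumAP q X a - K| ≤ C * (X : ℝ) ^ ε * ((X : ℝ) ^ (3 / 4 : ℝ) / Real.sqrt q + 1) := by
  set η := ε / 3 with hη
  have hη0 : 0 < η := by positivity
  obtain ⟨Cd, hCd, hd⟩ := card_divisors_le_rpow hη0
  obtain ⟨C4, hC4, h4⟩ := d4_le_rpow hε
  obtain ⟨Cl, hCl, hl⟩ := one_add_log_le_rpow hη0
  obtain ⟨Cv, hCv, hv⟩ := variance_divisorSumAP_le hη0
  set M := Cd ^ 2 * (12 * Cv) * Cl ^ 2 with hM
  set C₀ := 2 * (Cd ^ 2 * (4 * Cl)) + 2 * Real.sqrt M + Real.sqrt (2 * Cv * Cd ^ 2) with hC₀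
  refine ⟨C₀ + C4, by positivity, fun q _ X hX => ?_⟩
  have hq0 := NeZero.pos q
  have hq : (0 : ℝ) < q := by exact_mod_cast hq0
  have hX1 : (1 : ℝ) ≤ X := by exact_mod_cast hX
  have hX0 : (0 : ℝ) < X := by linarith
  set R := Real.sqrt X with hR
  have hR1 : 1 ≤ R := Real.one_le_sqrt.2 hX1
  have hRR : R * R = X := Real.mul_self_sqrt hX0.le
  set T := (X : ℝ) ^ η with hT
  have hT1 : 1 ≤ T := Real.one_le_rpow hX1 hη0.le
  have hT3 : (X : ℝ) ^ ε = T ^ 3 := by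
    rw [hT, ← Real.rpow_natCast, ← Real.rpow_mul hX0.le, hη]; congr 1; push_cast; ring
  set y := (X : ℝ) ^ (3 / 4 : ℝ) / Real.sqrt q with hy
  have hy0 : 0 < y := by positivity
  have hy2 : y ^ 2 = X * R / q := by
    rw [hy, div_pow, Real.sq_sqrt hq.le, hR, Real.sqrt_eq_rpow, ← Real.rpow_natCast,
      ← Real.rpow_mul hX0.le]
    nth_rw 2 [← Real.rpow_one (X : ℝ)]
    rw [← Real.rpow_add hX0]
    norm_num
  have hT0 : 0 < T := by positivity
  have hR0 : 0 < R := by positivity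
  have hM0 : 0 ≤ M := by positivity
  have hC₀0 : 0 ≤ C₀ := by positivity
  clear_value η M C₀ R T y
  rcases lt_or_ge R q with hqR | hqR
  · refine ⟨0, fun a => ?_⟩
    rw [sub_zero]
    have h1 := abs_sum_Ioc_ite_le q (Nat.zero_le X) (a : ZMod q) (fun n => (d4 n : ℝ))
      (C4 * (X : ℝ) ^ ε) (fun n hn => by
        rw [Finset.mem_Ioc] at hn
        rw [Nat.abs_cast]
        refine (h4 n (by omega)).trans ?_
        have : (n : ℝ) ≤ X := by exact_mod_cast hn.2
        gcongr) (by positivity)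
    have h2 : Finset.Ioc 0 X = Finset.Icc 1 X := by ext; simp [Nat.lt_iff_add_one_le]
    rw [h2, Nat.cast_zero, sub_zero] at h1
    have h3 : (X : ℝ) / q ≤ y := by
      refine (sq_le_sq₀ (by positivity) hy0.le).1 ?_
      rw [hy2, div_pow, div_le_div_iff₀ (by positivity) hq]
      calc (X : ℝ) ^ 2 * q = X * R * q * R := by rw [← hRR]; ring
        _ ≤ X * R * q * q := by gcongr
        _ = X * R * (q : ℝ) ^ 2 := by ring
    calc _ ≤ C4 * (X : ℝ) ^ ε * ((X : ℝ) / q + 1) := h1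
      _ ≤ (C₀ + C4) * (X : ℝ) ^ ε * (y + 1) := by
        gcongr
        linarith
  -- the main case: a small modulus
  choose c hc using fun N : {N : ℕ // 1 ≤ N} => hv q N.1 N.2
  set c' : ℕ → ℝ := fun N => if h : 1 ≤ N then c ⟨N, h⟩ else 0 with hc'
  have hvar : ∀ N : ℕ, 1 ≤ N → ∑ b : (ZMod q)ˣ, (divisorSumAP q N b - c' N) ^ 2 ≤
      Cv * (q * N : ℝ) ^ η * N := by
    intro N hN
    simp only [hc', dif_pos hN]
    exact hc ⟨N, hN⟩
  have hqX : (q : ℝ) ≤ X := by nlinarith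
  have hvar' : ∀ N : ℕ, 1 ≤ N → N ≤ X → ∑ b : (ZMod q)ˣ, (divisorSumAP q N b - c' N) ^ 2 ≤
      Cv * T ^ 2 * N := by
    intro N hN hNX
    refine (hvar N hN).trans ?_
    have h1 : (N : ℝ) ≤ X := by exact_mod_cast hNX
    have : (q * N : ℝ) ^ η ≤ T ^ 2 := by
      rw [hT, sq, ← Real.mul_rpow hX0.le hX0.le]
      gcongr
    gcongr
  obtain ⟨δ, hδ⟩ : ∃ δ, δ = (q : ℝ) / R := ⟨_, rfl⟩
  have hδ0 : 0 < δ := by rw [hδ]; positivity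
  have hδ1 : δ ≤ 1 := hδ ▸ (div_le_one (by linarith)).2 hqR
  set V : ℕ → ℕ := fun i => ⌊(X : ℝ) * Real.exp (-(i * δ))⌋₊ with hV
  set s := X.sqrt with hs
  have hs1 : 1 ≤ s := Nat.sqrt_pos.2 hX
  have hsR : (s : ℝ) ≤ R := hR ▸ Real.nat_sqrt_le_real_sqrt
  have hsX : s ≤ X := Nat.sqrt_le_self X
  set U := (Finset.Icc 1 s).filter (fun u => u.Coprime q) with hU
  have hUp : ∀ u ∈ U, 1 ≤ u ∧ (u : ℝ) ≤ R ∧ u.Coprime q := by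
    intro u hu
    simp only [hU, Finset.mem_filter, Finset.mem_Icc] at hu
    exact ⟨hu.1.1, le_trans (by exact_mod_cast hu.1.2) hsR, hu.2⟩
  have hVle : ∀ i, (V i : ℝ) ≤ X * Real.exp (-(i * δ)) := fun i => Nat.floor_le (by positivity)
  have hVX : ∀ i, V i ≤ X := by
    intro i
    have : (V i : ℝ) ≤ X := (hVle i).trans (mul_le_of_le_one_right hX0.le
      (Real.exp_le_one_iff.2 (by have : 0 ≤ i * δ := by positivity
                                 linarith)))
    exact_mod_cast this
  have hlogX : 0 ≤ Real.log X := Real.log_nonneg hX1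
  have hlogT : 1 + Real.log X ≤ Cl * T := hT ▸ hl X hX1
  have hlogRX : Real.log R ≤ Real.log X := Real.log_le_log (by linarith) (by nlinarith)
  have hClT : 1 ≤ Cl * T := by linarith
  have hτ : ∀ n : ℕ, 1 ≤ n → n ≤ X → (n.divisors.card : ℝ) ≤ Cd * T := by
    intro n hn hnX
    refine (hd n (by omega)).trans ?_
    have : (n : ℝ) ≤ X := by exact_mod_cast hnX
    rw [hT]
    gcongr
  have hUX : ∀ u ∈ U, u ≤ X := by
    intro u hu
    have : (u : ℝ) ≤ X := (hUp u hu).2.1.trans (by nlinarith)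
    exact_mod_cast this
  have hharm : ∑ u ∈ U, 1 / (u : ℝ) ≤ Cl * T := by
    refine le_trans (Finset.sum_le_sum_of_subset_of_nonneg (Finset.filter_subset _ _)
      (fun _ _ _ => by positivity)) ((sum_Icc_one_div_le s).trans (le_trans ?_ hlogT))
    have : Real.log s ≤ Real.log X := Real.log_le_log (by exact_mod_cast hs1) (by exact_mod_cast hsX)
    linarith
  have hRy : R ≤ y := by
    refine (sq_le_sq₀ (by positivity) hy0.le).1 ?_
    rw [hy2, le_div_iff₀ hq, sq, hRR]
    gcongr
  set ι : ℕ → ℕ := fun u => ⌊Real.log u / δ⌋₊ with hι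
  set K := ∑ u ∈ U, (u.divisors.card : ℝ) * (2 * c' (V (ι u)) - c' s) with hK
  refine ⟨K, fun a => ?_⟩
  set β : ℕ → (ZMod q)ˣ := fun u => a * (natUnit q u)⁻¹ with hβ
  have hdecomp : d4SumAP q X a - K =
      2 * ∑ u ∈ U, (u.divisors.card : ℝ) *
        (divisorSumAP q (X / u) (β u) - divisorSumAP q (V (ι u)) (β u)) +
      2 * ∑ u ∈ U, (u.divisors.card : ℝ) * (divisorSumAP q (V (ι u)) (β u) - c' (V (ι u))) -
      ∑ u ∈ U, (u.divisors.card : ℝ) * (divisorSumAP q s (β u) - c' s) := by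
    rw [d4SumAP_eq, hK, ← Finset.sum_sub_distrib, Finset.mul_sum, Finset.mul_sum,
      ← Finset.sum_add_distrib, ← Finset.sum_sub_distrib]
    refine Finset.sum_congr rfl fun u _ => ?_
    simp only [hβ]
    ring
  have hA1 : |∑ u ∈ U, (u.divisors.card : ℝ) *
        (divisorSumAP q (X / u) (β u) - divisorSumAP q (V (ι u)) (β u))| ≤
      Cd ^ 2 * (4 * Cl) * T ^ 3 * y := by
    have hterm : ∀ u ∈ U, |(u.divisors.card : ℝ) *
        (divisorSumAP q (X / u) (β u) - divisorSumAP q (V (ι u)) (β u))| ≤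
        (Cd * T) * ((Cd * T) * (2 * R * (1 / u) + 2)) := by
      intro u hu
      obtain ⟨hu1, huR, _⟩ := hUp u hu
      have hu1' : (1 : ℝ) ≤ u := by exact_mod_cast hu1
      have hu0 : (0 : ℝ) < u := by linarith
      have hlu := Real.log_nonneg hu1'
      have hι1 : (ι u : ℝ) * δ ≤ Real.log u := by
        rw [← le_div_iff₀ hδ0]; exact Nat.floor_le (by positivity)
      have hι2 : Real.log u ≤ (ι u + 1) * δ := by
        rw [← div_le_iff₀ hδ0]; exact (Nat.lt_floor_add_one _).le
      have hle : X / u ≤ V (ι u) := by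
        refine Nat.le_floor (Nat.cast_div_le.trans ?_)
        rw [div_eq_mul_inv]
        gcongr
        calc ((u : ℝ))⁻¹ = Real.exp (-Real.log u) := by rw [Real.exp_neg, Real.exp_log hu0]
          _ ≤ _ := Real.exp_le_exp.2 (neg_le_neg hι1)
      have hexp : Real.exp δ ≤ 1 + 2 * δ := by
        have := Real.abs_exp_sub_one_le (x := δ) (by rw [abs_of_pos hδ0]; exact hδ1)
        rw [abs_of_pos hδ0] at this
        linarith [le_abs_self (Real.exp δ - 1)]
      have hVu : (V (ι u) : ℝ) ≤ X / u * (1 + 2 * δ) := by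
        calc (V (ι u) : ℝ) ≤ X * Real.exp (-(ι u * δ)) := hVle _
          _ ≤ X * Real.exp (δ - Real.log u) := by gcongr; linarith
          _ = X / u * Real.exp δ := by
            rw [Real.exp_sub, Real.exp_log hu0]; ring
          _ ≤ _ := by gcongr
      have hdiv : (X : ℝ) / u - 1 ≤ ((X / u : ℕ) : ℝ) := by
        have h1 : X < u * (X / u + 1) := by
          have := Nat.lt_mul_div_succ X (show 0 < u from hu1)
          simpa using this
        have h2 : (X : ℝ) < u * (((X / u : ℕ) : ℝ) + 1) := by exact_mod_cast h1
        have : (X : ℝ) / u < ((X / u : ℕ) : ℝ) + 1 := by rw [div_lt_iff₀ hu0]; linarith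
        linarith
      have hlen : ((V (ι u) : ℝ) - ((X / u : ℕ) : ℝ)) / q + 1 ≤ 2 * R * (1 / u) + 2 := by
        have h1 : (V (ι u) : ℝ) - ((X / u : ℕ) : ℝ) ≤ 2 * δ * (X / u) + 1 := by linarith
        have h2 : 2 * δ * (X / u) = q * (2 * R * (1 / u)) := by
          rw [hδ, ← hRR]; field_simp
        have h3 : (1 : ℝ) ≤ q := by exact_mod_cast hq0
        have : ((V (ι u) : ℝ) - ((X / u : ℕ) : ℝ)) / q ≤ 2 * R * (1 / u) + 1 := by
          rw [div_le_iff₀ hq]; nlinarith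
        linarith
      rw [abs_mul, Nat.abs_cast]
      refine mul_le_mul (hτ u hu1 (hUX u hu)) ?_ (abs_nonneg _) (by positivity)
      rw [abs_sub_comm, divisorSumAP, divisorSumAP, sum_Icc_eq_add_sum_Ioc _ hle, add_sub_cancel_left]
      refine (abs_sum_Ioc_ite_le q hle _ _ (Cd * T) ?_ (by positivity)).trans ?_
      · intro n hn
        rw [Finset.mem_Ioc] at hn
        rw [Nat.abs_cast]
        exact hτ n ((Nat.zero_le _).trans_lt hn.1) (hn.2.trans (hVX _))
      · gcongr
    refine (Finset.abs_sum_le_sum_abs _ _).trans ((Finset.sum_le_sum hterm).trans ?_)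
    rw [← Finset.mul_sum, ← Finset.mul_sum, Finset.sum_add_distrib, ← Finset.mul_sum,
      Finset.sum_const, nsmul_eq_mul]
    have hcard : (U.card : ℝ) ≤ R := by
      refine le_trans ?_ hsR
      have : U.card ≤ s := (Finset.card_filter_le _ _).trans (by simp)
      exact_mod_cast this
    calc _ ≤ Cd * T * (Cd * T * (2 * R * (Cl * T) + R * (Cl * T) * 2)) := by
          gcongr
          exact hcard.trans (le_mul_of_one_le_right (by linarith) hClT)
      _ = Cd ^ 2 * (4 * Cl) * T ^ 3 * R := by ring
      _ ≤ _ := by gcongr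
  have hA2 : |∑ u ∈ U, (u.divisors.card : ℝ) *
      (divisorSumAP q (V (ι u)) (β u) - c' (V (ι u)))| ≤ Real.sqrt M * (T ^ 3 * y) := by
    have hf : ∑ u ∈ U, ((u.divisors.card : ℝ) / Real.sqrt u) ^ 2 ≤ (Cd * T) ^ 2 * (Cl * T) := by
      refine le_trans (Finset.sum_le_sum (g := fun u : ℕ => (Cd * T) ^ 2 * (1 / (u : ℝ))) ?_) ?_
      · intro u hu
        have hu0 : (0 : ℝ) ≤ u := by positivity
        rw [div_pow, Real.sq_sqrt hu0, div_eq_mul_one_div]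
        exact mul_le_mul_of_nonneg_right (pow_le_pow_left₀ (Nat.cast_nonneg _)
          (hτ u (hUp u hu).1 (hUX u hu)) 2) (by positivity)
      · rw [← Finset.mul_sum]
        exact mul_le_mul_of_nonneg_left hharm (sq_nonneg _)
    have hg := sum_mul_sq_grid_le q hR1 hδ hδ1 a U hUp
      (fun i b => divisorSumAP q (V i) b - c' (V i)) (Cv * T ^ 2 * X) (by
        intro i hi
        have hVi : 1 ≤ V i := by
          refine Nat.le_floor ?_
          have h1 : (i : ℝ) * δ ≤ Real.log R := by
            rw [← le_div_iff₀ hδ0]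
            exact (Nat.le_floor_iff (div_nonneg (Real.log_nonneg hR1) hδ0.le)).1 hi
          have h2 : Real.exp (-(Real.log R)) ≤ Real.exp (-(i * δ)) := by gcongr
          rw [Real.exp_neg, Real.exp_log (by linarith)] at h2
          have h3 : (1 : ℝ) ≤ X * R⁻¹ := by
            rw [← hRR, mul_assoc, mul_inv_cancel₀ (by linarith)]; linarith
          push_cast
          exact h3.trans (by gcongr)
        refine (hvar' (V i) hVi (hVX i)).trans ?_
        rw [mul_assoc _ (X : ℝ)]
        gcongr
        exact hVle i) (by positivity)
    have hg' : ∑ u ∈ U, (Real.sqrt u * (divisorSumAP q (V (ι u)) (β u) - c' (V (ι u)))) ^ 2 ≤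
        12 * (Cv * T ^ 2 * X) * ((Cl * T) * R / q) := by
      refine le_trans (le_of_eq ?_) (hg.trans ?_)
      · refine Finset.sum_congr rfl fun u _ => ?_
        rw [mul_pow, Real.sq_sqrt (by positivity)]
      · gcongr
        linarith
    have := abs_sum_mul_le_of_sq U _ _ _ _ hf hg'
    have heq : ∑ u ∈ U, (u.divisors.card : ℝ) / Real.sqrt u *
        (Real.sqrt u * (divisorSumAP q (V (ι u)) (β u) - c' (V (ι u)))) =
        ∑ u ∈ U, (u.divisors.card : ℝ) * (divisorSumAP q (V (ι u)) (β u) - c' (V (ι u))) := by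
      refine Finset.sum_congr rfl fun u hu => ?_
      have : Real.sqrt u ≠ 0 := by
        rw [Real.sqrt_ne_zero']; exact_mod_cast (hUp u hu).1
      rw [← mul_assoc, div_mul_cancel₀ _ this]
    rw [heq] at this
    refine abs_le_of_sq_le_sq (this.trans (le_of_eq ?_)) (by positivity)
    rw [mul_pow (Real.sqrt M), Real.sq_sqrt hM0, mul_pow _ y, hy2, hM]
    ring
  have hA3 : |∑ u ∈ U, (u.divisors.card : ℝ) * (divisorSumAP q s (β u) - c' s)| ≤
      Real.sqrt (2 * Cv * Cd ^ 2) * (T ^ 2 * y) := by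
    have hf : ∑ u ∈ U, ((u.divisors.card : ℝ)) ^ 2 ≤ (Cd * T) ^ 2 * R := by
      calc _ ≤ ∑ u ∈ U, (Cd * T) ^ 2 := by
            refine Finset.sum_le_sum fun u hu => ?_
            exact pow_le_pow_left₀ (Nat.cast_nonneg _) (hτ u (hUp u hu).1 (hUX u hu)) 2
        _ = (Cd * T) ^ 2 * U.card := by rw [Finset.sum_const, nsmul_eq_mul, mul_comm]
        _ ≤ _ := by
          gcongr
          refine le_trans ?_ hsR
          have : U.card ≤ s := (Finset.card_filter_le _ _).trans (by simp)
          exact_mod_cast this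
    have hg : ∑ u ∈ U, (divisorSumAP q s (β u) - c' s) ^ 2 ≤ (2 * R / q) * (Cv * T ^ 2 * R) := by
      refine (sum_sq_le_of_fiber q a s (fun b => divisorSumAP q s b - c' s)).trans ?_
      refine mul_le_mul ?_ ((hvar' s hs1 hsX).trans (by gcongr))
        (Finset.sum_nonneg fun _ _ => sq_nonneg _) (by positivity)
      have h1 : 1 ≤ R / q := (one_le_div hq).2 hqR
      have h2 : (s : ℝ) / q ≤ R / q := by gcongr
      have h3 : 2 * R / q = R / q + R / q := by ring
      linarith
    have := abs_sum_mul_le_of_sq U _ _ _ _ hf hg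
    refine abs_le_of_sq_le_sq (this.trans (le_of_eq ?_)) (by positivity)
    rw [mul_pow (Real.sqrt _), Real.sq_sqrt (by positivity), mul_pow _ y, hy2, ← hRR]
    ring
  have hT23 : T ^ 2 * y ≤ T ^ 3 * y := by
    gcongr
    norm_num
  rw [hdecomp, hT3]
  calc _ ≤ 2 * (Cd ^ 2 * (4 * Cl) * T ^ 3 * y) + 2 * (Real.sqrt M * (T ^ 3 * y)) +
        Real.sqrt (2 * Cv * Cd ^ 2) * (T ^ 3 * y) := by
        refine (abs_sub _ _).trans (add_le_add ((abs_add_le _ _).trans (add_le_add ?_ ?_)) ?_)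
        · rw [abs_mul, abs_two]; gcongr
        · rw [abs_mul, abs_two]; gcongr
        · exact hA3.trans (by gcongr)
    _ = C₀ * T ^ 3 * y := by rw [hC₀]; ring
    _ ≤ _ := by
        gcongr
        · linarith
        · linarith

/-- The sum of `d4` over integers up to `N` coprime to `q`. -/
noncomputable def d4SumCoprime (q N : ℕ) : ℝ :=
  ∑ n ∈ Finset.Icc 1 N, if n.Coprime q then (d4 n : ℝ) else 0

lemma sum_units_d4SumAP (q : ℕ) [NeZero q] (N : ℕ) :
    ∑ a : (ZMod q)ˣ, d4SumAP q N a = d4SumCoprime q N := by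
  unfold d4SumAP d4SumCoprime
  rw [Finset.sum_comm]
  refine Finset.sum_congr rfl fun n _ => ?_
  split_ifs with h
  · rw [Finset.sum_eq_single (natUnit q n)]
    · rw [coe_natUnit h, if_pos rfl]
    · intro b _ hb
      refine if_neg fun hnb => hb ?_
      ext
      rw [coe_natUnit h, hnb]
    · exact fun h => absurd (Finset.mem_univ _) h
  · refine Finset.sum_eq_zero fun a _ => if_neg fun hna => h ?_
    rw [← ZMod.isUnit_iff_coprime, hna]
    exact a.isUnit

lemma abs_d4SumAP_sub_le {ε : ℝ} (hε : 0 < ε) :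
    ∃ C : ℝ, 0 < C ∧ ∀ (q : ℕ) [NeZero q] (X : ℕ) (a : (ZMod q)ˣ),
      |d4SumAP q X a - d4SumCoprime q X / q.totient| ≤
        C * (X : ℝ) ^ ε * ((X : ℝ) ^ (3 / 4 : ℝ) / Real.sqrt q + 1) := by
  obtain ⟨C, hC, h⟩ := d4SumAP_sub_const_le hε
  refine ⟨2 * C, by positivity, fun q _ X a => ?_⟩
  rcases Nat.eq_zero_or_pos X with rfl | hX
  · simp only [d4SumAP, d4SumCoprime]
    simp
    positivity
  obtain ⟨K, hK⟩ := h q X hX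
  set B := C * (X : ℝ) ^ ε * ((X : ℝ) ^ (3 / 4 : ℝ) / Real.sqrt q + 1) with hB
  have hφ : (0 : ℝ) < q.totient := by exact_mod_cast Nat.totient_pos.2 (NeZero.pos q)
  have h1 : |K - d4SumCoprime q X / q.totient| ≤ B := by
    rw [← sum_units_d4SumAP, ← ZMod.card_units_eq_totient] at *
    have : K - (∑ a : (ZMod q)ˣ, d4SumAP q X a) / (Fintype.card (ZMod q)ˣ : ℝ) =
        (∑ a : (ZMod q)ˣ, (K - d4SumAP q X a)) / (Fintype.card (ZMod q)ˣ : ℝ) := by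
      rw [Finset.sum_sub_distrib, Finset.sum_const, nsmul_eq_mul, Finset.card_univ, sub_div,
        mul_div_cancel_left₀ _ hφ.ne']
    rw [this, abs_div, Nat.abs_cast, div_le_iff₀ hφ]
    refine (Finset.abs_sum_le_sum_abs _ _).trans ((Finset.sum_le_sum (g := fun _ => B)
      fun b _ => ?_).trans ?_)
    · rw [abs_sub_comm]; exact hK b
    · rw [Finset.sum_const, nsmul_eq_mul, Finset.card_univ, mul_comm]
  calc _ ≤ |d4SumAP q X a - K| + |K - d4SumCoprime q X / q.totient| := abs_sub_le _ _ _
    _ ≤ B + B := add_le_add (hK a) h1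
    _ = _ := by rw [hB]; ring

open MeasureTheory in
/-- Abel summation against an approximate summatory function. -/
lemma exists_abs_sum_mul_sub_le (c : ℕ → ℝ) (hc0 : c 0 = 0) (g g' M Ψ : ℝ → ℝ)
    (hg : ∀ t, 1 ≤ t → HasDerivAt g (g' t) t) (hg'c : ContinuousOn g' (Set.Ici 1))
    (hMc : ContinuousOn M (Set.Ici 1)) (hΨ : ∀ t, 1 ≤ t → HasDerivAt Ψ (M t * g' t) t)
    (a b A B : ℝ) (hab : a - b < -1)
    (hE : ∀ t, 1 ≤ t → |∑ k ∈ Finset.Icc 0 ⌊t⌋₊, c k - M t| ≤ A * t ^ a)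
    (hB : ∀ t, 1 ≤ t → |g' t| ≤ B * t ^ (-b)) :
    ∃ k C : ℝ, ∀ z, 1 ≤ z →
      |∑ k ∈ Finset.Icc 0 ⌊z⌋₊, g k * c k - (M z * g z - Ψ z + k)| ≤
        A * z ^ a * |g z| + C * z ^ (a - b + 1) := by
  set F : ℝ → ℝ := fun t => ∑ k ∈ Finset.Icc 0 ⌊t⌋₊, c k with hF
  set h : ℝ → ℝ := fun t => g' t * F t - g' t * M t with hh
  have hloc1 : LocallyIntegrableOn (fun t => g' t * F t) (Set.Ici 1) :=
    locallyIntegrableOn_mul_sum_Icc (m := 0) c zero_le_one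
      (hg'c.locallyIntegrableOn measurableSet_Ici)
  have hloc2 : LocallyIntegrableOn (fun t => g' t * M t) (Set.Ici 1) :=
    (hg'c.mul hMc).locallyIntegrableOn measurableSet_Ici
  have hloc : LocallyIntegrableOn h (Set.Ici 1) := hloc1.sub hloc2
  have hbound : ∀ t, 1 ≤ t → ‖h t‖ ≤ A * B * t ^ (a - b) := by
    intro t ht
    have ht0 : 0 < t := by linarith
    calc ‖h t‖ = |F t - M t| * |g' t| := by
          rw [hh, Real.norm_eq_abs, ← abs_mul]; congr 1; ring
      _ ≤ (A * t ^ a) * (B * t ^ (-b)) :=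
          mul_le_mul (hE t ht) (hB t ht) (abs_nonneg _) ((abs_nonneg _).trans (hE t ht))
      _ = A * B * t ^ (a - b) := by rw [sub_eq_add_neg, Real.rpow_add ht0]; ring
  have hpow : ∀ z : ℝ, 1 ≤ z → IntegrableOn (fun t : ℝ => A * B * t ^ (a - b)) (Set.Ioi z) :=
    fun z hz => (integrableOn_Ioi_rpow_of_lt hab (by linarith)).const_mul _
  have hIntOn : IntegrableOn h (Set.Ioi 1) := by
    refine Integrable.mono' (hpow 1 le_rfl)
      ((hloc.aestronglyMeasurable).mono_measure (Measure.restrict_mono Set.Ioi_subset_Ici_self le_rfl)) ?_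
    refine (ae_restrict_iff' measurableSet_Ioi).2 (Filter.Eventually.of_forall fun t ht => ?_)
    exact hbound t (le_of_lt ht)
  refine ⟨Ψ 1 - ∫ t in Set.Ioi 1, h t, A * B / (-(a - b + 1)), fun z hz => ?_⟩
  have hz0 : 0 < z := by linarith
  have hsub : Set.Icc 1 z ⊆ Set.Ici 1 := Set.Icc_subset_Ici_self
  have hderiv : Set.EqOn (deriv g) g' (Set.Icc 1 z) := fun t ht => (hg t ht.1).deriv
  have hIg' : IntegrableOn g' (Set.Icc 1 z) :=
    (hg'c.mono hsub).integrableOn_compact isCompact_Icc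
  have habel := sum_mul_eq_sub_integral_mul₀ (f := g) c hc0 z
    (fun t ht => (hg t ht.1).differentiableAt)
    (hIg'.congr_fun hderiv.symm measurableSet_Icc)
  have hI1 : ∫ t in Set.Ioc 1 z, deriv g t * ∑ k ∈ Finset.Icc 0 ⌊t⌋₊, c k =
      ∫ t in Set.Ioc 1 z, (h t + g' t * M t) := by
    refine setIntegral_congr_fun measurableSet_Ioc fun t ht => ?_
    have : deriv g t = g' t := (hg t ht.1.le).deriv
    simp only [this, hh, hF]
    ring
  have hI2 : ∫ t in Set.Ioc 1 z, (h t + g' t * M t) =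
      (∫ t in Set.Ioc 1 z, h t) + ∫ t in Set.Ioc 1 z, g' t * M t := by
    refine integral_add (hIntOn.mono_set Set.Ioc_subset_Ioi_self) ?_
    exact ((((hg'c.mul hMc).mono hsub).integrableOn_compact isCompact_Icc)).mono_set
      Set.Ioc_subset_Icc_self
  have hI3 : ∫ t in Set.Ioc 1 z, g' t * M t = Ψ z - Ψ 1 := by
    rw [← intervalIntegral.integral_of_le hz]
    refine intervalIntegral.integral_eq_sub_of_hasDerivAt (fun t ht => ?_) ?_
    · rw [Set.uIcc_of_le hz] at ht
      rw [mul_comm]; exact hΨ t ht.1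
    · refine ContinuousOn.intervalIntegrable ?_
      rw [Set.uIcc_of_le hz]
      exact (hg'c.mul hMc).mono hsub
  have hI4 : (∫ t in Set.Ioi 1, h t) = (∫ t in Set.Ioc 1 z, h t) + ∫ t in Set.Ioi z, h t := by
    rw [← setIntegral_union _ measurableSet_Ioi (hIntOn.mono_set Set.Ioc_subset_Ioi_self)
      (hIntOn.mono_set (Set.Ioi_subset_Ioi hz)), Set.Ioc_union_Ioi_eq_Ioi hz]
    exact Set.disjoint_left.2 fun t ht ht' => not_lt.2 ht.2 ht'
  have hI5 : |∫ t in Set.Ioi z, h t| ≤ A * B / (-(a - b + 1)) * z ^ (a - b + 1) := by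
    rw [← Real.norm_eq_abs]
    refine (norm_integral_le_of_norm_le (hpow z hz)
      ((ae_restrict_iff' measurableSet_Ioi).2 (Filter.Eventually.of_forall fun t ht =>
        hbound t (hz.trans (le_of_lt ht))))).trans (le_of_eq ?_)
    rw [integral_const_mul, integral_Ioi_rpow_of_lt hab hz0, neg_div, div_neg]
    ring
  have hfin : ∑ k ∈ Finset.Icc 0 ⌊z⌋₊, g k * c k -
      (M z * g z - Ψ z + (Ψ 1 - ∫ t in Set.Ioi 1, h t)) =
      (F z - M z) * g z + ∫ t in Set.Ioi z, h t := by
    rw [habel, hI1, hI2, hI3, hI4]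
    simp only [hF]
    ring
  rw [hfin]
  refine (abs_add_le _ _).trans (add_le_add ?_ hI5)
  rw [abs_mul]
  exact mul_le_mul_of_nonneg_right (hE z hz) (abs_nonneg _)

lemma sum_Icc_zero_eq (f : ℕ → ℝ) (hf : f 0 = 0) (N : ℕ) :
    ∑ k ∈ Finset.Icc 0 N, f k = ∑ k ∈ Finset.Icc 1 N, f k := by
  rw [← Finset.add_sum_Ioc_eq_sum_Icc (Nat.zero_le N), hf, zero_add]
  exact Finset.sum_congr (by ext; simp [Nat.lt_iff_add_one_le]) fun _ _ => rfl

/-- Logarithmic averages of `f` when the summatory function of `f` is `x * (α * log x + β)` up to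
a power saving. -/
lemma exists_sum_div_asymp (f : ℕ → ℝ) (hf0 : f 0 = 0) (α β a A η : ℝ) (hη : 0 < η)
    (haη : a + η < 1)
    (hF : ∀ x : ℝ, 1 ≤ x → |∑ k ∈ Finset.Icc 1 ⌊x⌋₊, f k - x * (α * Real.log x + β)| ≤ A * x ^ a) :
    ∃ k₀ k₁ C : ℝ, ∀ z : ℝ, 1 ≤ z →
      |∑ u ∈ Finset.Icc 1 ⌊z⌋₊, f u / u -
        (α / 2 * Real.log z ^ 2 + (α + β) * Real.log z + k₀)| ≤ C * z ^ (a - 1 + η) ∧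
      |∑ u ∈ Finset.Icc 1 ⌊z⌋₊, f u * Real.log u / u -
        (α / 3 * Real.log z ^ 3 + (α + β) / 2 * Real.log z ^ 2 + k₁)| ≤ C * z ^ (a - 1 + η) := by
  obtain ⟨Cl, hCl, hl⟩ := one_add_log_le_rpow hη
  have hA : 0 ≤ A := by
    have := (abs_nonneg _).trans (hF 1 le_rfl)
    simpa using this
  have hF' : ∀ x : ℝ, 1 ≤ x →
      |∑ k ∈ Finset.Icc 0 ⌊x⌋₊, f k - x * (α * Real.log x + β)| ≤ A * x ^ a := by
    intro x hx
    rw [sum_Icc_zero_eq f hf0]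
    exact hF x hx
  have hne : ∀ t ∈ Set.Ici (1 : ℝ), t ≠ 0 := fun t ht => by
    have : (1 : ℝ) ≤ t := ht
    linarith
  have hlogc : ContinuousOn Real.log (Set.Ici 1) := Real.continuousOn_log.mono fun t ht => hne t ht
  have hMc : ContinuousOn (fun x => x * (α * Real.log x + β)) (Set.Ici 1) := by fun_prop
  obtain ⟨k₀, C₀, h₀⟩ := exists_abs_sum_mul_sub_le f hf0 (fun t => t⁻¹) (fun t => -(t ^ 2)⁻¹)
    (fun x => x * (α * Real.log x + β))
    (fun x => -(α / 2 * Real.log x ^ 2 + β * Real.log x))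
    (fun t ht => hasDerivAt_inv (hne t ht))
    ((ContinuousOn.inv₀ (by fun_prop) fun t ht => pow_ne_zero 2 (hne t ht)).neg) hMc
    (fun t ht => by
      have h := Real.hasDerivAt_log (hne t ht)
      convert! (((h.pow 2).const_mul (α / 2)).add (h.const_mul β)).neg using 1
      have := hne t ht
      push_cast
      field_simp)
    a (2 - η) A 1 (by linarith) hF'
    (fun t ht => by
      have ht0 : 0 < t := by linarith
      rw [abs_neg, abs_of_nonneg (by positivity), one_mul, ← Real.rpow_natCast, ← Real.rpow_neg ht0.le]
      exact Real.rpow_le_rpow_of_exponent_le ht (by push_cast; linarith))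
  obtain ⟨k₁, C₁, h₁⟩ := exists_abs_sum_mul_sub_le f hf0 (fun t => Real.log t * t⁻¹)
    (fun t => (1 - Real.log t) * (t ^ 2)⁻¹)
    (fun x => x * (α * Real.log x + β))
    (fun x => -(α / 3 * Real.log x ^ 3) - (β - α) / 2 * Real.log x ^ 2 + β * Real.log x)
    (fun t ht => by
      convert! (Real.hasDerivAt_log (hne t ht)).mul (hasDerivAt_inv (hne t ht)) using 1
      have := hne t ht
      field_simp
      ring)
    (ContinuousOn.mul (by fun_prop)
      (ContinuousOn.inv₀ (by fun_prop) fun t ht => pow_ne_zero 2 (hne t ht))) hMc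
    (fun t ht => by
      have h := Real.hasDerivAt_log (hne t ht)
      convert! ((((h.pow 3).const_mul (α / 3)).neg).sub ((h.pow 2).const_mul ((β - α) / 2))).add
        (h.const_mul β) using 1
      have := hne t ht
      push_cast
      field_simp
      ring)
    a (2 - η) A Cl (by linarith) hF'
    (fun t ht => by
      have ht0 : 0 < t := by linarith
      have h0 := Real.log_nonneg ht
      have h1 : |1 - Real.log t| ≤ Cl * t ^ η := by
        refine le_trans ?_ (hl t ht)
        rw [abs_le]; constructor <;> linarith
      rw [abs_mul, abs_of_nonneg (by positivity : 0 ≤ (t ^ 2)⁻¹), neg_sub, Real.rpow_sub ht0,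
        div_eq_mul_inv, ← mul_assoc]
      rw [show t ^ (2 : ℝ) = t ^ 2 by norm_cast]
      gcongr)
  refine ⟨k₀ + β, k₁, max (A + C₀) (A * Cl + C₁), fun z hz => ?_⟩
  have hz0 : 0 < z := by linarith
  have hexp : a - (2 - η) + 1 = a - 1 + η := by ring
  have hlog := Real.log_nonneg hz
  constructor
  · have h := h₀ z hz
    rw [sum_Icc_zero_eq _ (by simp [hf0]), hexp] at h
    have e1 : ∑ u ∈ Finset.Icc 1 ⌊z⌋₊, ((u : ℝ))⁻¹ * f u = ∑ u ∈ Finset.Icc 1 ⌊z⌋₊, f u / u :=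
      Finset.sum_congr rfl fun _ _ => by ring
    have e2 : z * (α * Real.log z + β) * z⁻¹ - -(α / 2 * Real.log z ^ 2 + β * Real.log z) +
        k₀ = α / 2 * Real.log z ^ 2 + (α + β) * Real.log z + (k₀ + β) := by
      field_simp; ring
    have e3 : z ^ a * |z⁻¹| ≤ z ^ (a - 1 + η) := by
      rw [abs_of_pos (inv_pos.2 hz0), ← Real.rpow_neg_one, ← Real.rpow_add hz0]
      exact Real.rpow_le_rpow_of_exponent_le hz (by linarith)
    rw [e1, e2] at h
    calc _ ≤ _ := h
      _ ≤ A * z ^ (a - 1 + η) + C₀ * z ^ (a - 1 + η) := by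
        rw [mul_assoc]; gcongr
      _ = (A + C₀) * z ^ (a - 1 + η) := by ring
      _ ≤ _ := by gcongr; exact le_max_left _ _
  · have h := h₁ z hz
    rw [sum_Icc_zero_eq _ (by simp [hf0]), hexp] at h
    have e1 : ∑ u ∈ Finset.Icc 1 ⌊z⌋₊, Real.log u * ((u : ℝ))⁻¹ * f u =
        ∑ u ∈ Finset.Icc 1 ⌊z⌋₊, f u * Real.log u / u :=
      Finset.sum_congr rfl fun _ _ => by ring
    have e2 : z * (α * Real.log z + β) * (Real.log z * z⁻¹) -
        (-(α / 3 * Real.log z ^ 3) - (β - α) / 2 * Real.log z ^ 2 + β * Real.log z) + k₁ =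
        α / 3 * Real.log z ^ 3 + (α + β) / 2 * Real.log z ^ 2 + k₁ := by
      field_simp; ring
    have e3 : z ^ a * |Real.log z * z⁻¹| ≤ Cl * z ^ (a - 1 + η) := by
      rw [abs_of_nonneg (by positivity), ← Real.rpow_neg_one]
      calc z ^ a * (Real.log z * z ^ (-1 : ℝ)) ≤ z ^ a * ((Cl * z ^ η) * z ^ (-1 : ℝ)) := by
            gcongr
            linarith [hl z hz]
        _ = Cl * (z ^ a * z ^ (-1 : ℝ) * z ^ η) := by ring
        _ = _ := by rw [← Real.rpow_add hz0, ← Real.rpow_add hz0, ← sub_eq_add_neg]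
    rw [e1, e2] at h
    calc _ ≤ _ := h
      _ ≤ A * (Cl * z ^ (a - 1 + η)) + C₁ * z ^ (a - 1 + η) := by
        rw [mul_assoc]; gcongr
      _ = (A * Cl + C₁) * z ^ (a - 1 + η) := by ring
      _ ≤ _ := by gcongr; exact le_max_right _ _

lemma floor_sqrt_eq {x : ℝ} (hx : 0 ≤ x) : ⌊Real.sqrt x⌋₊ = (⌊x⌋₊).sqrt := by
  refine eq_of_forall_le_iff fun k => ?_
  rw [Nat.le_sqrt', Nat.le_floor_iff (Real.sqrt_nonneg _), Nat.le_floor_iff hx,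
    Real.le_sqrt (by positivity) hx]
  push_cast
  rfl

set_option maxHeartbeats 1600000 in
/-- Dirichlet's hyperbola method for a convolution square. -/
lemma exists_convolution_asymp (f : ℕ → ℝ) (hf0 : f 0 = 0) (hfn : ∀ n, 0 ≤ f n)
    (α β a A η Cf : ℝ) (ha : 0 < a) (hη : 0 < η) (haη : a + η < 1)
    (hf : ∀ n : ℕ, n ≠ 0 → f n ≤ Cf * (n : ℝ) ^ η)
    (hF : ∀ x : ℝ, 1 ≤ x → |∑ k ∈ Finset.Icc 1 ⌊x⌋₊, f k - x * (α * Real.log x + β)| ≤ A * x ^ a) :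
    ∃ p₀ p₁ p₂ p₃ B : ℝ, (α = 0 → p₂ = 0 ∧ p₃ = 0) ∧ ∀ x : ℝ, 1 ≤ x →
      |∑ n ∈ Finset.Icc 1 ⌊x⌋₊, ∑ p ∈ n.divisorsAntidiagonal, f p.1 * f p.2 -
        x * (p₀ + p₁ * Real.log x + p₂ * Real.log x ^ 2 + p₃ * Real.log x ^ 3)| ≤
        B * x ^ ((1 + a + 3 * η) / 2) := by
  obtain ⟨k₀, k₁, C, hk⟩ := exists_sum_div_asymp f hf0 α β a A η hη haη hF
  obtain ⟨Cl, hCl, hl⟩ := one_add_log_le_rpow hη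
  have hA : 0 ≤ A := by
    have := (abs_nonneg _).trans (hF 1 le_rfl)
    simpa using this
  have hC : 0 ≤ C := by
    have := (abs_nonneg _).trans (hk 1 le_rfl).1
    simpa using this
  have hCf : 0 ≤ Cf := by
    have := (hfn 1).trans (hf 1 one_ne_zero)
    simpa using this
  refine ⟨2 * (β * k₀ - α * k₁) - β ^ 2, 2 * (α * k₀ + β * (α + β) / 2) - α * β,
    2 * (α * (α + β) / 2 + α * β / 8 - α * (α + β) / 8) - α ^ 2 / 4, 2 * (α ^ 2 / 8 - α ^ 2 / 24),
    2 * (Cf * A * Cl) + 2 * (2 * (|α| + |β|) * Cl * C) + 2 * |α| * C +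
      (2 * ((|α| + |β|) * Cl) * A + A ^ 2), ?_, ?_⟩
  · rintro rfl
    constructor <;> ring
  intro x hx
  have hx0 : 0 ≤ x := by linarith
  obtain ⟨z, hz⟩ : ∃ z, z = Real.sqrt x := ⟨_, rfl⟩
  have hz1 : 1 ≤ z := hz ▸ Real.one_le_sqrt.2 hx
  have hz0 : 0 < z := by linarith
  have hzz : x = z ^ 2 := by rw [hz, Real.sq_sqrt hx0]
  have hlogx : Real.log x = 2 * Real.log z := by rw [hzz, Real.log_pow]; norm_num
  obtain ⟨T, hT⟩ : ∃ T, T = z ^ η := ⟨_, rfl⟩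
  have hT1 : 1 ≤ T := hT ▸ Real.one_le_rpow hz1 hη.le
  obtain ⟨w, hw⟩ : ∃ w, w = z ^ a := ⟨_, rfl⟩
  have hw0 : 0 < w := hw ▸ Real.rpow_pos_of_pos hz0 a
  have hwz : w ≤ z := by
    rw [hw]
    nth_rw 2 [← Real.rpow_one z]
    exact Real.rpow_le_rpow_of_exponent_le hz1 (by linarith)
  have hrhs : x ^ ((1 + a + 3 * η) / 2) = z * w * T ^ 3 := by
    rw [hzz, ← Real.rpow_natCast, ← Real.rpow_mul hz0.le, hT, hw, ← Real.rpow_natCast (z ^ η),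
      ← Real.rpow_mul hz0.le]
    nth_rw 2 [← Real.rpow_one z]
    rw [← Real.rpow_add hz0, ← Real.rpow_add hz0]
    congr 1
    push_cast
    ring
  have hzpow : z ^ (a - 1 + η) = w * T / z := by
    rw [hT, hw, Real.rpow_add hz0, Real.rpow_sub hz0, Real.rpow_one]; ring
  set ℓ := Real.log z with hℓ
  have hℓ0 : 0 ≤ ℓ := Real.log_nonneg hz1
  have hℓT : 1 + ℓ ≤ Cl * T := hT ▸ hl z hz1
  set F : ℝ → ℝ := fun y => ∑ k ∈ Finset.Icc 1 ⌊y⌋₊, f k with hFdef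
  set s := ⌊z⌋₊ with hs
  have hhyp : ∑ n ∈ Finset.Icc 1 ⌊x⌋₊, ∑ p ∈ n.divisorsAntidiagonal, f p.1 * f p.2 =
      2 * ∑ u ∈ Finset.Icc 1 s, f u * F (x / u) - F z ^ 2 := by
    rw [sum_hyperbola (fun u v => f u * f v) (fun u v => mul_comm _ _), ← floor_sqrt_eq hx0, ← hz]
    simp only [← Finset.mul_sum, ← Finset.sum_mul, hFdef, Nat.floor_div_natCast]
    ring
  obtain ⟨E₀, hE₀⟩ : ∃ E, E = ∑ u ∈ Finset.Icc 1 s, f u / u -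
        (α / 2 * ℓ ^ 2 + (α + β) * ℓ + k₀) := ⟨_, rfl⟩
  obtain ⟨E₁, hE₁⟩ : ∃ E, E = ∑ u ∈ Finset.Icc 1 s, f u * Real.log u / u -
        (α / 3 * ℓ ^ 3 + (α + β) / 2 * ℓ ^ 2 + k₁) := ⟨_, rfl⟩
  have hE₀b : |E₀| ≤ C * (w * T / z) := by rw [hE₀, ← hzpow]; exact (hk z hz1).1
  have hE₁b : |E₁| ≤ C * (w * T / z) := by rw [hE₁, ← hzpow]; exact (hk z hz1).2
  obtain ⟨E₂, hE₂⟩ : ∃ E, E = F z - z * (α * ℓ + β) := ⟨_, rfl⟩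
  have hE₂b : |E₂| ≤ A * w := by rw [hE₂, hw]; exact hF z hz1
  obtain ⟨E₃, hE₃⟩ : ∃ E, E = ∑ u ∈ Finset.Icc 1 s,
    f u * (F (x / u) - x / u * (α * Real.log (x / u) + β)) := ⟨_, rfl⟩
  have hus : ∀ u ∈ Finset.Icc 1 s, (1 : ℝ) ≤ u ∧ (u : ℝ) ≤ z := by
    intro u hu
    rw [Finset.mem_Icc] at hu
    exact ⟨by exact_mod_cast hu.1, (Nat.le_floor_iff hz0.le).1 hu.2⟩
  have hE₃b : |E₃| ≤ Cf * A * Cl * (z * w * T ^ 2) := by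
    rw [hE₃]
    refine (Finset.abs_sum_le_sum_abs _ _).trans ((Finset.sum_le_sum
      (g := fun u : ℕ => (Cf * T) * (A * (z * w)) * ((1 : ℝ) / u)) fun u hu => ?_).trans ?_)
    · obtain ⟨hu1, huz⟩ := hus u hu
      have hu0 : (0 : ℝ) < u := by linarith
      have hxu : 1 ≤ x / u := by
        rw [one_le_div hu0, hzz]; nlinarith
      rw [abs_mul, abs_of_nonneg (hfn u), mul_assoc (Cf * T)]
      have h1 : f u ≤ Cf * T := by
        refine (hf u (by rintro rfl; norm_num at hu1)).trans ?_
        rw [hT]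
        gcongr
      refine mul_le_mul h1 ((hF _ hxu).trans ?_) (abs_nonneg _) (by positivity)
      rw [mul_assoc A]
      refine mul_le_mul_of_nonneg_left ?_ hA
      rw [hzz, Real.div_rpow (by positivity) hu0.le, mul_one_div, div_le_div_iff₀ (by positivity) hu0]
      have h2 : (z ^ 2) ^ a = w * w := by
        rw [sq, Real.mul_rpow hz0.le hz0.le, hw]
      have h3 : (u : ℝ) = (u : ℝ) ^ (1 - a) * (u : ℝ) ^ a := by
        rw [← Real.rpow_add hu0]; simp
      have h4 : w * (u : ℝ) ^ (1 - a) ≤ z := by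
        calc w * (u : ℝ) ^ (1 - a) ≤ w * z ^ (1 - a) := by
              gcongr
              linarith
          _ = z := by rw [hw, ← Real.rpow_add hz0]; simp
      calc (z ^ 2) ^ a * u = w * (w * (u : ℝ) ^ (1 - a)) * (u : ℝ) ^ a := by
            rw [h2]; nth_rw 1 [h3]; ring
        _ ≤ w * z * (u : ℝ) ^ a := by gcongr
        _ = _ := by ring
    · rw [← Finset.mul_sum]
      have hs0 : (1 : ℝ) ≤ s := by
        exact_mod_cast Nat.le_floor (by exact_mod_cast hz1)
      have h1 : ∑ u ∈ Finset.Icc 1 s, (1 : ℝ) / u ≤ Cl * T := by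
        refine (sum_Icc_one_div_le s).trans (le_trans ?_ hℓT)
        have := Real.log_le_log (by linarith) (Nat.floor_le hz0.le)
        linarith
      calc _ ≤ Cf * T * (A * (z * w)) * (Cl * T) := by gcongr
        _ = _ := by ring
  have hexpand : ∑ u ∈ Finset.Icc 1 s, f u * F (x / u) =
      E₃ + x * ((2 * α * ℓ + β) * ∑ u ∈ Finset.Icc 1 s, f u / u -
        α * ∑ u ∈ Finset.Icc 1 s, f u * Real.log u / u) := by
    rw [hE₃, Finset.mul_sum, Finset.mul_sum, ← Finset.sum_sub_distrib, Finset.mul_sum,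
      ← Finset.sum_add_distrib]
    refine Finset.sum_congr rfl fun u hu => ?_
    have hu0 : (0 : ℝ) < u := by linarith [(hus u hu).1]
    rw [Real.log_div (by linarith) hu0.ne', hlogx]
    ring
  have hS₀ : ∑ u ∈ Finset.Icc 1 s, f u / u = E₀ + (α / 2 * ℓ ^ 2 + (α + β) * ℓ + k₀) := by
    rw [hE₀]; ring
  have hS₁ : ∑ u ∈ Finset.Icc 1 s, f u * Real.log u / u =
      E₁ + (α / 3 * ℓ ^ 3 + (α + β) / 2 * ℓ ^ 2 + k₁) := by
    rw [hE₁]; ring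
  have hFz : F z = E₂ + z * (α * ℓ + β) := by rw [hE₂]; ring
  have hdiff : ∑ n ∈ Finset.Icc 1 ⌊x⌋₊, ∑ p ∈ n.divisorsAntidiagonal, f p.1 * f p.2 -
        x * (2 * (β * k₀ - α * k₁) - β ^ 2 + (2 * (α * k₀ + β * (α + β) / 2) - α * β) * Real.log x +
          (2 * (α * (α + β) / 2 + α * β / 8 - α * (α + β) / 8) - α ^ 2 / 4) * Real.log x ^ 2 +
          2 * (α ^ 2 / 8 - α ^ 2 / 24) * Real.log x ^ 3) =
      2 * E₃ + 2 * (z ^ 2 * ((2 * α * ℓ + β) * E₀)) - 2 * (z ^ 2 * (α * E₁)) -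
        (2 * (z * (α * ℓ + β)) * E₂ + E₂ ^ 2) := by
    rw [hhyp, hexpand, hS₀, hS₁, hFz, hlogx, hzz]
    ring
  clear hhyp hexpand hS₀ hS₁ hFz hE₀ hE₁ hE₂ hE₃ hus hk hl hF hf hℓ
  clear_value ℓ
  have hab : 0 ≤ |α| + |β| := by positivity
  have hlin : ∀ r : ℝ, 0 ≤ r → r ≤ 2 → |r * α * ℓ + β| ≤ max 1 r * ((|α| + |β|) * Cl) * T := by
    intro r hr hr2
    have h1 : |r * α * ℓ + β| ≤ r * |α| * ℓ + |β| := by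
      refine (abs_add_le _ _).trans ?_
      rw [abs_mul, abs_mul, abs_of_nonneg hr, abs_of_nonneg hℓ0]
    have hm1 : 1 ≤ max 1 r := le_max_left _ _
    calc |r * α * ℓ + β| ≤ r * |α| * ℓ + |β| := h1
      _ ≤ max 1 r * |α| * (1 + ℓ) + max 1 r * |β| * (1 + ℓ) := by
          have h2 : |β| ≤ max 1 r * |β| * (1 + ℓ) := by
            have : 1 ≤ max 1 r * (1 + ℓ) := by nlinarith
            nlinarith [abs_nonneg β]
          have h3 : r * |α| * ℓ ≤ max 1 r * |α| * (1 + ℓ) := by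
            gcongr
            · exact le_max_right _ _
            · linarith
          linarith
      _ = max 1 r * (|α| + |β|) * (1 + ℓ) := by ring
      _ ≤ max 1 r * (|α| + |β|) * (Cl * T) := by gcongr
      _ = _ := by ring
  have hl1 : |α * ℓ + β| ≤ (|α| + |β|) * Cl * T := by simpa using hlin 1 zero_le_one one_le_two
  have hl2 : |2 * α * ℓ + β| ≤ 2 * ((|α| + |β|) * Cl) * T := by
    simpa using hlin 2 zero_le_two le_rfl
  have hT0 : 0 < T := by linarith
  have hT12 : T ≤ T ^ 3 := by simpa using pow_le_pow_right₀ hT1 (show 1 ≤ 3 by norm_num)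
  have hT23 : T ^ 2 ≤ T ^ 3 := pow_le_pow_right₀ hT1 (by norm_num)
  have hT03 : 1 ≤ T ^ 3 := one_le_pow₀ hT1
  have t1 : |2 * E₃| ≤ 2 * (Cf * A * Cl) * (z * w * T ^ 3) := by
    rw [abs_mul, abs_two]
    calc 2 * |E₃| ≤ 2 * (Cf * A * Cl * (z * w * T ^ 2)) := by gcongr
      _ ≤ 2 * (Cf * A * Cl * (z * w * T ^ 3)) := by gcongr
      _ = _ := by ring
  have t2 : |2 * (z ^ 2 * ((2 * α * ℓ + β) * E₀))| ≤
      2 * (2 * (|α| + |β|) * Cl * C) * (z * w * T ^ 3) := by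
    rw [abs_mul, abs_two, abs_mul, abs_of_nonneg (by positivity : 0 ≤ z ^ 2), abs_mul]
    calc _ ≤ 2 * (z ^ 2 * ((2 * ((|α| + |β|) * Cl) * T) * (C * (w * T / z)))) := by gcongr
      _ = 2 * (2 * (|α| + |β|) * Cl * C) * (z * w * T ^ 2) := by field_simp
      _ ≤ _ := by gcongr
  have t3 : |2 * (z ^ 2 * (α * E₁))| ≤ 2 * |α| * C * (z * w * T ^ 3) := by
    rw [abs_mul, abs_two, abs_mul, abs_of_nonneg (by positivity : 0 ≤ z ^ 2), abs_mul]
    calc _ ≤ 2 * (z ^ 2 * (|α| * (C * (w * T / z)))) := by gcongr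
      _ = 2 * |α| * C * (z * w * T) := by field_simp
      _ ≤ _ := by gcongr
  have t4 : |2 * (z * (α * ℓ + β)) * E₂| ≤ 2 * ((|α| + |β|) * Cl) * A * (z * w * T ^ 3) := by
    rw [abs_mul, abs_mul, abs_two, abs_mul, abs_of_pos hz0]
    calc _ ≤ 2 * (z * ((|α| + |β|) * Cl * T)) * (A * w) := by gcongr
      _ = 2 * ((|α| + |β|) * Cl) * A * (z * w * T) := by ring
      _ ≤ _ := by gcongr
  have t5 : |E₂ ^ 2| ≤ A ^ 2 * (z * w * T ^ 3) := by
    rw [abs_pow]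
    calc |E₂| ^ 2 ≤ (A * w) ^ 2 := by gcongr
      _ = A ^ 2 * (w * w * 1) := by ring
      _ ≤ _ := by gcongr
  rw [hdiff, hrhs]
  refine (abs_sub _ _).trans ((add_le_add ((abs_sub _ _).trans (add_le_add
    ((abs_add_le _ _).trans (add_le_add t1 t2)) t3)) ((abs_add_le _ _).trans
    (add_le_add t4 t5))).trans (le_of_eq ?_))
  ring

/-- Evaluation of the cubic polynomial with coefficient vector `p`. -/
def cubic (p : Fin 4 → ℝ) (L : ℝ) : ℝ := p 0 + p 1 * L + p 2 * L ^ 2 + p 3 * L ^ 3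

lemma cubic_smul (c : ℝ) (p : Fin 4 → ℝ) (L : ℝ) : cubic (c • p) L = c * cubic p L := by
  simp only [cubic, Pi.smul_apply, smul_eq_mul]; ring

lemma cubic_add (p q : Fin 4 → ℝ) (L : ℝ) : cubic (p + q) L = cubic p L + cubic q L := by
  simp only [cubic, Pi.add_apply]; ring

lemma cubic_sum {ι : Type*} (s : Finset ι) (p : ι → Fin 4 → ℝ) (L : ℝ) :
    cubic (∑ i ∈ s, p i) L = ∑ i ∈ s, cubic (p i) L := by
  simp only [cubic, Finset.sum_apply, Finset.sum_add_distrib, Finset.sum_mul]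

lemma abs_cubic_le (p : Fin 4 → ℝ) (L : ℝ) : |cubic p L| ≤ ‖p‖ * (1 + |L|) ^ 3 := by
  have h : ∀ i, |p i| ≤ ‖p‖ := fun i => norm_le_pi_norm p i
  have hL := abs_nonneg L
  calc |cubic p L| ≤ |p 0| + |p 1| * |L| + |p 2| * |L| ^ 2 + |p 3| * |L| ^ 3 := by
        unfold cubic
        refine (abs_add_le _ _).trans (add_le_add ((abs_add_le _ _).trans (add_le_add
          ((abs_add_le _ _).trans (add_le_add le_rfl ?_)) ?_)) ?_) <;> simp [abs_mul]
    _ ≤ ‖p‖ + ‖p‖ * |L| + ‖p‖ * |L| ^ 2 + ‖p‖ * |L| ^ 3 := by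
        gcongr <;> exact h _
    _ = ‖p‖ * (1 + |L| + |L| ^ 2 + |L| ^ 3) := by ring
    _ ≤ _ := by
        gcongr
        nlinarith [pow_nonneg hL 2, pow_nonneg hL 3]

/-- Coefficients of the polynomial `L ↦ cubic p (L - ℓ)`. -/
def cubicShift (p : Fin 4 → ℝ) (ℓ : ℝ) : Fin 4 → ℝ :=
  ![p 0 - p 1 * ℓ + p 2 * ℓ ^ 2 - p 3 * ℓ ^ 3, p 1 - 2 * p 2 * ℓ + 3 * p 3 * ℓ ^ 2,
    p 2 - 3 * p 3 * ℓ, p 3]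

lemma cubic_cubicShift (p : Fin 4 → ℝ) (ℓ L : ℝ) :
    cubic (cubicShift p ℓ) L = cubic p (L - ℓ) := by
  simp [cubic, cubicShift]; ring

lemma norm_cubicShift_le (p : Fin 4 → ℝ) (ℓ : ℝ) :
    ‖cubicShift p ℓ‖ ≤ 6 * ‖p‖ * (1 + |ℓ|) ^ 3 := by
  have h : ∀ i, |p i| ≤ ‖p‖ := fun i => norm_le_pi_norm p i
  have hp := norm_nonneg p
  have hL := abs_nonneg ℓ
  have hb : ∀ k ≤ 3, ∀ i, |p i * ℓ ^ k| ≤ ‖p‖ * (1 + |ℓ|) ^ 3 := by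
    intro k hk i
    rw [abs_mul, abs_pow]
    refine mul_le_mul (h i) ?_ (by positivity) hp
    calc |ℓ| ^ k ≤ (1 + |ℓ|) ^ k := by gcongr; linarith
      _ ≤ (1 + |ℓ|) ^ 3 := pow_le_pow_right₀ (by linarith) hk
  have h0 := hb 0 (by norm_num)
  have h1 := hb 1 (by norm_num)
  have h2 := hb 2 (by norm_num)
  have h3 := hb 3 (by norm_num)
  simp only [pow_zero, mul_one, pow_one] at h0 h1
  rw [pi_norm_le_iff_of_nonneg (by positivity)]
  have hB : 0 ≤ ‖p‖ * (1 + |ℓ|) ^ 3 := by positivity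
  rw [mul_assoc]
  generalize ‖p‖ * (1 + |ℓ|) ^ 3 = B at *
  simp only [abs_le] at h0 h1 h2 h3
  intro i
  rw [Real.norm_eq_abs, abs_le]
  fin_cases i <;> simp [cubicShift] <;> constructor <;>
    linarith [h0 0, h1 1, h2 2, h3 3, h0 1, h1 2, h2 3, h0 2, h1 3, h0 3]

lemma sum_pos_indicator (N : ℕ) :
    ∑ k ∈ Finset.Icc 1 N, (if k = 0 then (0 : ℝ) else 1) = N := by
  rw [Finset.sum_congr rfl (g := fun _ => (1 : ℝ)) fun k hk => by
    rw [Finset.mem_Icc] at hk; rw [if_neg (by omega)]]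
  simp

lemma exists_sum_d4_asymp_of_one_le {ε : ℝ} (hε : 0 < ε) :
    ∃ (p : Fin 4 → ℝ) (B : ℝ), 0 ≤ B ∧ ∀ x : ℝ, 1 ≤ x →
      |∑ n ∈ Finset.Icc 1 ⌊x⌋₊, (d4 n : ℝ) - x * cubic p (Real.log x)| ≤
        B * x ^ (3 / 4 + ε) := by
  obtain ⟨δ, hδ⟩ : ∃ δ, δ = min (ε / 3) (1 / 10) := ⟨_, rfl⟩
  have hδ0 : 0 < δ := by rw [hδ]; positivity
  have hδε : δ ≤ ε / 3 := hδ ▸ min_le_left _ _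
  have hδ1 : δ ≤ 1 / 10 := hδ ▸ min_le_right _ _
  obtain ⟨p₀, p₁, p₂, p₃, A, hp, h1⟩ := exists_convolution_asymp (fun n => if n = 0 then 0 else 1)
    (if_pos rfl) (fun n => by split_ifs <;> norm_num) 0 1 δ 1 δ 1 hδ0 hδ0 (by linarith)
    (fun n hn => by
      rw [if_neg hn, one_mul]
      exact Real.one_le_rpow (by exact_mod_cast Nat.one_le_iff_ne_zero.2 hn) hδ0.le)
    (fun x hx => by
      rw [sum_pos_indicator, zero_mul, zero_add, mul_one, one_mul]
      refine le_trans ?_ (Real.one_le_rpow hx hδ0.le)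
      rw [abs_le]
      constructor
      · linarith [Nat.lt_floor_add_one x]
      · linarith [Nat.floor_le (show 0 ≤ x by linarith)])
  obtain ⟨rfl, rfl⟩ := hp rfl
  obtain ⟨Cd, hCd, hd⟩ := card_divisors_le_rpow hδ0
  obtain ⟨q₀, q₁, q₂, q₃, B, -, h2⟩ := exists_convolution_asymp (fun n => (n.divisors.card : ℝ))
    (by simp) (fun n => by positivity) p₁ p₀ ((1 + δ + 3 * δ) / 2) A δ Cd (by linarith) hδ0
    (by linarith) hd (fun x hx => by
      have h := h1 x hx
      have e1 : ∑ n ∈ Finset.Icc 1 ⌊x⌋₊, ∑ p ∈ n.divisorsAntidiagonal,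
          (if p.1 = 0 then (0 : ℝ) else 1) * (if p.2 = 0 then 0 else 1) =
          ∑ n ∈ Finset.Icc 1 ⌊x⌋₊, (n.divisors.card : ℝ) := by
        refine Finset.sum_congr rfl fun n hn => ?_
        rw [Finset.mem_Icc] at hn
        rw [← card_divisorsAntidiagonal, Finset.card_eq_sum_ones]
        push_cast
        refine Finset.sum_congr rfl fun p hp => ?_
        have := Nat.mem_divisorsAntidiagonal.1 hp
        have h1 : p.1 ≠ 0 := by rintro h; rw [h] at this; omega
        have h2 : p.2 ≠ 0 := by rintro h; rw [h] at this; omega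
        rw [if_neg h1, if_neg h2, one_mul]
      simp only [e1] at h
      convert h using 3
      ring)
  refine ⟨![q₀, q₁, q₂, q₃], |B|, abs_nonneg _, fun x hx => ?_⟩
  have h := h2 x hx
  have e1 : ∑ n ∈ Finset.Icc 1 ⌊x⌋₊, ∑ p ∈ n.divisorsAntidiagonal,
      ((p.1.divisors.card : ℝ) * (p.2.divisors.card : ℝ)) =
      ∑ n ∈ Finset.Icc 1 ⌊x⌋₊, (d4 n : ℝ) := by
    refine Finset.sum_congr rfl fun n hn => ?_
    rw [Finset.mem_Icc] at hn
    rw [d4_eq_sum_divisorsAntidiagonal n (by omega)]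
    push_cast
    rfl
  simp only [e1] at h
  simp only [cubic, Matrix.cons_val]
  refine h.trans (mul_le_mul (le_abs_self B) ?_ (by positivity) (abs_nonneg _))
  exact Real.rpow_le_rpow_of_exponent_le hx (by linarith)

/-- Summatory function of `d4`, in a form that is uniform for small arguments. -/
lemma exists_sum_d4_asymp {ε : ℝ} (hε : 0 < ε) :
    ∃ (p : Fin 4 → ℝ) (B : ℝ), 0 ≤ B ∧ ∀ y x : ℝ, 0 < y → y ≤ x → 1 ≤ x →
      |∑ n ∈ Finset.Icc 1 ⌊y⌋₊, (d4 n : ℝ) - y * cubic p (Real.log y)| ≤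
        B * x ^ (3 / 4 + ε) := by
  obtain ⟨p, B, hB, h⟩ := exists_sum_d4_asymp_of_one_le hε
  obtain ⟨C, hC, hl⟩ := one_add_log_le_rpow (show (0 : ℝ) < 1 / 3 by norm_num)
  refine ⟨p, max B (‖p‖ * C ^ 3), le_max_of_le_left hB, fun y x hy hyx hx => ?_⟩
  rcases le_or_gt 1 y with hy1 | hy1
  · refine (h y hy1).trans ?_
    gcongr
    exact le_max_left _ _
  · rw [Nat.floor_eq_zero.2 hy1]
    have h1 : (1 + |Real.log y|) ≤ C * (y⁻¹) ^ (1 / 3 : ℝ) := by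
      rw [abs_of_neg (Real.log_neg hy hy1), ← Real.log_inv]
      exact hl _ ((one_le_inv₀ hy).2 hy1.le)
    have h2 : (1 + |Real.log y|) ^ 3 ≤ C ^ 3 * y⁻¹ := by
      calc _ ≤ (C * (y⁻¹) ^ (1 / 3 : ℝ)) ^ 3 := by gcongr
        _ = C ^ 3 * y⁻¹ := by
          rw [mul_pow, ← Real.rpow_natCast (y⁻¹ ^ _), ← Real.rpow_mul (by positivity)]
          norm_num
    have h3 : (1 : ℝ) ≤ x ^ (3 / 4 + ε) := Real.one_le_rpow hx (by linarith)
    simp only [Finset.Icc_eq_empty_of_lt Nat.zero_lt_one, Finset.sum_empty, zero_sub, abs_neg]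
    rw [abs_mul, abs_of_pos hy]
    calc y * |cubic p (Real.log y)| ≤ y * (‖p‖ * (C ^ 3 * y⁻¹)) := by
          gcongr
          refine (abs_cubic_le _ _).trans ?_
          gcongr
      _ = ‖p‖ * C ^ 3 * 1 := by field_simp
      _ ≤ _ := by
          gcongr
          exact le_max_right _ _

lemma d4_mul_of_coprime {m n : ℕ} (h : m.Coprime n) : d4 (m * n) = d4 m * d4 n := by
  rcases eq_or_ne m 0 with rfl | hm
  · simp [d4_zero]
  rcases eq_or_ne n 0 with rfl | hn
  · simp [d4_zero]
  have key : ∀ k : ℕ, k ≠ 0 →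
      d4 k = (ArithmeticFunction.sigma 0 * ArithmeticFunction.sigma 0) k := by
    intro k hk
    rw [d4_eq_sum_divisorsAntidiagonal k hk, ArithmeticFunction.mul_apply]
    simp [ArithmeticFunction.sigma_zero_apply]
  rw [key _ hm, key _ hn, key _ (mul_ne_zero hm hn)]
  exact (ArithmeticFunction.isMultiplicative_sigma.mul
    ArithmeticFunction.isMultiplicative_sigma).map_mul_of_coprime h

lemma sum_range_succ_mul_sub (J : ℝ) (n : ℕ) :
    ∑ i ∈ Finset.range n, ((i : ℝ) + 1) * (J - i + 1) =
      n * (n + 1) / 2 * (J + 2) - n * (n + 1) * (2 * n + 1) / 6 := by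
  induction n with
  | zero => simp
  | succ n ih => rw [Finset.sum_range_succ, ih]; push_cast; ring

lemma d4_prime_pow {p : ℕ} (hp : p.Prime) (j : ℕ) :
    (d4 (p ^ j) : ℝ) = (j + 1) * (j + 2) * (j + 3) / 6 := by
  rw [d4_eq_sum_divisorsAntidiagonal _ (pow_ne_zero _ hp.ne_zero),
    Nat.sum_divisorsAntidiagonal (fun a b => a.divisors.card * b.divisors.card),
    Nat.sum_divisors_prime_pow hp]
  push_cast
  have : ∀ i ∈ Finset.range (j + 1), ((p ^ i).divisors.card : ℝ) * ((p ^ j / p ^ i).divisors.card : ℝ) =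
      ((i : ℝ) + 1) * ((j : ℝ) - i + 1) := by
    intro i hi
    have hij : i ≤ j := by rw [Finset.mem_range] at hi; omega
    rw [Nat.pow_div hij hp.pos, Nat.divisors_prime_pow hp, Nat.divisors_prime_pow hp]
    simp [Nat.cast_sub hij]
  rw [Finset.sum_congr rfl this, sum_range_succ_mul_sub]
  push_cast
  ring

/-- `d4 (m / e)` if `e` divides `m`, and zero otherwise. -/
noncomputable def d4Div (e m : ℕ) : ℝ := if e ∣ m then (d4 (m / e) : ℝ) else 0

lemma d4Div_prime_pow_mul {p : ℕ} (hp : p.Prime) {n : ℕ} (hn : ¬ p ∣ n) (i k : ℕ) :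
    d4Div (p ^ i) (p ^ k * n) =
      if i ≤ k then ((k - i : ℕ) + 1) * ((k - i : ℕ) + 2) * ((k - i : ℕ) + 3) / 6 * (d4 n : ℝ)
      else 0 := by
  have hcop : ∀ j, (p ^ j).Coprime n := fun j => Nat.Coprime.pow_left _ (hp.coprime_iff_not_dvd.2 hn)
  unfold d4Div
  have hiff : p ^ i ∣ p ^ k * n ↔ i ≤ k := by
    rw [(hcop i).dvd_mul_right, Nat.pow_dvd_pow_iff_le_right hp.one_lt]
  by_cases h : i ≤ k
  · rw [if_pos (hiff.2 h), if_pos h, Nat.mul_div_right_comm (pow_dvd_pow p h),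
      Nat.pow_div h hp.pos, d4_mul_of_coprime (hcop _)]
    push_cast
    rw [d4_prime_pow hp]
  · rw [if_neg (fun h' => h (hiff.1 h')), if_neg h]

lemma d4_prime_identity {p : ℕ} (hp : p.Prime) {m : ℕ} (hm : m ≠ 0) :
    (if p ∣ m then 0 else (d4 m : ℝ)) = d4Div 1 m - 4 * d4Div p m + 6 * d4Div (p ^ 2) m -
      4 * d4Div (p ^ 3) m + d4Div (p ^ 4) m := by
  obtain ⟨k, n, hn, rfl⟩ := Nat.exists_eq_pow_mul_and_not_dvd hm p hp.ne_one
  have h0 := d4Div_prime_pow_mul hp hn 0 k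
  have h1 := d4Div_prime_pow_mul hp hn 1 k
  rw [pow_zero] at h0
  rw [pow_one] at h1
  rw [h0, h1, d4Div_prime_pow_mul hp hn, d4Div_prime_pow_mul hp hn, d4Div_prime_pow_mul hp hn]
  rcases k with _ | _ | _ | _ | k
  · simp [hn]; ring
  all_goals try
    have hd : ∀ j, p ∣ p ^ (j + 1) * n := fun j =>
      Dvd.dvd.mul_right (dvd_pow_self p (Nat.succ_ne_zero j)) n
    rw [if_pos (hd _)]
    norm_num <;> ring

lemma d4Div_mul {e f m : ℕ} (he : 0 < e) :
    d4Div (e * f) m = if e ∣ m then d4Div f (m / e) else 0 := by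
  unfold d4Div
  by_cases h : e ∣ m
  · obtain ⟨k, rfl⟩ := h
    rw [if_pos (Dvd.intro k rfl), Nat.mul_div_cancel_left _ he]
    simp only [Nat.mul_dvd_mul_iff_left he, Nat.mul_div_mul_left _ _ he]
  · rw [if_neg h, if_neg fun h' => h (dvd_of_mul_right_dvd h')]

lemma d4_prime_mul {p : ℕ} (hp : p.Prime) {m : ℕ} (hm : m ≠ 0) :
    (d4 (p * m) : ℝ) = 4 * d4Div 1 m - 6 * d4Div p m + 4 * d4Div (p ^ 2) m - d4Div (p ^ 3) m := by
  have h := d4_prime_identity hp (mul_ne_zero hp.ne_zero hm)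
  have hs : ∀ f, d4Div (p * f) (p * m) = d4Div f m := fun f => by
    rw [d4Div_mul hp.pos, if_pos (Dvd.intro m rfl), Nat.mul_div_cancel_left _ hp.pos]
  rw [if_pos (Dvd.intro m rfl), pow_succ' p 3, pow_succ' p 2, pow_succ' p 1, pow_one, hs, hs, hs] at h
  have h1 : d4Div p (p * m) = d4Div 1 m := by simpa using hs 1
  have h2 : d4Div 1 (p * m) = d4 (p * m) := by simp [d4Div]
  rw [h1, h2] at h
  rw [pow_succ' p 2, pow_succ' p 1, pow_one]
  linarith

/-- `f` agrees on positive integers with a combination of the functions `d4Div e`, `e ≤ Z`, whose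
coefficients have absolute sum at most `A`. -/
def IsD4Comb (f : ℕ → ℝ) (A : ℝ) (Z : ℕ) : Prop :=
  ∃ (ι : Type) (s : Finset ι) (κ : ι → ℝ) (e : ι → ℕ), (∀ i ∈ s, 0 < e i ∧ e i ≤ Z) ∧
    ∑ i ∈ s, |κ i| ≤ A ∧ ∀ m, m ≠ 0 → f m = ∑ i ∈ s, κ i * d4Div (e i) m

lemma isD4Comb_d4Div {e Z : ℕ} (he : 0 < e) (hZ : e ≤ Z) : IsD4Comb (d4Div e) 1 Z :=
  ⟨Unit, Finset.univ, fun _ => 1, fun _ => e, fun _ _ => ⟨he, hZ⟩, by simp, by simp⟩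

lemma isD4Comb_zero (Z : ℕ) : IsD4Comb (fun _ => 0) 0 Z :=
  ⟨Unit, ∅, fun _ => 1, fun _ => 1, by simp, by simp, by simp⟩

lemma IsD4Comb.mono {f g : ℕ → ℝ} {A B : ℝ} {Z W : ℕ} (h : IsD4Comb f A Z) (hAB : A ≤ B)
    (hZW : Z ≤ W) (hfg : ∀ m, m ≠ 0 → g m = f m) : IsD4Comb g B W := by
  obtain ⟨ι, s, κ, e, he, hA, hf⟩ := h
  exact ⟨ι, s, κ, e, fun i hi => ⟨(he i hi).1, (he i hi).2.trans hZW⟩, hA.trans hAB,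
    fun m hm => (hfg m hm).trans (hf m hm)⟩

lemma IsD4Comb.sum {ι : Type} {s : Finset ι} {κ : ι → ℝ} {f : ι → ℕ → ℝ} {A K : ℝ} {Z : ℕ}
    (h : ∀ i ∈ s, IsD4Comb (f i) K Z) (hA : ∑ i ∈ s, |κ i| ≤ A) (hK : 0 ≤ K) :
    IsD4Comb (fun m => ∑ i ∈ s, κ i * f i m) (A * K) Z := by
  classical
  have h' : ∀ i, ∃ (ι' : Type) (t : Finset ι') (ν : ι' → ℝ) (e : ι' → ℕ), i ∈ s →
      (∀ j ∈ t, 0 < e j ∧ e j ≤ Z) ∧ ∑ j ∈ t, |ν j| ≤ K ∧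
        ∀ m, m ≠ 0 → f i m = ∑ j ∈ t, ν j * d4Div (e j) m := by
    intro i
    by_cases hi : i ∈ s
    · obtain ⟨ι', t, ν, e, H⟩ := h i hi
      exact ⟨ι', t, ν, e, fun _ => H⟩
    · exact ⟨Unit, ∅, fun _ => 0, fun _ => 0, fun h => absurd h hi⟩
  choose ι' t ν e H using h'
  refine ⟨Σ i, ι' i, s.sigma t, fun x => κ x.1 * ν x.1 x.2, fun x => e x.1 x.2, ?_, ?_, ?_⟩
  · rintro ⟨i, j⟩ hij
    rw [Finset.mem_sigma] at hij
    exact (H i hij.1).1 j hij.2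
  · rw [Finset.sum_sigma]
    calc ∑ i ∈ s, ∑ j ∈ t i, |κ i * ν i j| = ∑ i ∈ s, |κ i| * ∑ j ∈ t i, |ν i j| := by
          simp only [abs_mul, Finset.mul_sum]
      _ ≤ ∑ i ∈ s, |κ i| * K := Finset.sum_le_sum fun i hi =>
          mul_le_mul_of_nonneg_left (H i hi).2.1 (abs_nonneg _)
      _ = (∑ i ∈ s, |κ i|) * K := (Finset.sum_mul ..).symm
      _ ≤ A * K := mul_le_mul_of_nonneg_right hA hK
  · intro m hm
    rw [Finset.sum_sigma]
    refine Finset.sum_congr rfl fun i hi => ?_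
    rw [(H i hi).2.2 m hm, Finset.mul_sum]
    exact Finset.sum_congr rfl fun j _ => (mul_assoc _ _ _).symm

lemma isD4Comb_d4Div_prime_mul {p : ℕ} (hp : p.Prime) {e Z : ℕ} (he : 0 < e) (hZ : e ≤ Z) :
    IsD4Comb (fun m => d4Div e (p * m)) ((p : ℝ) ^ 4) (p ^ 3 * Z) := by
  have hp2 : (2 : ℝ) ≤ p := by exact_mod_cast hp.two_le
  have hp4 : (16 : ℝ) ≤ (p : ℝ) ^ 4 := by
    calc (16 : ℝ) = 2 ^ 4 := by norm_num
      _ ≤ _ := by gcongr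
  by_cases hpe : p ∣ e
  · obtain ⟨e, rfl⟩ := hpe
    have he' : 0 < e := Nat.pos_of_mul_pos_left he
    refine (isD4Comb_d4Div he' le_rfl).mono (by linarith) ?_ fun m _ => ?_
    · calc e ≤ p * e := Nat.le_mul_of_pos_left _ hp.pos
        _ ≤ Z := hZ
        _ ≤ p ^ 3 * Z := Nat.le_mul_of_pos_left _ (pow_pos hp.pos _)
    · rw [d4Div_mul hp.pos, if_pos (Dvd.intro m rfl), Nat.mul_div_cancel_left _ hp.pos]
  · have H : ∀ i ∈ (Finset.univ : Finset (Fin 4)),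
        IsD4Comb (d4Div (e * p ^ (i : ℕ))) 1 (p ^ 3 * Z) := fun i _ => by
      refine isD4Comb_d4Div (Nat.mul_pos he (pow_pos hp.pos _)) ?_
      rw [mul_comm]
      exact Nat.mul_le_mul (Nat.pow_le_pow_right hp.pos (by omega)) hZ
    refine (IsD4Comb.sum (κ := ![4, -6, 4, -1]) (A := 15) H ?_ zero_le_one).mono
      (by linarith) le_rfl fun m hm => ?_
    · rw [Fin.sum_univ_four]
      change |(4 : ℝ)| + |(-6 : ℝ)| + |(4 : ℝ)| + |(-1 : ℝ)| ≤ 15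
      norm_num
    · rw [Fin.sum_univ_four]
      simp only [d4Div_mul he]
      have hc : e.Coprime p := ((hp.coprime_iff_not_dvd).2 hpe).symm
      by_cases hem : e ∣ m
      · obtain ⟨k, rfl⟩ := hem
        have hk : k ≠ 0 := right_ne_zero_of_mul hm
        rw [show p * (e * k) = e * (p * k) by ring, d4Div, if_pos (Dvd.intro _ rfl),
          Nat.mul_div_cancel_left _ he, d4_prime_mul hp hk]
        simp [Nat.mul_div_cancel_left _ he]
        ring
      · have : ¬ e ∣ p * m := fun h => hem (hc.dvd_of_dvd_mul_left h)
        simp [d4Div, hem, this]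

lemma isD4Comb_d4_mul (g : ℕ) (hg : g ≠ 0) :
    IsD4Comb (fun m => (d4 (g * m) : ℝ)) ((g : ℝ) ^ 4) (g ^ 3) := by
  induction g using induction_on_primes with
  | zero => exact absurd rfl hg
  | one => exact (isD4Comb_d4Div one_pos le_rfl).mono (by simp) (by simp) (by simp [d4Div])
  | prime_mul p a hp ih =>
    have ha : a ≠ 0 := right_ne_zero_of_mul hg
    obtain ⟨ι, s, κ, e, he, hA, hf⟩ := ih ha
    refine (IsD4Comb.sum (κ := κ) (fun i hi => isD4Comb_d4Div_prime_mul hp (he i hi).1 (he i hi).2)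
      hA (by positivity)).mono ?_ ?_ fun m hm => ?_
    · push_cast; rw [mul_pow, mul_comm]
    · rw [mul_pow]
    · rw [show p * a * m = a * (p * m) by ring]
      exact hf _ (mul_ne_zero hp.ne_zero hm)

lemma isD4Comb_d4Div_not_dvd {p : ℕ} (hp : p.Prime) {e Z : ℕ} (he : 0 < e) (hZ : e ≤ Z) :
    IsD4Comb (fun m => if p ∣ m then 0 else d4Div e m) 16 (p ^ 4 * Z) := by
  by_cases hpe : p ∣ e
  · refine (isD4Comb_zero _).mono (by norm_num) le_rfl fun m _ => ?_
    split_ifs with h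
    · rfl
    · exact if_neg fun h' => h (hpe.trans h')
  · have H : ∀ i ∈ (Finset.univ : Finset (Fin 5)),
        IsD4Comb (d4Div (e * p ^ (i : ℕ))) 1 (p ^ 4 * Z) := fun i _ => by
      refine isD4Comb_d4Div (Nat.mul_pos he (pow_pos hp.pos _)) ?_
      rw [mul_comm]
      exact Nat.mul_le_mul (Nat.pow_le_pow_right hp.pos (by omega)) hZ
    refine (IsD4Comb.sum (κ := ![1, -4, 6, -4, 1]) (A := 16) H ?_ zero_le_one).mono
      (by norm_num) le_rfl fun m hm => ?_
    · rw [Fin.sum_univ_five]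
      change |(1 : ℝ)| + |(-4 : ℝ)| + |(6 : ℝ)| + |(-4 : ℝ)| + |(1 : ℝ)| ≤ 16
      norm_num
    · rw [Fin.sum_univ_five]
      simp only [d4Div_mul he]
      have hc : p.Coprime e := (hp.coprime_iff_not_dvd).2 hpe
      by_cases hem : e ∣ m
      · obtain ⟨k, rfl⟩ := hem
        have hk : k ≠ 0 := right_ne_zero_of_mul hm
        have h := d4_prime_identity hp hk
        have h1 : d4Div e (e * k) = d4 k := by
          rw [d4Div, if_pos (Dvd.intro _ rfl), Nat.mul_div_cancel_left _ he]
        simp only [hc.dvd_mul_left, h1, h]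
        simp [Nat.mul_div_cancel_left _ he]
        ring
      · simp [d4Div, hem]

lemma isD4Comb_d4_coprime (q : ℕ) (hq : q ≠ 0) :
    IsD4Comb (fun m => if m.Coprime q then (d4 m : ℝ) else 0) ((q.divisors.card : ℝ) ^ 4)
      (q ^ 4) := by
  induction q using induction_on_primes with
  | zero => exact absurd rfl hq
  | one => exact (isD4Comb_d4Div one_pos le_rfl).mono (by simp) (by simp) (by simp [d4Div])
  | prime_mul p a hp ih =>
    have ha : a ≠ 0 := right_ne_zero_of_mul hq
    have hcop : ∀ m : ℕ, m.Coprime (p * a) ↔ ¬ p ∣ m ∧ m.Coprime a := fun m => by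
      rw [Nat.coprime_mul_iff_right, Nat.coprime_comm, hp.coprime_iff_not_dvd]
    by_cases hpa : p ∣ a
    · refine (ih ha).mono ?_ ?_ fun m hm => ?_
      · gcongr
        exact Nat.dvd_mul_left a p
      · gcongr
        exact Nat.le_mul_of_pos_left _ hp.pos
      · have : m.Coprime (p * a) ↔ m.Coprime a := by
          rw [hcop, and_iff_right_iff_imp]
          exact fun h h' => hp.one_lt.ne' (Nat.Coprime.eq_one_of_dvd (h.symm.coprime_dvd_left hpa) h')
        simp only [this]
    · obtain ⟨ι, s, κ, e, he, hA, hf⟩ := ih ha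
      refine (IsD4Comb.sum (κ := κ) (fun i hi => isD4Comb_d4Div_not_dvd hp (he i hi).1 (he i hi).2)
        hA (by positivity)).mono ?_ ?_ fun m hm => ?_
      · rw [((hp.coprime_iff_not_dvd).2 hpa).card_divisors_mul, hp.divisors,
          Finset.card_pair hp.one_lt.ne]
        push_cast
        apply le_of_eq; ring
      · rw [mul_pow]
      · by_cases hpm : p ∣ m
        · simp [hcop, hpm]
        · simpa [hcop, hpm] using hf m hm

lemma sum_Icc_ite_dvd {e : ℕ} (he : 0 < e) (N : ℕ) (H : ℕ → ℝ) :
    ∑ n ∈ Finset.Icc 1 N, (if e ∣ n then H n else 0) =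
      ∑ k ∈ Finset.Icc 1 (N / e), H (e * k) := by
  rw [← Finset.sum_filter]
  refine Finset.sum_nbij' (fun n => n / e) (fun k => e * k) ?_ ?_ ?_ ?_ ?_
  · intro n hn
    rw [Finset.mem_filter, Finset.mem_Icc] at hn
    rw [Finset.mem_Icc]
    exact ⟨Nat.div_pos (Nat.le_of_dvd (by omega) hn.2) he, Nat.div_le_div_right hn.1.2⟩
  · intro k hk
    rw [Finset.mem_Icc] at hk
    rw [Finset.mem_filter, Finset.mem_Icc]
    refine ⟨⟨Nat.mul_pos he (by omega), ?_⟩, Dvd.intro _ rfl⟩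
    rw [mul_comm]
    exact (Nat.le_div_iff_mul_le he).1 hk.2
  · intro n hn
    rw [Finset.mem_filter] at hn
    exact Nat.mul_div_cancel' hn.2
  · intro k _
    exact Nat.mul_div_cancel_left _ he
  · intro n hn
    rw [Finset.mem_filter] at hn
    rw [Nat.mul_div_cancel' hn.2]

lemma sum_Icc_d4Div {e : ℕ} (he : 0 < e) (N : ℕ) :
    ∑ n ∈ Finset.Icc 1 N, d4Div e n = ∑ k ∈ Finset.Icc 1 (N / e), (d4 k : ℝ) := by
  unfold d4Div
  rw [sum_Icc_ite_dvd he N fun n => (d4 (n / e) : ℝ)]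
  exact Finset.sum_congr rfl fun k _ => by rw [Nat.mul_div_cancel_left _ he]

lemma exists_d4SumCoprime_asymp {ε : ℝ} (hε : 0 < ε) :
    ∃ C, 0 < C ∧ ∀ q : ℕ, q ≠ 0 → ∃ p : Fin 4 → ℝ, ‖p‖ ≤ C * (q : ℝ) ^ ε ∧
      ∀ y x : ℝ, 0 < y → y ≤ x → 1 ≤ x →
        |d4SumCoprime q ⌊y⌋₊ - y * cubic p (Real.log y)| ≤ C * (q : ℝ) ^ ε * x ^ (3 / 4 + ε) := by
  obtain ⟨P, B, hB, hP⟩ := exists_sum_d4_asymp hε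
  obtain ⟨C₁, hC₁, h₁⟩ := card_divisors_le_rpow (ε := ε / 8) (by positivity)
  obtain ⟨C₂, hC₂, h₂⟩ := one_add_log_le_rpow (ε := ε / 6) (by positivity)
  refine ⟨C₁ ^ 4 * (6 * ‖P‖ * (4 * C₂) ^ 3) + C₁ ^ 4 * B + 1, by positivity, fun q hq => ?_⟩
  obtain ⟨ι, s, κ, e, he, hA, hf⟩ := isD4Comb_d4_coprime q hq
  have hq1 : (1 : ℝ) ≤ q := by exact_mod_cast Nat.one_le_iff_ne_zero.2 hq
  have hq0 : (0 : ℝ) < q := by linarith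
  have hA4 : ∑ i ∈ s, |κ i| ≤ C₁ ^ 4 * (q : ℝ) ^ (ε / 2) := by
    refine hA.trans ?_
    calc (q.divisors.card : ℝ) ^ 4 ≤ (C₁ * (q : ℝ) ^ (ε / 8)) ^ 4 := by
          gcongr; exact h₁ q hq
      _ = _ := by
          rw [mul_pow, ← Real.rpow_natCast ((q : ℝ) ^ (ε / 8)), ← Real.rpow_mul hq0.le]
          congr 2; push_cast; ring
  have hlog0 : ∀ i ∈ s, 0 ≤ Real.log (e i) := fun i hi =>
    Real.log_nonneg (by exact_mod_cast (he i hi).1)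
  have hlog : ∀ i ∈ s, (1 + |Real.log (e i)|) ^ 3 ≤ (4 * C₂) ^ 3 * (q : ℝ) ^ (ε / 2) := by
    intro i hi
    have hei : (0 : ℝ) < e i := by exact_mod_cast (he i hi).1
    have h1 : Real.log (e i) ≤ 4 * Real.log q := by
      calc Real.log (e i) ≤ Real.log ((q : ℝ) ^ 4) :=
            Real.log_le_log hei (by exact_mod_cast (he i hi).2)
        _ = 4 * Real.log q := by rw [Real.log_pow]; norm_num
    have h2 := h₂ q hq1
    rw [abs_of_nonneg (hlog0 i hi)]
    calc (1 + Real.log (e i)) ^ 3 ≤ (4 * C₂ * (q : ℝ) ^ (ε / 6)) ^ 3 := by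
          have := hlog0 i hi
          gcongr
          linarith
      _ = _ := by
          rw [mul_pow, ← Real.rpow_natCast ((q : ℝ) ^ (ε / 6)), ← Real.rpow_mul hq0.le]
          congr 2; push_cast; ring
  have hqq : (q : ℝ) ^ (ε / 2) * (q : ℝ) ^ (ε / 2) = (q : ℝ) ^ ε := by
    rw [← Real.rpow_add hq0]; congr 1; ring
  have hqe : (q : ℝ) ^ (ε / 2) ≤ (q : ℝ) ^ ε := Real.rpow_le_rpow_of_exponent_le hq1 (by linarith)
  refine ⟨∑ i ∈ s, (κ i / e i) • cubicShift P (Real.log (e i)), ?_, ?_⟩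
  · calc ‖∑ i ∈ s, (κ i / e i) • cubicShift P (Real.log (e i))‖
        ≤ ∑ i ∈ s, |κ i| * (6 * ‖P‖ * ((4 * C₂) ^ 3 * (q : ℝ) ^ (ε / 2))) := by
          refine (norm_sum_le _ _).trans (Finset.sum_le_sum fun i hi => ?_)
          rw [norm_smul, Real.norm_eq_abs]
          have hei : (1 : ℝ) ≤ e i := by exact_mod_cast (he i hi).1
          refine mul_le_mul ?_ ((norm_cubicShift_le _ _).trans
            (mul_le_mul_of_nonneg_left (hlog i hi) (by positivity))) (norm_nonneg _) (abs_nonneg _)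
          rw [abs_div, abs_of_pos (by linarith : (0 : ℝ) < e i)]
          exact div_le_self (abs_nonneg _) hei
      _ ≤ C₁ ^ 4 * (q : ℝ) ^ (ε / 2) * (6 * ‖P‖ * ((4 * C₂) ^ 3 * (q : ℝ) ^ (ε / 2))) := by
          rw [← Finset.sum_mul]; gcongr
      _ = C₁ ^ 4 * (6 * ‖P‖ * (4 * C₂) ^ 3) * ((q : ℝ) ^ (ε / 2) * (q : ℝ) ^ (ε / 2)) := by ring
      _ = C₁ ^ 4 * (6 * ‖P‖ * (4 * C₂) ^ 3) * (q : ℝ) ^ ε := by rw [hqq]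
      _ ≤ _ := by
          gcongr
          have : 0 ≤ C₁ ^ 4 * B := by positivity
          linarith
  · intro y x hy hyx hx
    have h1 : d4SumCoprime q ⌊y⌋₊ =
        ∑ i ∈ s, κ i * ∑ k ∈ Finset.Icc 1 ⌊y / e i⌋₊, (d4 k : ℝ) := by
      unfold d4SumCoprime
      rw [Finset.sum_congr rfl fun n hn => hf n (by rw [Finset.mem_Icc] at hn; omega),
        Finset.sum_comm]
      refine Finset.sum_congr rfl fun i hi => ?_
      rw [← Finset.mul_sum, sum_Icc_d4Div (he i hi).1, Nat.floor_div_natCast]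
    have h2 : y * cubic (∑ i ∈ s, (κ i / e i) • cubicShift P (Real.log (e i))) (Real.log y) =
        ∑ i ∈ s, κ i * (y / e i * cubic P (Real.log (y / e i))) := by
      rw [cubic_sum, Finset.mul_sum]
      refine Finset.sum_congr rfl fun i hi => ?_
      have hei : (e i : ℝ) ≠ 0 := by exact_mod_cast (he i hi).1.ne'
      rw [cubic_smul, cubic_cubicShift, Real.log_div hy.ne' hei]
      ring
    rw [h1, h2, ← Finset.sum_sub_distrib]
    calc _ ≤ ∑ i ∈ s, |κ i| * (B * x ^ (3 / 4 + ε)) := by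
          refine (Finset.abs_sum_le_sum_abs _ _).trans (Finset.sum_le_sum fun i hi => ?_)
          have hei : (1 : ℝ) ≤ e i := by exact_mod_cast (he i hi).1
          rw [← mul_sub, abs_mul]
          refine mul_le_mul_of_nonneg_left (hP _ _ (by positivity) ?_ hx) (abs_nonneg _)
          exact (div_le_self hy.le hei).trans hyx
      _ ≤ C₁ ^ 4 * (q : ℝ) ^ ε * (B * x ^ (3 / 4 + ε)) := by
          rw [← Finset.sum_mul]
          gcongr
          exact hA4.trans (by gcongr)
      _ = C₁ ^ 4 * B * (q : ℝ) ^ ε * x ^ (3 / 4 + ε) := by ring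
      _ ≤ _ := by
          gcongr
          have : 0 ≤ C₁ ^ 4 * (6 * ‖P‖ * (4 * C₂) ^ 3) := by positivity
          linarith

lemma le_totient_mul_card_divisors (q : ℕ) : q ≤ q.totient * q.divisors.card := by
  rcases Nat.eq_zero_or_pos q with rfl | hq
  · simp
  conv_lhs => rw [← Nat.sum_totient q]
  rw [mul_comm, ← smul_eq_mul]
  refine Finset.sum_le_card_nsmul _ _ _ fun d hd => ?_
  exact Nat.le_of_dvd (Nat.totient_pos.2 hq) (Nat.totient_dvd_of_dvd (Nat.dvd_of_mem_divisors hd))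

lemma exists_d4SumAP_unit_asymp {ε : ℝ} (hε : 0 < ε) (hε2 : ε ≤ 1 / 2) :
    ∃ C, 0 < C ∧ ∀ (q : ℕ) [NeZero q], ∃ p : Fin 4 → ℝ, ‖p‖ ≤ C * (q : ℝ) ^ (ε - 1) ∧
      ∀ (a : (ZMod q)ˣ) (y x : ℝ), 0 < y → y ≤ x → 1 ≤ x →
        |d4SumAP q ⌊y⌋₊ a - y * cubic p (Real.log y)| ≤
          C * x ^ ε * (x ^ (3 / 4 : ℝ) / √q + 1) := by
  obtain ⟨C₁, hC₁, h₁⟩ := card_divisors_le_rpow (ε := ε / 2) (by positivity)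
  obtain ⟨C₂, hC₂, h₂⟩ := exists_d4SumCoprime_asymp (ε := ε / 2) (by positivity)
  obtain ⟨C₃, hC₃, h₃⟩ := abs_d4SumAP_sub_le hε
  refine ⟨C₁ * C₂ + C₃, by positivity, fun q _ => ?_⟩
  have hq : q ≠ 0 := NeZero.ne q
  have hq1 : (1 : ℝ) ≤ q := by exact_mod_cast Nat.one_le_iff_ne_zero.2 hq
  have hq0 : (0 : ℝ) < q := by linarith
  obtain ⟨p, hp, hpa⟩ := h₂ q hq
  have hφ : (0 : ℝ) < q.totient := by exact_mod_cast Nat.totient_pos.2 (Nat.pos_of_ne_zero hq)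
  have hφ1 : (q.totient : ℝ)⁻¹ * (C₂ * (q : ℝ) ^ (ε / 2)) ≤ C₁ * C₂ * (q : ℝ) ^ (ε - 1) := by
    have h : (q : ℝ) ≤ q.totient * (C₁ * (q : ℝ) ^ (ε / 2)) := by
      calc (q : ℝ) ≤ q.totient * q.divisors.card := by exact_mod_cast le_totient_mul_card_divisors q
        _ ≤ _ := by gcongr; exact h₁ q hq
    have e1 : (q : ℝ) ^ (ε - 1) = (q : ℝ) ^ (ε / 2) * (q : ℝ) ^ (ε / 2) / q := by
      rw [← Real.rpow_add hq0, Real.rpow_sub_one hq0.ne']; congr 2; ring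
    rw [e1, inv_mul_eq_div, mul_div_assoc', div_le_div_iff₀ hφ hq0]
    have h' := mul_le_mul_of_nonneg_left h (by positivity : 0 ≤ C₂ * (q : ℝ) ^ (ε / 2))
    calc _ ≤ _ := h'
      _ = _ := by ring
  refine ⟨(q.totient : ℝ)⁻¹ • p, ?_, fun a y x hy hyx hx => ?_⟩
  · rw [norm_smul, Real.norm_eq_abs, abs_of_pos (by positivity)]
    calc _ ≤ (q.totient : ℝ)⁻¹ * (C₂ * (q : ℝ) ^ (ε / 2)) := by gcongr
      _ ≤ _ := hφ1
      _ ≤ _ := by gcongr; linarith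
  · have hx0 : 0 < x := by linarith
    have hfl : (⌊y⌋₊ : ℝ) ≤ x := (Nat.floor_le hy.le).trans hyx
    have hA := h₃ q ⌊y⌋₊ a
    have hB := hpa y x hy hyx hx
    rw [cubic_smul]
    have e : d4SumAP q ⌊y⌋₊ a - y * ((q.totient : ℝ)⁻¹ * cubic p (Real.log y)) =
        (d4SumAP q ⌊y⌋₊ a - d4SumCoprime q ⌊y⌋₊ / q.totient) +
          (q.totient : ℝ)⁻¹ * (d4SumCoprime q ⌊y⌋₊ - y * cubic p (Real.log y)) := by
      rw [div_eq_inv_mul]; ring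
    have hqs : (q : ℝ) ^ (ε - 1) ≤ (√q)⁻¹ := by
      rw [Real.sqrt_eq_rpow, ← Real.rpow_neg hq0.le]
      exact Real.rpow_le_rpow_of_exponent_le hq1 (by linarith)
    have hA' : |d4SumAP q ⌊y⌋₊ a - d4SumCoprime q ⌊y⌋₊ / q.totient| ≤
        C₃ * (x ^ ε * (x ^ (3 / 4 : ℝ) / √q + 1)) := by
      refine hA.trans ?_
      rw [mul_assoc]
      gcongr
    have hB' : |(q.totient : ℝ)⁻¹ * (d4SumCoprime q ⌊y⌋₊ - y * cubic p (Real.log y))| ≤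
        C₁ * C₂ * (x ^ ε * (x ^ (3 / 4 : ℝ) / √q + 1)) := by
      rw [abs_mul, abs_of_pos (inv_pos.2 hφ)]
      calc _ ≤ (q.totient : ℝ)⁻¹ * (C₂ * (q : ℝ) ^ (ε / 2) * x ^ (3 / 4 + ε / 2)) := by gcongr
        _ = (q.totient : ℝ)⁻¹ * (C₂ * (q : ℝ) ^ (ε / 2)) * x ^ (3 / 4 + ε / 2) := by ring
        _ ≤ C₁ * C₂ * (q : ℝ) ^ (ε - 1) * x ^ (3 / 4 + ε) := by
            gcongr ?_ * ?_
            exact Real.rpow_le_rpow_of_exponent_le hx (by linarith)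
        _ ≤ C₁ * C₂ * (√q)⁻¹ * x ^ (3 / 4 + ε) := by gcongr
        _ = C₁ * C₂ * (x ^ ε * (x ^ (3 / 4 : ℝ) / √q)) := by
            rw [Real.rpow_add hx0, div_eq_mul_inv]; ring
        _ ≤ _ := by gcongr; linarith
    rw [e]
    calc _ ≤ _ := abs_add_le _ _
      _ ≤ _ := add_le_add hA' hB'
      _ = _ := by ring

lemma d4SumAP_mul {g t : ℕ} (hg : 0 < g) (c N : ℕ) :
    d4SumAP (g * t) N ((g * c : ℕ) : ZMod (g * t)) =
      ∑ m ∈ Finset.Icc 1 (N / g), if (m : ZMod t) = c then (d4 (g * m) : ℝ) else 0 := by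
  have h1 : ∀ n : ℕ, (if (n : ZMod (g * t)) = ((g * c : ℕ) : ZMod (g * t)) then (d4 n : ℝ) else 0) =
      if g ∣ n then
        (if (n : ZMod (g * t)) = ((g * c : ℕ) : ZMod (g * t)) then (d4 n : ℝ) else 0) else 0 := by
    intro n
    by_cases hn : g ∣ n
    · rw [if_pos hn]
    · rw [if_neg hn, if_neg]
      rw [ZMod.natCast_eq_natCast_iff]
      intro h
      exact hn (((h.dvd_iff (Dvd.intro t rfl)).2 (Dvd.intro c rfl)))
  unfold d4SumAP
  rw [Finset.sum_congr rfl fun n _ => h1 n, sum_Icc_ite_dvd hg N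
    fun n => if (n : ZMod (g * t)) = ((g * c : ℕ) : ZMod (g * t)) then (d4 n : ℝ) else 0]
  refine Finset.sum_congr rfl fun k _ => if_congr ?_ rfl rfl
  rw [ZMod.natCast_eq_natCast_iff, ZMod.natCast_eq_natCast_iff]
  exact ⟨fun h => Nat.ModEq.mul_left_cancel' hg.ne' h, fun h => Nat.ModEq.mul_left' g h⟩

lemma sum_Icc_ite_d4Div {t : ℕ} [NeZero t] {e : ℕ} (he : 0 < e) (b : (ZMod t)ˣ) (N : ℕ) :
    ∑ m ∈ Finset.Icc 1 N, (if (m : ZMod t) = b then d4Div e m else 0) =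
      if e.Coprime t then d4SumAP t (N / e) ((b * (natUnit t e)⁻¹ : (ZMod t)ˣ)) else 0 := by
  have h1 : ∀ m : ℕ, (if (m : ZMod t) = b then d4Div e m else 0) =
      if e ∣ m then (if (m : ZMod t) = b then (d4 (m / e) : ℝ) else 0) else 0 := fun m => by
    unfold d4Div; split_ifs <;> rfl
  rw [Finset.sum_congr rfl fun m _ => h1 m, sum_Icc_ite_dvd he]
  split_ifs with h
  · unfold d4SumAP
    refine Finset.sum_congr rfl fun k _ => ?_
    rw [Nat.mul_div_cancel_left _ he]
    refine if_congr ?_ rfl rfl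
    rw [Nat.cast_mul, ← coe_natUnit h, Units.val_mul, Units.eq_mul_inv_iff_mul_eq, mul_comm]
  · refine Finset.sum_eq_zero fun k _ => if_neg fun hk => h ?_
    rw [← ZMod.isUnit_iff_coprime]
    rw [Nat.cast_mul] at hk
    exact isUnit_of_mul_isUnit_left (hk ▸ b.isUnit)

lemma exists_d4SumAP_asymp {ε : ℝ} (hε : 0 < ε) (hε2 : ε ≤ 1 / 2) :
    ∃ C, 0 < C ∧ ∀ c t : ℕ, c ≠ 0 → t ≠ 0 → ∃ p : Fin 4 → ℝ,
      ‖p‖ ≤ C * (c : ℝ) ^ 17 * (t : ℝ) ^ (ε - 1) ∧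
      ∀ x : ℝ, 1 ≤ x → (t : ℝ) ≤ √x →
        |d4SumAP t ⌊x⌋₊ (c : ZMod t) - x * cubic p (Real.log x)| ≤
          C * (c : ℝ) ^ 17 * (x ^ (3 / 4 + ε) / √t) := by
  obtain ⟨C, hC, H⟩ := exists_d4SumAP_unit_asymp hε hε2
  refine ⟨6 * C, by positivity, fun c t hc ht => ?_⟩
  obtain ⟨g, t', c', hg, hcop, rfl, rfl⟩ : ∃ g t' c', 0 < g ∧ Nat.Coprime t' c' ∧ t = g * t' ∧
      c = g * c' := by
    obtain ⟨t', c', hcop, h1, h2⟩ := Nat.exists_coprime t c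
    exact ⟨t.gcd c, t', c', Nat.gcd_pos_of_pos_left _ (Nat.pos_of_ne_zero ht), hcop,
      by rw [mul_comm]; exact h1, by rw [mul_comm]; exact h2⟩
  have ht' : t' ≠ 0 := right_ne_zero_of_mul ht
  have hc' : c' ≠ 0 := right_ne_zero_of_mul hc
  have : NeZero t' := ⟨ht'⟩
  obtain ⟨p, hp, hpa⟩ := H t'
  obtain ⟨ι, s, κ, e, he, hA, hf⟩ := isD4Comb_d4_mul g hg.ne'
  obtain ⟨b, hb⟩ : ∃ b : (ZMod t')ˣ, (b : ZMod t') = c' := ⟨_, coe_natUnit hcop.symm⟩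
  have hg1 : (1 : ℝ) ≤ g := by exact_mod_cast hg
  have hc1 : (1 : ℝ) ≤ c' := by exact_mod_cast Nat.one_le_iff_ne_zero.2 hc'
  have ht1 : (1 : ℝ) ≤ t' := by exact_mod_cast Nat.one_le_iff_ne_zero.2 ht'
  have hgc : (g : ℝ) ≤ ((g * c' : ℕ) : ℝ) := by exact_mod_cast Nat.le_mul_of_pos_right _ (by omega)
  obtain ⟨s', hs'⟩ : ∃ s', s' = s.filter fun i => (e i).Coprime t' := ⟨_, rfl⟩
  have hs's : s' ⊆ s := hs' ▸ Finset.filter_subset _ _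
  have hA' : ∑ i ∈ s', |κ i| ≤ (g : ℝ) ^ 4 :=
    (Finset.sum_le_sum_of_subset_of_nonneg hs's fun _ _ _ => abs_nonneg _).trans hA
  have hge1 : ∀ i ∈ s', (1 : ℝ) ≤ (g * e i : ℕ) := fun i hi => by
    exact_mod_cast Nat.mul_pos hg (he i (hs's hi)).1
  have hge : ∀ i ∈ s', ((g * e i : ℕ) : ℝ) ≤ (g : ℝ) ^ 4 := fun i hi => by
    have := Nat.mul_le_mul_left g (he i (hs's hi)).2
    rw [← pow_succ'] at this
    exact_mod_cast this
  refine ⟨∑ i ∈ s', (κ i / (g * e i : ℕ)) • cubicShift p (Real.log (g * e i : ℕ)), ?_, ?_⟩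
  · have hlog : ∀ i ∈ s', (1 + |Real.log (g * e i : ℕ)|) ^ 3 ≤ (g : ℝ) ^ 12 := by
      intro i hi
      rw [abs_of_nonneg (Real.log_nonneg (hge1 i hi))]
      have h1 := Real.log_le_sub_one_of_pos (by linarith [hge1 i hi] : (0 : ℝ) < (g * e i : ℕ))
      have h2 := Real.log_nonneg (hge1 i hi)
      calc _ ≤ ((g : ℝ) ^ 4) ^ 3 := by
            have := hge i hi
            gcongr; linarith
        _ = _ := by ring
    have htg : (t' : ℝ) ^ (ε - 1) ≤ g * ((g * t' : ℕ) : ℝ) ^ (ε - 1) := by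
      have hg0 : (0 : ℝ) < g := by linarith
      push_cast
      rw [Real.mul_rpow (by positivity) (by positivity), ← mul_assoc]
      refine le_mul_of_one_le_left (by positivity) ?_
      rw [← Real.rpow_one_add' hg0.le (by linarith)]
      exact Real.one_le_rpow hg1 (by linarith)
    calc _ ≤ ∑ i ∈ s', |κ i| * (6 * (C * (t' : ℝ) ^ (ε - 1)) * (g : ℝ) ^ 12) := by
          refine (norm_sum_le _ _).trans (Finset.sum_le_sum fun i hi => ?_)
          rw [norm_smul, Real.norm_eq_abs, abs_div, abs_of_nonneg (by positivity : (0:ℝ) ≤ (g * e i : ℕ))]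
          refine mul_le_mul (div_le_self (abs_nonneg _) (hge1 i hi)) ((norm_cubicShift_le _ _).trans ?_)
            (norm_nonneg _) (abs_nonneg _)
          have := hlog i hi
          gcongr
      _ ≤ (g : ℝ) ^ 4 * (6 * (C * (g * ((g * t' : ℕ) : ℝ) ^ (ε - 1))) * (g : ℝ) ^ 12) := by
          rw [← Finset.sum_mul]
          gcongr
      _ = 6 * C * (g : ℝ) ^ 17 * ((g * t' : ℕ) : ℝ) ^ (ε - 1) := by ring
      _ ≤ _ := by gcongr
  · intro x hx htx
    have hx0 : 0 < x := by linarith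
    have h1 : d4SumAP (g * t') ⌊x⌋₊ ((g * c' : ℕ) : ZMod (g * t')) =
        ∑ i ∈ s', κ i * d4SumAP t' ⌊x / (g * e i : ℕ)⌋₊ ((b * (natUnit t' (e i))⁻¹ : (ZMod t')ˣ)) := by
      rw [d4SumAP_mul hg, ← hb]
      calc _ = ∑ m ∈ Finset.Icc 1 (⌊x⌋₊ / g), ∑ i ∈ s,
            κ i * (if (m : ZMod t') = b then d4Div (e i) m else 0) := by
            refine Finset.sum_congr rfl fun m hm => ?_
            rw [Finset.mem_Icc] at hm
            split_ifs with h
            · exact hf m (by omega)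
            · simp
        _ = ∑ i ∈ s, κ i * (if (e i).Coprime t' then
              d4SumAP t' (⌊x⌋₊ / g / e i) ((b * (natUnit t' (e i))⁻¹ : (ZMod t')ˣ)) else 0) := by
            rw [Finset.sum_comm]
            refine Finset.sum_congr rfl fun i hi => ?_
            rw [← Finset.mul_sum, sum_Icc_ite_d4Div (he i hi).1]
        _ = _ := by
            rw [hs', Finset.sum_filter]
            refine Finset.sum_congr rfl fun i hi => ?_
            rw [Nat.div_div_eq_div_mul, Nat.floor_div_natCast, mul_ite, mul_zero]
    have h2 : x * cubic (∑ i ∈ s', (κ i / (g * e i : ℕ)) • cubicShift p (Real.log (g * e i : ℕ)))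
          (Real.log x) =
        ∑ i ∈ s', κ i * (x / (g * e i : ℕ) * cubic p (Real.log (x / (g * e i : ℕ)))) := by
      rw [cubic_sum, Finset.mul_sum]
      refine Finset.sum_congr rfl fun i hi => ?_
      rw [cubic_smul, cubic_cubicShift, Real.log_div hx0.ne' (by linarith [hge1 i hi])]
      ring
    have hbd : x ^ ε * (x ^ (3 / 4 : ℝ) / √t' + 1) ≤ 2 * g * (x ^ (3 / 4 + ε) / √(g * t' : ℕ)) := by
      have hs0 : 0 < √((g * t' : ℕ) : ℝ) := Real.sqrt_pos.2 (by push_cast; positivity)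
      have e1 : x ^ (3 / 4 : ℝ) / √t' ≤ g * (x ^ (3 / 4 : ℝ) / √(g * t' : ℕ)) := by
        push_cast
        rw [Real.sqrt_mul (by positivity), mul_div_assoc', mul_div_mul_comm]
        refine le_mul_of_one_le_left (by positivity) ?_
        rw [Real.div_sqrt]
        exact Real.one_le_sqrt.2 hg1
      have e2 : 1 ≤ g * (x ^ (3 / 4 : ℝ) / √(g * t' : ℕ)) := by
        refine hg1.trans (le_mul_of_one_le_right (by positivity) ?_)
        rw [one_le_div hs0]
        calc √((g * t' : ℕ) : ℝ) ≤ √(√x) := Real.sqrt_le_sqrt htx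
          _ = x ^ (1 / 4 : ℝ) := by
              rw [Real.sqrt_eq_rpow, Real.sqrt_eq_rpow, ← Real.rpow_mul hx0.le]; norm_num
          _ ≤ _ := Real.rpow_le_rpow_of_exponent_le hx (by norm_num)
      calc _ ≤ x ^ ε * (g * (x ^ (3 / 4 : ℝ) / √(g * t' : ℕ)) +
            g * (x ^ (3 / 4 : ℝ) / √(g * t' : ℕ))) := by gcongr
        _ = _ := by rw [Real.rpow_add hx0]; ring
    rw [h1, h2, ← Finset.sum_sub_distrib]
    calc _ ≤ ∑ i ∈ s', |κ i| * (C * (x ^ ε * (x ^ (3 / 4 : ℝ) / √t' + 1))) := by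
          refine (Finset.abs_sum_le_sum_abs _ _).trans (Finset.sum_le_sum fun i hi => ?_)
          rw [← mul_sub, abs_mul, ← mul_assoc C]
          have := hge1 i hi
          refine mul_le_mul_of_nonneg_left (hpa _ _ x (by positivity) ?_ hx) (abs_nonneg _)
          exact div_le_self hx0.le this
      _ ≤ (g : ℝ) ^ 4 * (C * (2 * g * (x ^ (3 / 4 + ε) / √(g * t' : ℕ)))) := by
          rw [← Finset.sum_mul]
          gcongr
      _ = 2 * C * (g : ℝ) ^ 5 * (x ^ (3 / 4 + ε) / √(g * t' : ℕ)) := by ring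
      _ ≤ 6 * C * ((g * c' : ℕ) : ℝ) ^ 17 * (x ^ (3 / 4 + ε) / √(g * t' : ℕ)) := by
          refine mul_le_mul_of_nonneg_right (mul_le_mul (by linarith) ?_ (by positivity)
            (by positivity)) (by positivity)
          calc (g : ℝ) ^ 5 ≤ (g : ℝ) ^ 17 := pow_le_pow_right₀ hg1 (by norm_num)
            _ ≤ _ := by gcongr

/-- The sum of `d4 (n + c)` over the multiples `n ≤ N` of `t`. -/
noncomputable def shiftSum (t N c : ℕ) : ℝ :=
  ∑ n ∈ Finset.Icc 1 N, if t ∣ n then (d4 (n + c) : ℝ) else 0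

lemma abs_sum_shift_sub_le (F : ℕ → ℝ) {N c : ℕ} {M : ℝ}
    (hF : ∀ n, 0 < n → n ≤ N + c → 0 ≤ F n ∧ F n ≤ M) :
    |∑ n ∈ Finset.Icc 1 N, F (n + c) - ∑ n ∈ Finset.Icc 1 N, F n| ≤ c * M := by
  have h1 : ∑ n ∈ Finset.Icc 1 N, F (n + c) = ∑ n ∈ Finset.Ioc c (N + c), F n := by
    refine Finset.sum_nbij' (fun n => n + c) (fun n => n - c) ?_ ?_ ?_ ?_ fun _ _ => rfl
    all_goals
      intro n hn
      simp only [Finset.mem_Icc, Finset.mem_Ioc] at hn ⊢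
      omega
  have h2 := sum_Icc_eq_add_sum_Ioc F (Nat.le_add_left c N)
  have h3 := sum_Icc_eq_add_sum_Ioc F (Nat.le_add_right N c)
  have b1 : ∑ n ∈ Finset.Icc 1 c, F n ≤ c * M := by
    have := Finset.sum_le_card_nsmul (Finset.Icc 1 c) F M fun n hn => by
      rw [Finset.mem_Icc] at hn
      exact (hF n (by omega) (by omega)).2
    simpa using this
  have b2 : ∑ n ∈ Finset.Ioc N (N + c), F n ≤ c * M := by
    have := Finset.sum_le_card_nsmul (Finset.Ioc N (N + c)) F M fun n hn => by
      rw [Finset.mem_Ioc] at hn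
      exact (hF n (by omega) (by omega)).2
    simpa using this
  have b3 : 0 ≤ ∑ n ∈ Finset.Icc 1 c, F n := Finset.sum_nonneg fun n hn => by
    rw [Finset.mem_Icc] at hn
    exact (hF n (by omega) (by omega)).1
  have b4 : 0 ≤ ∑ n ∈ Finset.Ioc N (N + c), F n := Finset.sum_nonneg fun n hn => by
    rw [Finset.mem_Ioc] at hn
    exact (hF n (by omega) (by omega)).1
  rw [h1, abs_le]
  constructor <;> linarith

lemma shiftSum_sub_d4SumAP_le {ε : ℝ} (hε : 0 < ε) (hε1 : ε ≤ 1) :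
    ∃ C, 0 < C ∧ ∀ t N c : ℕ, c ≠ 0 → N ≠ 0 →
      |shiftSum t N c - d4SumAP t N (c : ZMod t)| ≤ C * (c : ℝ) ^ 2 * (N : ℝ) ^ ε := by
  obtain ⟨C, hC, h⟩ := d4_le_rpow hε
  refine ⟨2 * C, by positivity, fun t N c hc hN => ?_⟩
  have hc1 : (1 : ℝ) ≤ c := by exact_mod_cast Nat.one_le_iff_ne_zero.2 hc
  have hN1 : (1 : ℝ) ≤ N := by exact_mod_cast Nat.one_le_iff_ne_zero.2 hN
  have hbd : ((N + c : ℕ) : ℝ) ^ ε ≤ 2 * c * (N : ℝ) ^ ε := by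
    calc ((N + c : ℕ) : ℝ) ^ ε ≤ (2 * c * (N : ℝ)) ^ ε := by
          push_cast
          gcongr
          nlinarith
      _ = (2 * c) ^ ε * (N : ℝ) ^ ε := Real.mul_rpow (by positivity) (by positivity)
      _ ≤ _ := by
          gcongr
          calc (2 * (c : ℝ)) ^ ε ≤ (2 * (c : ℝ)) ^ (1 : ℝ) :=
                Real.rpow_le_rpow_of_exponent_le (by linarith) hε1
            _ = _ := Real.rpow_one _
  have key := abs_sum_shift_sub_le (fun m => if (m : ZMod t) = c then (d4 m : ℝ) else 0)
    (N := N) (c := c) (M := C * (2 * c * (N : ℝ) ^ ε)) fun n hn hnN => by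
      have hn' : (d4 n : ℝ) ≤ C * (2 * c * (N : ℝ) ^ ε) := by
        refine (h n hn.ne').trans ?_
        refine mul_le_mul_of_nonneg_left (le_trans ?_ hbd) hC.le
        gcongr
      split_ifs
      · exact ⟨Nat.cast_nonneg _, hn'⟩
      · exact ⟨le_rfl, by positivity⟩
  have e : ∀ n : ℕ, (((n + c : ℕ) : ZMod t) = c) ↔ t ∣ n := fun n => by
    rw [Nat.cast_add, add_eq_right, ZMod.natCast_eq_zero_iff]
  simp only [e] at key
  refine key.trans (le_of_eq ?_)
  ring

lemma exists_shiftSum_asymp {ε : ℝ} (hε : 0 < ε) (hε2 : ε ≤ 1 / 2) :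
    ∃ C, 0 < C ∧ ∀ c t : ℕ, c ≠ 0 → t ≠ 0 → ∃ p : Fin 4 → ℝ,
      ‖p‖ ≤ C * (c : ℝ) ^ 17 * (t : ℝ) ^ (ε - 1) ∧
      ∀ x : ℝ, 1 ≤ x → (t : ℝ) ≤ √x →
        |shiftSum t ⌊x⌋₊ c - x * cubic p (Real.log x)| ≤
          C * (c : ℝ) ^ 17 * (x ^ (3 / 4 + ε) / √t) := by
  obtain ⟨C₁, hC₁, h₁⟩ := shiftSum_sub_d4SumAP_le hε (by linarith)
  obtain ⟨C₂, hC₂, h₂⟩ := exists_d4SumAP_asymp hε hε2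
  refine ⟨C₁ + C₂, by positivity, fun c t hc ht => ?_⟩
  obtain ⟨p, hp, hpa⟩ := h₂ c t hc ht
  have hc1 : (1 : ℝ) ≤ c := by exact_mod_cast Nat.one_le_iff_ne_zero.2 hc
  have ht0 : (0 : ℝ) < t := by exact_mod_cast Nat.pos_of_ne_zero ht
  refine ⟨p, hp.trans (by gcongr; linarith), fun x hx htx => ?_⟩
  have hx0 : 0 < x := by linarith
  have hfl : 0 < ⌊x⌋₊ := Nat.floor_pos.2 hx
  have hA := h₁ t ⌊x⌋₊ c hc hfl.ne'
  have hB := hpa x hx htx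
  have hA' : C₁ * (c : ℝ) ^ 2 * (⌊x⌋₊ : ℝ) ^ ε ≤ C₁ * (c : ℝ) ^ 17 * (x ^ (3 / 4 + ε) / √t) := by
    have e1 : x ^ ε ≤ x ^ (3 / 4 + ε) / √t := by
      rw [le_div_iff₀ (Real.sqrt_pos.2 ht0), Real.rpow_add hx0, mul_comm]
      refine mul_le_mul_of_nonneg_right ?_ (by positivity)
      calc √(t : ℝ) ≤ √(√x) := Real.sqrt_le_sqrt htx
        _ = x ^ (1 / 4 : ℝ) := by
            rw [Real.sqrt_eq_rpow, Real.sqrt_eq_rpow, ← Real.rpow_mul hx0.le]; norm_num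
        _ ≤ _ := Real.rpow_le_rpow_of_exponent_le hx (by norm_num)
    refine mul_le_mul (mul_le_mul_of_nonneg_left (pow_le_pow_right₀ hc1 (by norm_num)) hC₁.le)
      (le_trans ?_ e1) (by positivity) (by positivity)
    exact Real.rpow_le_rpow (by positivity) (Nat.floor_le hx0.le) hε.le
  rw [show shiftSum t ⌊x⌋₊ c - x * cubic p (Real.log x) =
    (shiftSum t ⌊x⌋₊ c - d4SumAP t ⌊x⌋₊ (c : ZMod t)) +
      (d4SumAP t ⌊x⌋₊ (c : ZMod t) - x * cubic p (Real.log x)) by ring]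
  calc _ ≤ _ := abs_add_le _ _
    _ ≤ _ := add_le_add (hA.trans hA') hB
    _ = _ := by ring

lemma shiftSum_nonneg (t N c : ℕ) : 0 ≤ shiftSum t N c :=
  Finset.sum_nonneg fun _ _ => by positivity

lemma shiftSum_le {ε : ℝ} (hε : 0 < ε) (hε1 : ε ≤ 1) :
    ∃ C, 0 < C ∧ ∀ c t : ℕ, c ≠ 0 → t ≠ 0 → ∀ x : ℝ, 1 ≤ x →
      shiftSum t ⌊x⌋₊ c ≤ C * c * (x ^ (1 + ε) / t) := by
  obtain ⟨C, hC, h⟩ := d4_le_rpow hε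
  refine ⟨2 * C, by positivity, fun c t hc ht x hx => ?_⟩
  have hc1 : (1 : ℝ) ≤ c := by exact_mod_cast Nat.one_le_iff_ne_zero.2 hc
  have ht0 : (0 : ℝ) < t := by exact_mod_cast Nat.pos_of_ne_zero ht
  have hx0 : 0 < x := by linarith
  have hb : ∀ n ∈ Finset.Icc 1 (⌊x⌋₊ / t), (d4 (t * n + c) : ℝ) ≤ C * (2 * c * x ^ ε) := by
    intro n hn
    rw [Finset.mem_Icc] at hn
    have htn : ((t * n : ℕ) : ℝ) ≤ x := by
      refine le_trans ?_ (Nat.floor_le hx0.le)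
      exact_mod_cast (Nat.mul_le_mul_left t hn.2).trans (Nat.mul_div_le _ _)
    refine (h _ (by omega)).trans (mul_le_mul_of_nonneg_left ?_ hC.le)
    calc ((t * n + c : ℕ) : ℝ) ^ ε ≤ (2 * c * x) ^ ε := by
          gcongr
          push_cast at htn ⊢
          nlinarith
      _ = (2 * c) ^ ε * x ^ ε := Real.mul_rpow (by positivity) (by positivity)
      _ ≤ _ := by
          gcongr
          calc (2 * (c : ℝ)) ^ ε ≤ (2 * (c : ℝ)) ^ (1 : ℝ) :=
                Real.rpow_le_rpow_of_exponent_le (by linarith) hε1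
            _ = _ := Real.rpow_one _
  unfold shiftSum
  rw [sum_Icc_ite_dvd (Nat.pos_of_ne_zero ht) _ fun n => (d4 (n + c) : ℝ)]
  have h1 := Finset.sum_le_card_nsmul _ _ _ hb
  rw [Nat.card_Icc, Nat.add_sub_cancel, nsmul_eq_mul] at h1
  refine h1.trans ?_
  have h2 : ((⌊x⌋₊ / t : ℕ) : ℝ) ≤ x / t :=
    Nat.cast_div_le.trans (by gcongr; exact Nat.floor_le hx0.le)
  calc _ ≤ x / t * (C * (2 * c * x ^ ε)) := by gcongr
    _ = _ := by rw [Real.rpow_one_add' hx0.le (by linarith)]; ring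

/-- Every prime divisor of `t` divides it at least twice. -/
def IsSquarefull (t : ℕ) : Prop := ∀ p : ℕ, p.Prime → p ∣ t → p ^ 2 ∣ t

lemma IsSquarefull.exists_eq {t : ℕ} (h : IsSquarefull t) (ht : t ≠ 0) :
    ∃ a b : ℕ, 0 < a ∧ 0 < b ∧ a ^ 2 * b ^ 3 = t := by
  obtain ⟨b, a, hb, ha, rfl, hsq⟩ := Nat.sq_mul_squarefree_of_pos (Nat.pos_of_ne_zero ht)
  have hba : b ∣ a := by
    rw [← Nat.prod_primeFactors_of_squarefree hsq, Nat.prod_primeFactors_dvd_iff ha.ne']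
    intro p hp
    rw [Nat.mem_primeFactors] at hp
    refine Nat.mem_primeFactors.2 ⟨hp.1, ?_, ha.ne'⟩
    have h2 := h p hp.1 (hp.2.1.mul_left _)
    obtain ⟨k, rfl⟩ := hp.2.1
    have hk : ¬ p ∣ k := fun hk =>
      hp.1.one_lt.ne' (Nat.isUnit_iff.1 (hsq p (mul_dvd_mul_left p hk)))
    rw [pow_two, mul_left_comm, Nat.mul_dvd_mul_iff_left hp.1.pos] at h2
    exact hp.1.dvd_of_dvd_pow ((hp.1.dvd_mul.1 h2).resolve_right hk)
  obtain ⟨k, rfl⟩ := hba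
  exact ⟨k, b, Nat.pos_of_mul_pos_left ha, hb, by ring⟩

lemma summable_isSquarefull_rpow {η : ℝ} (hη : 0 < η) :
    Summable fun t : {t : ℕ // t ≠ 0 ∧ IsSquarefull t} => ((t : ℕ) : ℝ) ^ (-(1 / 2) - η) := by
  choose a b ha hb hab using fun t : {t : ℕ // t ≠ 0 ∧ IsSquarefull t} => t.2.2.exists_eq t.2.1
  have hinj : Function.Injective fun t => (a t, b t) := by
    intro t t' h
    rw [Prod.mk.injEq] at h
    apply Subtype.ext
    rw [← hab t, ← hab t', h.1, h.2]
  have h1 : Summable fun n : ℕ => (n : ℝ) ^ (-1 - 2 * η) := Real.summable_nat_rpow.2 (by linarith)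
  have h2 : Summable fun n : ℕ => (n : ℝ) ^ (-(3 / 2) - 3 * η) :=
    Real.summable_nat_rpow.2 (by linarith)
  have h3 := (h1.mul_of_nonneg h2 (fun n => by positivity) fun n => by positivity).comp_injective hinj
  refine h3.congr fun t => ?_
  have ha0 : (0 : ℝ) ≤ a t := Nat.cast_nonneg _
  have hb0 : (0 : ℝ) ≤ b t := Nat.cast_nonneg _
  have : ((t : ℕ) : ℝ) = (a t : ℝ) ^ (2 : ℝ) * (b t : ℝ) ^ (3 : ℝ) := by
    rw [← hab t]; push_cast; norm_cast
  simp only [Function.comp]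
  rw [this, Real.mul_rpow (by positivity) (by positivity), ← Real.rpow_mul ha0, ← Real.rpow_mul hb0]
  congr 2 <;> ring

lemma abelianCount_prime_mul {p s : ℕ} (hp : p.Prime) (hs : ¬ p ∣ s) :
    abelianCount (p * s) = abelianCount s := by
  unfold abelianCount
  have hc : p.Coprime s := (hp.coprime_iff_not_dvd).2 hs
  rw [Nat.factorization_mul_of_coprime hc, Finsupp.prod_add_index_of_disjoint]
  · rw [hp.factorization, Finsupp.prod_single_index (by simp)]
    simp
  · simpa using hc.disjoint_primeFactors

open ArithmeticFunction in
lemma sum_moebius_mul_eq_zero {f : ℕ → ℝ} (hf : ∀ p s : ℕ, p.Prime → ¬ p ∣ s → f (p * s) = f s)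
    {t : ℕ} (ht : t ≠ 0) (h : ¬ IsSquarefull t) :
    ∑ x ∈ t.divisorsAntidiagonal, (moebius x.1 : ℝ) * f x.2 = 0 := by
  unfold IsSquarefull at h
  push Not at h
  obtain ⟨p, hp, ⟨s, rfl⟩, hps⟩ := h
  have hs : ¬ p ∣ s := fun hd => hps (by rw [pow_two]; exact mul_dvd_mul_left p hd)
  have hs0 : s ≠ 0 := right_ne_zero_of_mul ht
  have hμ : ∀ u, ¬ p ∣ u → moebius (p * u) = - moebius u := fun u hu => by
    rw [isMultiplicative_moebius.map_mul_of_coprime ((hp.coprime_iff_not_dvd).2 hu),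
      moebius_apply_prime hp]
    ring
  refine Finset.sum_involution (fun x _ => if p ∣ x.1 then (x.1 / p, p * x.2) else (p * x.1, x.2 / p))
    ?_ ?_ ?_ ?_
  all_goals
    rintro ⟨u, v⟩ hx
    rw [Nat.mem_divisorsAntidiagonal] at hx
    have hx1 : u * v = p * s := hx.1
    have hx2 : p ∣ u ∨ p ∣ v := hp.dvd_mul.1 ⟨s, hx1⟩
    have hx3 : p ∣ u → ¬ p ∣ v := by
      rintro ⟨u, rfl⟩ h
      rw [mul_assoc] at hx1
      have := Nat.eq_of_mul_eq_mul_left hp.pos hx1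
      exact hs (this ▸ h.mul_left u)
    have hx4 : p ∣ v → ¬ p ∣ u := fun h h' => hx3 h' h
  · by_cases hu : p ∣ u
    · have hv := hx3 hu
      obtain ⟨u, rfl⟩ := hu
      have hu' : ¬ p ∣ u := by
        intro h
        rw [mul_assoc] at hx1
        have := Nat.eq_of_mul_eq_mul_left hp.pos hx1
        exact hs (this ▸ h.mul_right v)
      simp [hμ u hu', hf p v hp hv, Nat.mul_div_cancel_left _ hp.pos]
    · obtain ⟨v, rfl⟩ := hx2.resolve_left hu
      have hv' : ¬ p ∣ v := by
        intro h
        rw [mul_left_comm] at hx1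
        have := Nat.eq_of_mul_eq_mul_left hp.pos hx1
        exact hs (this ▸ h.mul_left u)
      simp [hu, hμ u hu, hf p v hp hv', Nat.mul_div_cancel_left _ hp.pos]
  · intro _ heq
    by_cases hu : p ∣ u
    · rw [if_pos hu, Prod.mk.injEq] at heq
      exact hx3 hu ⟨v, heq.2.symm⟩
    · rw [if_neg hu, Prod.mk.injEq] at heq
      exact hu ⟨u, heq.1.symm⟩
  · rw [Nat.mem_divisorsAntidiagonal]
    refine ⟨?_, ht⟩
    by_cases hu : p ∣ u
    · rw [if_pos hu]
      obtain ⟨u, rfl⟩ := hu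
      rw [Nat.mul_div_cancel_left _ hp.pos, ← hx1]; ring
    · rw [if_neg hu]
      obtain ⟨v, rfl⟩ := hx2.resolve_left hu
      rw [Nat.mul_div_cancel_left _ hp.pos, ← hx1]; ring
  · by_cases hu : p ∣ u
    · have hv := hx3 hu
      obtain ⟨u, rfl⟩ := hu
      have hu' : ¬ p ∣ u := by
        intro h
        rw [mul_assoc] at hx1
        have := Nat.eq_of_mul_eq_mul_left hp.pos hx1
        exact hs (this ▸ h.mul_right v)
      simp [hu', Nat.mul_div_cancel_left _ hp.pos]
    · obtain ⟨v, rfl⟩ := hx2.resolve_left hu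
      simp [hu, Nat.mul_div_cancel_left _ hp.pos]

open ArithmeticFunction in
/-- The contribution of `t` to the sum of `d4 (n + abelianCount n)`. -/
noncomputable def shiftPart (t N : ℕ) : ℝ :=
  ∑ x ∈ t.divisorsAntidiagonal, (moebius x.1 : ℝ) * shiftSum t N (abelianCount x.2)

open ArithmeticFunction in
lemma shiftPart_eq (t N : ℕ) :
    shiftPart t N = ∑ n ∈ Finset.Icc 1 N, if t ∣ n then
      ∑ x ∈ t.divisorsAntidiagonal, (moebius x.1 : ℝ) * (d4 (n + abelianCount x.2) : ℝ) else 0 := by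
  unfold shiftPart shiftSum
  simp only [Finset.mul_sum]
  rw [Finset.sum_comm]
  refine Finset.sum_congr rfl fun n _ => ?_
  split_ifs <;> simp

lemma shiftPart_eq_zero_of_not_isSquarefull {t : ℕ} (ht : t ≠ 0) (h : ¬ IsSquarefull t) (N : ℕ) :
    shiftPart t N = 0 := by
  rw [shiftPart_eq]
  refine Finset.sum_eq_zero fun n _ => ?_
  split_ifs
  · exact sum_moebius_mul_eq_zero (f := fun d => (d4 (n + abelianCount d) : ℝ))
      (fun p s hp hs => by simp only [abelianCount_prime_mul hp hs]) ht h
  · rfl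

lemma shiftPart_eq_zero_of_lt {t N : ℕ} (h : N < t) : shiftPart t N = 0 := by
  rw [shiftPart_eq]
  refine Finset.sum_eq_zero fun n hn => if_neg fun hd => ?_
  rw [Finset.mem_Icc] at hn
  have := Nat.le_of_dvd (by omega) hd
  omega

lemma sum_d4_add_abelianCount (N : ℕ) :
    ∑ n ∈ Finset.Icc 1 N, (d4 (n + abelianCount n) : ℝ) =
      ∑ t ∈ Finset.Icc 1 N, shiftPart t N := by
  simp only [shiftPart_eq]
  rw [Finset.sum_comm]
  refine Finset.sum_congr rfl fun n hn => ?_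
  rw [Finset.mem_Icc] at hn
  have h := (ArithmeticFunction.sum_eq_iff_sum_mul_moebius_eq
    (g := fun d => (d4 (n + abelianCount d) : ℝ))).2 (fun t _ => rfl) n hn.1
  rw [← h, ← Finset.sum_filter]
  refine Finset.sum_congr ?_ fun _ _ => rfl
  ext t
  rw [Nat.mem_divisors, Finset.mem_filter, Finset.mem_Icc]
  constructor
  · rintro ⟨hd, _⟩
    have := Nat.le_of_dvd hn.1 hd
    exact ⟨⟨Nat.pos_of_dvd_of_pos hd hn.1, by omega⟩, hd⟩
  · rintro ⟨_, hd⟩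
    exact ⟨hd, by omega⟩

lemma sum_abelianCount_pow_le (k : ℕ) {ε : ℝ} (hε : 0 < ε) :
    ∃ C, 0 < C ∧ ∀ t : ℕ, t ≠ 0 →
      ∑ x ∈ t.divisorsAntidiagonal, (abelianCount x.2 : ℝ) ^ k ≤ C * (t : ℝ) ^ ε := by
  obtain ⟨C₁, hC₁, h₁⟩ := abelianCount_le_rpow (ε := ε / (k + 1)) (by positivity)
  obtain ⟨C₂, hC₂, h₂⟩ := card_divisors_le_rpow (ε := ε / (k + 1)) (by positivity)
  refine ⟨C₂ * C₁ ^ k, by positivity, fun t ht => ?_⟩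
  have ht0 : (0 : ℝ) < t := by exact_mod_cast Nat.pos_of_ne_zero ht
  have hb : ∀ x ∈ t.divisorsAntidiagonal,
      (abelianCount x.2 : ℝ) ^ k ≤ C₁ ^ k * (t : ℝ) ^ (ε / (k + 1) * k) := by
    intro x hx
    have hx2 : x.2 ∣ t := Dvd.intro_left x.1 (Nat.mem_divisorsAntidiagonal.1 hx).1
    have hx0 : x.2 ≠ 0 := ne_zero_of_dvd_ne_zero ht hx2
    calc (abelianCount x.2 : ℝ) ^ k ≤ (C₁ * (t : ℝ) ^ (ε / (k + 1))) ^ k := by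
          refine pow_le_pow_left₀ (Nat.cast_nonneg _) ((h₁ _ hx0).trans ?_) _
          have : (x.2 : ℝ) ≤ t := by exact_mod_cast Nat.le_of_dvd (Nat.pos_of_ne_zero ht) hx2
          gcongr
      _ = _ := by
          rw [mul_pow, ← Real.rpow_natCast ((t : ℝ) ^ (ε / (k + 1))), ← Real.rpow_mul ht0.le]
  have h := Finset.sum_le_card_nsmul _ _ _ hb
  rw [card_divisorsAntidiagonal, nsmul_eq_mul] at h
  calc _ ≤ _ := h
    _ ≤ C₂ * (t : ℝ) ^ (ε / (k + 1)) * (C₁ ^ k * (t : ℝ) ^ (ε / (k + 1) * k)) := by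
        gcongr; exact h₂ t ht
    _ = C₂ * C₁ ^ k * ((t : ℝ) ^ (ε / (k + 1)) * (t : ℝ) ^ (ε / (k + 1) * k)) := by ring
    _ = _ := by
        rw [← Real.rpow_add ht0]; congr 2; field_simp; ring

open ArithmeticFunction in
lemma abs_moebius_mul_le (u : ℕ) (a : ℝ) : |(moebius u : ℝ) * a| ≤ |a| := by
  rw [abs_mul]
  refine mul_le_of_le_one_left (abs_nonneg _) ?_
  exact_mod_cast abs_moebius_le_one

lemma abs_shiftPart_le {ε : ℝ} (hε : 0 < ε) (hε1 : ε ≤ 1) :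
    ∃ C, 0 < C ∧ ∀ t : ℕ, t ≠ 0 → ∀ x : ℝ, 1 ≤ x →
      |shiftPart t ⌊x⌋₊| ≤ C * (x ^ (1 + ε) * (t : ℝ) ^ (ε - 1)) := by
  obtain ⟨C₁, hC₁, h₁⟩ := shiftSum_le hε hε1
  obtain ⟨C₂, hC₂, h₂⟩ := sum_abelianCount_pow_le 1 hε
  refine ⟨C₁ * C₂, by positivity, fun t ht x hx => ?_⟩
  have ht0 : (0 : ℝ) < t := by exact_mod_cast Nat.pos_of_ne_zero ht
  calc |shiftPart t ⌊x⌋₊|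
      ≤ ∑ y ∈ t.divisorsAntidiagonal, C₁ * (x ^ (1 + ε) / t) * (abelianCount y.2 : ℝ) ^ 1 := by
        refine (Finset.abs_sum_le_sum_abs _ _).trans (Finset.sum_le_sum fun y _ => ?_)
        refine (abs_moebius_mul_le _ _).trans ?_
        rw [abs_of_nonneg (shiftSum_nonneg _ _ _)]
        refine (h₁ _ t (abelianCount_pos _).ne' ht x hx).trans (le_of_eq ?_)
        ring
    _ ≤ C₁ * (x ^ (1 + ε) / t) * (C₂ * (t : ℝ) ^ ε) := by
        rw [← Finset.mul_sum]
        exact mul_le_mul_of_nonneg_left (h₂ t ht) (by positivity)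
    _ = _ := by rw [Real.rpow_sub_one ht0.ne']; ring

lemma exists_shiftPart_asymp {ε : ℝ} (hε : 0 < ε) (hε2 : ε ≤ 1 / 2) :
    ∃ C, 0 < C ∧ ∀ t : ℕ, t ≠ 0 → ∃ p : Fin 4 → ℝ, ‖p‖ ≤ C * (t : ℝ) ^ (ε - 1) ∧
      ∀ x : ℝ, 1 ≤ x → (t : ℝ) ≤ √x →
        |shiftPart t ⌊x⌋₊ - x * cubic p (Real.log x)| ≤
          C * (x ^ (3 / 4 + ε) * (t : ℝ) ^ (ε - 1 / 2)) := by
  obtain ⟨C₁, hC₁, h₁⟩ := exists_shiftSum_asymp (ε := ε / 2) (by positivity) (by linarith)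
  obtain ⟨C₂, hC₂, h₂⟩ := sum_abelianCount_pow_le 17 (ε := ε / 2) (by positivity)
  refine ⟨C₁ * C₂, by positivity, fun t ht => ?_⟩
  have ht1 : (1 : ℝ) ≤ t := by exact_mod_cast Nat.one_le_iff_ne_zero.2 ht
  have ht0 : (0 : ℝ) < t := by linarith
  choose p hp hpa using fun d => h₁ (abelianCount d) t (abelianCount_pos d).ne' ht
  refine ⟨∑ y ∈ t.divisorsAntidiagonal, (ArithmeticFunction.moebius y.1 : ℝ) • p y.2, ?_, ?_⟩
  · calc _ ≤ ∑ y ∈ t.divisorsAntidiagonal,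
          C₁ * (t : ℝ) ^ (ε / 2 - 1) * (abelianCount y.2 : ℝ) ^ 17 := by
          refine (norm_sum_le _ _).trans (Finset.sum_le_sum fun y _ => ?_)
          rw [norm_smul, Real.norm_eq_abs]
          have h := abs_moebius_mul_le y.1 ‖p y.2‖
          rw [abs_mul, abs_norm] at h
          refine h.trans ((hp y.2).trans (le_of_eq ?_))
          ring
      _ ≤ C₁ * (t : ℝ) ^ (ε / 2 - 1) * (C₂ * (t : ℝ) ^ (ε / 2)) := by
          rw [← Finset.mul_sum]
          exact mul_le_mul_of_nonneg_left (h₂ t ht) (by positivity)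
      _ = C₁ * C₂ * ((t : ℝ) ^ (ε / 2 - 1) * (t : ℝ) ^ (ε / 2)) := by ring
      _ = _ := by rw [← Real.rpow_add ht0]; congr 2; ring
  · intro x hx htx
    have hx0 : 0 < x := by linarith
    unfold shiftPart
    rw [cubic_sum, Finset.mul_sum, ← Finset.sum_sub_distrib]
    calc _ ≤ ∑ y ∈ t.divisorsAntidiagonal,
          C₁ * (x ^ (3 / 4 + ε / 2) / √t) * (abelianCount y.2 : ℝ) ^ 17 := by
          refine (Finset.abs_sum_le_sum_abs _ _).trans (Finset.sum_le_sum fun y _ => ?_)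
          rw [cubic_smul, mul_left_comm, ← mul_sub]
          refine (abs_moebius_mul_le _ _).trans ((hpa y.2 x hx htx).trans (le_of_eq ?_))
          ring
      _ ≤ C₁ * (x ^ (3 / 4 + ε / 2) / √t) * (C₂ * (t : ℝ) ^ (ε / 2)) := by
          rw [← Finset.mul_sum]
          exact mul_le_mul_of_nonneg_left (h₂ t ht) (by positivity)
      _ = C₁ * C₂ * (x ^ (3 / 4 + ε / 2) * ((t : ℝ) ^ (ε / 2) / √t)) := by ring
      _ = C₁ * C₂ * (x ^ (3 / 4 + ε / 2) * (t : ℝ) ^ (ε / 2 - 1 / 2)) := by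
          rw [Real.sqrt_eq_rpow, ← Real.rpow_sub ht0]
      _ ≤ _ := by
          have e1 : x ^ (3 / 4 + ε / 2) ≤ x ^ (3 / 4 + ε) :=
            Real.rpow_le_rpow_of_exponent_le hx (by linarith)
          have e2 : (t : ℝ) ^ (ε / 2 - 1 / 2) ≤ (t : ℝ) ^ (ε - 1 / 2) :=
            Real.rpow_le_rpow_of_exponent_le ht1 (by linarith)
          gcongr

lemma hasSum_cubic {ι : Type*} {p : ι → Fin 4 → ℝ} {P : Fin 4 → ℝ} (h : HasSum p P) (L : ℝ) :
    HasSum (fun i => cubic (p i) L) (cubic P L) := by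
  refine h.map (⟨⟨fun p => cubic p L, by simp [cubic]⟩, fun p q => cubic_add p q L⟩ :
    (Fin 4 → ℝ) →+ ℝ) ?_
  change Continuous fun p : Fin 4 → ℝ => cubic p L
  unfold cubic
  fun_prop

lemma hasSum_shiftPart (N : ℕ) :
    HasSum (fun t : {t : ℕ | t ≠ 0 ∧ IsSquarefull t} => shiftPart t N)
      (∑ n ∈ Finset.Icc 1 N, (d4 (n + abelianCount n) : ℝ)) := by
  have h0 : shiftPart 0 N = 0 := by simp [shiftPart]
  have h : HasSum (fun t => shiftPart t N) (∑ t ∈ Finset.Icc 1 N, shiftPart t N) := by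
    refine hasSum_sum_of_ne_finset_zero fun t ht => ?_
    rw [Finset.mem_Icc] at ht
    rcases Nat.eq_zero_or_pos t with rfl | ht0
    · exact h0
    · exact shiftPart_eq_zero_of_lt (by omega)
  rw [sum_d4_add_abelianCount]
  refine (hasSum_subtype_iff_of_support_subset (f := fun t => shiftPart t N) ?_).2 h
  intro t ht
  rw [Function.mem_support] at ht
  have ht0 : t ≠ 0 := by rintro rfl; exact ht h0
  exact ⟨ht0, by_contra fun h => ht (shiftPart_eq_zero_of_not_isSquarefull ht0 h _)⟩

set_option maxHeartbeats 1600000 in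
lemma exists_sum_shift_asymp {ε : ℝ} (hε : 0 < ε) (hε8 : ε ≤ 1 / 8) :
    ∃ (P : Fin 4 → ℝ) (B : ℝ), ∀ x : ℝ, 1 ≤ x →
      |∑ n ∈ Finset.Icc 1 ⌊x⌋₊, (d4 (n + abelianCount n) : ℝ) - x * cubic P (Real.log x)| ≤
        B * x ^ (3 / 4 + 2 * ε) := by
  obtain ⟨C₁, hC₁, h₁⟩ := exists_shiftPart_asymp hε (by linarith)
  obtain ⟨C₂, hC₂, h₂⟩ := abs_shiftPart_le hε (by linarith)
  obtain ⟨C₃, hC₃, h₃⟩ := one_add_log_le_rpow (ε := ε / 3) (by positivity)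
  obtain ⟨S, hS⟩ : ∃ S : Set ℕ, S = {t | t ≠ 0 ∧ IsSquarefull t} := ⟨_, rfl⟩
  have hSm : ∀ t, t ∈ S ↔ t ≠ 0 ∧ IsSquarefull t := fun t => by rw [hS]; rfl
  have hw : Summable fun t : S => ((t : ℕ) : ℝ) ^ (-(1 / 2) - ε) := by
    subst hS; exact summable_isSquarefull_rpow hε
  have hS0 : ∀ t : S, (t : ℕ) ≠ 0 := fun t => ((hSm t).1 t.2).1
  have hS1 : ∀ t : S, (1 : ℝ) ≤ (t : ℕ) := fun t => by
    exact_mod_cast Nat.one_le_iff_ne_zero.2 (hS0 t)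
  choose p hp hpa using fun t : S => h₁ t (hS0 t)
  have hps : Summable p := by
    refine Summable.of_norm_bounded (hw.mul_left C₁) fun t => (hp t).trans ?_
    refine mul_le_mul_of_nonneg_left ?_ hC₁.le
    exact Real.rpow_le_rpow_of_exponent_le (hS1 t) (by linarith)
  refine ⟨∑' t, p t, (C₁ + C₂ + C₁ * C₃ ^ 3) * ∑' t : S, ((t : ℕ) : ℝ) ^ (-(1 / 2) - ε),
    fun x hx => ?_⟩
  have hx0 : 0 < x := by linarith
  have hT : HasSum (fun t : S => shiftPart t ⌊x⌋₊)
      (∑ n ∈ Finset.Icc 1 ⌊x⌋₊, (d4 (n + abelianCount n) : ℝ)) := by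
    subst hS
    exact hasSum_shiftPart _
  have hsum := hT.sub ((hasSum_cubic hps.hasSum (Real.log x)).mul_left x)
  have hbound : ∀ t : S, ‖shiftPart t ⌊x⌋₊ - x * cubic (p t) (Real.log x)‖ ≤
      (C₁ + C₂ + C₁ * C₃ ^ 3) * x ^ (3 / 4 + 2 * ε) * ((t : ℕ) : ℝ) ^ (-(1 / 2) - ε) := by
    intro t
    obtain ⟨τ, hτ⟩ : ∃ τ : ℝ, τ = ((t : ℕ) : ℝ) := ⟨_, rfl⟩
    have hτ1 : 1 ≤ τ := hτ ▸ hS1 t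
    have hτ0 : 0 < τ := by linarith
    rw [Real.norm_eq_abs]
    have hpt := hp t
    rw [← hτ] at hpt ⊢
    by_cases htx : τ ≤ √x
    · have e1 : τ ^ (ε - 1 / 2) ≤ x ^ ε * τ ^ (-(1 / 2) - ε) := by
        have e2 : τ ^ (2 * ε) ≤ x ^ ε := by
          calc τ ^ (2 * ε) ≤ (√x) ^ (2 * ε) := by gcongr
            _ = x ^ ε := by
                rw [Real.sqrt_eq_rpow, ← Real.rpow_mul hx0.le]; congr 1; ring
        calc τ ^ (ε - 1 / 2) = τ ^ (2 * ε) * τ ^ (-(1 / 2) - ε) := by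
              rw [← Real.rpow_add hτ0]; congr 1; ring
          _ ≤ _ := by gcongr
      have h := hpa t x hx (hτ ▸ htx)
      rw [← hτ] at h
      calc _ ≤ _ := h
        _ ≤ C₁ * (x ^ (3 / 4 + ε) * (x ^ ε * τ ^ (-(1 / 2) - ε))) := by gcongr
        _ = C₁ * (x ^ (3 / 4 + ε) * x ^ ε) * τ ^ (-(1 / 2) - ε) := by ring
        _ = C₁ * x ^ (3 / 4 + 2 * ε) * τ ^ (-(1 / 2) - ε) := by
            rw [← Real.rpow_add hx0]; congr 3; ring
        _ ≤ _ := by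
            gcongr
            have : 0 ≤ C₁ * C₃ ^ 3 := by positivity
            linarith
    · have e1 : x ^ (1 + ε) * τ ^ (ε - 1) ≤ x ^ (3 / 4 + 2 * ε) * τ ^ (-(1 / 2) - ε) := by
        have e2 : τ ^ (-(1 / 2) + 2 * ε) ≤ x ^ (-(1 / 4) + ε) := by
          calc τ ^ (-(1 / 2) + 2 * ε) ≤ (√x) ^ (-(1 / 2) + 2 * ε) :=
                Real.rpow_le_rpow_of_nonpos (Real.sqrt_pos.2 hx0) (not_le.1 htx).le (by linarith)
            _ = _ := by
                rw [Real.sqrt_eq_rpow, ← Real.rpow_mul hx0.le]; congr 1; ring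
        calc x ^ (1 + ε) * τ ^ (ε - 1)
            = x ^ (1 + ε) * (τ ^ (-(1 / 2) + 2 * ε) * τ ^ (-(1 / 2) - ε)) := by
              rw [← Real.rpow_add hτ0]; congr 2; ring
          _ ≤ x ^ (1 + ε) * (x ^ (-(1 / 4) + ε) * τ ^ (-(1 / 2) - ε)) := by gcongr
          _ = _ := by
              rw [← mul_assoc, ← Real.rpow_add hx0]; congr 2; ring
      have hA := h₂ t (hS0 t) x hx
      rw [← hτ] at hA
      have hB : |x * cubic (p t) (Real.log x)| ≤ C₁ * C₃ ^ 3 * (x ^ (1 + ε) * τ ^ (ε - 1)) := by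
        rw [abs_mul, abs_of_pos hx0]
        have hl : (1 + |Real.log x|) ^ 3 ≤ C₃ ^ 3 * x ^ ε := by
          rw [abs_of_nonneg (Real.log_nonneg hx)]
          have h0 := Real.log_nonneg hx
          calc (1 + Real.log x) ^ 3 ≤ (C₃ * x ^ (ε / 3)) ^ 3 := by
                have := h₃ x hx
                gcongr
            _ = _ := by
                rw [mul_pow, ← Real.rpow_natCast (x ^ (ε / 3)), ← Real.rpow_mul hx0.le]
                congr 2; push_cast; ring
        calc _ ≤ x * (‖p t‖ * (1 + |Real.log x|) ^ 3) := by
              gcongr; exact abs_cubic_le _ _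
          _ ≤ x * ((C₁ * τ ^ (ε - 1)) * (C₃ ^ 3 * x ^ ε)) := by gcongr
          _ = C₁ * C₃ ^ 3 * ((x * x ^ ε) * τ ^ (ε - 1)) := by ring
          _ = _ := by rw [Real.rpow_one_add' hx0.le (by linarith)]
      calc _ ≤ _ := abs_sub _ _
        _ ≤ _ := add_le_add hA hB
        _ = (C₂ + C₁ * C₃ ^ 3) * (x ^ (1 + ε) * τ ^ (ε - 1)) := by ring
        _ ≤ (C₂ + C₁ * C₃ ^ 3) * (x ^ (3 / 4 + 2 * ε) * τ ^ (-(1 / 2) - ε)) := by gcongr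
        _ = (C₂ + C₁ * C₃ ^ 3) * x ^ (3 / 4 + 2 * ε) * τ ^ (-(1 / 2) - ε) := by ring
        _ ≤ _ := by gcongr; linarith
  have h := hsum.norm_le_of_bounded (hw.hasSum.mul_left _) hbound
  rw [Real.norm_eq_abs] at h
  refine h.trans (le_of_eq ?_)
  ring

lemma abelianCount_of_squarefree {n : ℕ} (hn : Squarefree n) : abelianCount n = 1 := by
  rw [abelianCount, Finsupp.prod]
  refine Finset.prod_eq_one fun p hp => ?_
  have h1 : n.factorization p = 1 := by
    have h2 := hn.natFactorization_le_one p
    have h3 := Finsupp.mem_support_iff.1 hp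
    omega
  rw [h1]
  exact Fintype.card_unique

lemma card_filter_dvd_mul_add_one_le {r : ℕ} (hr : 0 < r) {k : ℕ} (hk : 0 < k) (N : ℕ) :
    ∑ n ∈ Finset.Icc 1 N, (if k ∣ n then (if r ∣ n + 1 then (1 : ℝ) else 0) else 0) ≤
      (N : ℝ) / r * (1 / k) + 1 := by
  have : NeZero r := ⟨hr.ne'⟩
  rw [sum_Icc_ite_dvd hk]
  by_cases hc : k.Coprime r
  · have hiff : ∀ j : ℕ, r ∣ k * j + 1 → (j : ZMod r) = ((-(natUnit r k)⁻¹ : (ZMod r)ˣ) : ZMod r) := by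
      intro j hj
      rw [← ZMod.natCast_eq_zero_iff] at hj
      push_cast at hj
      rw [← coe_natUnit hc] at hj
      refine (natUnit r k).isUnit.mul_left_cancel ?_
      rw [Units.val_neg, mul_neg, Units.mul_inv]
      exact eq_neg_of_add_eq_zero_left hj
    have hsub := card_filter_Ioc_zmod_le_real r 0 (N / k) (Nat.zero_le _)
      ((-(natUnit r k)⁻¹ : (ZMod r)ˣ) : ZMod r)
    have hNk : ((N / k : ℕ) : ℝ) ≤ (N : ℝ) / k := Nat.cast_div_le
    calc _ = (((Finset.Icc 1 (N / k)).filter (fun j => r ∣ k * j + 1)).card : ℝ) := by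
          rw [Finset.sum_boole]
      _ ≤ _ := by
          refine (Nat.cast_le.2 (Finset.card_le_card fun j hj => ?_)).trans hsub
          rw [Finset.mem_filter, Finset.mem_Icc] at hj
          rw [Finset.mem_filter, Finset.mem_Ioc]
          exact ⟨hj.1, hiff j hj.2⟩
      _ ≤ (N : ℝ) / k / r + 1 := by
          rw [Nat.cast_zero, sub_zero]; gcongr
      _ = _ := by ring
  · have hz : ∀ j : ℕ, ¬ r ∣ k * j + 1 := by
      intro j hj
      obtain ⟨p, hp, hpk, hpr⟩ := Nat.Prime.not_coprime_iff_dvd.1 hc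
      have h1 := (Nat.dvd_add_right (hpk.mul_right j)).1 (hpr.trans hj)
      exact hp.one_lt.ne' (Nat.dvd_one.1 h1)
    simp only [hz, if_false, Finset.sum_const_zero]
    positivity

lemma sum_one_div_sq_le {K : ℕ} (hK : 2 ≤ K) :
    ∑ k ∈ Finset.Icc 2 K, 1 / ((k ^ 2 : ℕ) : ℝ) ≤ 3 / 4 - 1 / K := by
  induction K, hK using Nat.le_induction with
  | base => norm_num
  | succ K hK ih =>
    rw [Finset.sum_Icc_succ_top (by omega)]
    have hK0 : (2 : ℝ) ≤ K := by exact_mod_cast hK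
    have : 1 / (((K + 1) ^ 2 : ℕ) : ℝ) ≤ 1 / (K : ℝ) - 1 / ((K + 1 : ℕ) : ℝ) := by
      push_cast
      rw [div_sub_div _ _ (by positivity) (by positivity), div_le_div_iff₀ (by positivity) (by positivity)]
      nlinarith
    linarith

lemma sum_squarefree_ge {r : ℕ} (hr : 0 < r) (N : ℕ) :
    (N : ℝ) / (4 * r) - N.sqrt - 2 ≤
      ∑ n ∈ Finset.Icc 1 N, if Squarefree n ∧ r ∣ n + 1 then (1 : ℝ) else 0 := by
  have hr0 : (1 : ℝ) ≤ r := by exact_mod_cast hr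
  have h1 : (N : ℝ) / r - 2 ≤ ∑ n ∈ Finset.Icc 1 N, if r ∣ n + 1 then (1 : ℝ) else 0 := by
    have ha := abs_sum_shift_sub_le (fun m => if r ∣ m then (1 : ℝ) else 0) (N := N) (c := 1)
      (M := 1) (fun n _ _ => by split_ifs <;> norm_num)
    have hb := sum_Icc_ite_dvd hr N fun _ => 1
    have hc : (N : ℝ) / r - 1 ≤ ((N / r : ℕ) : ℝ) := by
      have := Nat.lt_floor_add_one ((N : ℝ) / r)
      rw [Nat.floor_div_eq_div] at this
      linarith
    rw [hb, Finset.sum_const, Nat.card_Icc] at ha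
    simp only [Nat.add_sub_cancel, nsmul_eq_mul, mul_one, Nat.cast_one] at ha
    have := (abs_le.1 ha).1
    linarith
  have h2 : ∀ n ∈ Finset.Icc 1 N, (if r ∣ n + 1 then (1 : ℝ) else 0) ≤
      (if Squarefree n ∧ r ∣ n + 1 then (1 : ℝ) else 0) + ∑ k ∈ Finset.Icc 2 N.sqrt,
        if k ^ 2 ∣ n then (if r ∣ n + 1 then (1 : ℝ) else 0) else 0 := by
    intro n hn
    rw [Finset.mem_Icc] at hn
    have hnn : ∀ k ∈ Finset.Icc 2 N.sqrt,
        (0 : ℝ) ≤ if k ^ 2 ∣ n then (if r ∣ n + 1 then (1 : ℝ) else 0) else 0 :=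
      fun k _ => by split_ifs <;> norm_num
    by_cases hrn : r ∣ n + 1
    swap
    · simp [hrn]
    by_cases hs : Squarefree n
    · simp only [hrn, hs, and_self, if_true]
      simp only [hrn, if_true] at hnn
      linarith [Finset.sum_nonneg hnn]
    · obtain ⟨p, hp, hpn⟩ : ∃ p : ℕ, p.Prime ∧ p * p ∣ n := by
        rw [Nat.squarefree_iff_prime_squarefree] at hs
        push Not at hs
        exact hs
      have hpN : p ∈ Finset.Icc 2 N.sqrt :=
        Finset.mem_Icc.2 ⟨hp.two_le, Nat.le_sqrt.2 ((Nat.le_of_dvd (by omega) hpn).trans hn.2)⟩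
      have := Finset.single_le_sum hnn hpN
      rw [← pow_two] at hpn
      simp only [hpn, hrn, if_true] at this
      simpa [hs, hrn] using this
  have h3 : ∑ k ∈ Finset.Icc 2 N.sqrt, ((N : ℝ) / r * (1 / ((k ^ 2 : ℕ) : ℝ)) + 1) ≤
      (N : ℝ) / r * (3 / 4) + N.sqrt := by
    rw [Finset.sum_add_distrib, ← Finset.mul_sum]
    refine add_le_add ?_ ?_
    · gcongr
      rcases le_or_gt 2 N.sqrt with h | h
      · have : (0 : ℝ) ≤ 1 / N.sqrt := by positivity
        linarith [sum_one_div_sq_le h]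
      · rw [Finset.Icc_eq_empty (by omega), Finset.sum_empty]; norm_num
    · rw [Finset.sum_const, Nat.card_Icc, nsmul_eq_mul, mul_one]
      exact_mod_cast (by omega)
  have h4 := h1.trans (Finset.sum_le_sum h2)
  rw [Finset.sum_add_distrib, Finset.sum_comm] at h4
  have h5 := (Finset.sum_le_sum fun k hk => card_filter_dvd_mul_add_one_le hr
    (k := k ^ 2) (pow_pos (by rw [Finset.mem_Icc] at hk; omega) 2) N).trans h3
  have h6 : (N : ℝ) / (4 * r) = N / r - N / r * (3 / 4) := by ring
  rw [h6]
  linarith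

lemma sum_ite_dvd_le_d4 {m : ℕ} (hm : m ≠ 0) (Y : ℕ) :
    (∑ a ∈ Finset.Icc 1 Y, ∑ b ∈ Finset.Icc 1 Y, ∑ c ∈ Finset.Icc 1 Y,
      if a * b * c ∣ m then (1 : ℝ) else 0) ≤ d4 m := by
  have h : ((Finset.Icc 1 Y ×ˢ Finset.Icc 1 Y ×ˢ Finset.Icc 1 Y).filter
      fun t => t.1 * t.2.1 * t.2.2 ∣ m).card ≤ (m.divisorsAntidiagonal.sigma fun p =>
        p.1.divisors ×ˢ p.2.divisors).card := by
    refine Finset.card_le_card_of_injOn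
      (fun t => ⟨(t.1 * t.2.1, m / (t.1 * t.2.1)), (t.1, t.2.2)⟩) ?_ ?_
    · rintro ⟨a, b, c⟩ ht
      simp only [Finset.coe_filter, Finset.mem_product, Finset.mem_Icc, Set.mem_ofPred_eq] at ht
      obtain ⟨⟨ha, hb, hc⟩, e, rfl⟩ := ht
      have hab : 0 < a * b := Nat.mul_pos (by omega) (by omega)
      have hce : c * e ≠ 0 := by
        rintro h0; exact hm (by rw [mul_assoc, h0, mul_zero])
      simp only [Finset.coe_sigma, Set.mem_sigma_iff, Finset.mem_coe, Finset.mem_product,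
        Nat.mem_divisorsAntidiagonal, Nat.mem_divisors]
      rw [mul_assoc (a * b), Nat.mul_div_cancel_left _ hab]
      exact ⟨⟨rfl, by rwa [← mul_assoc]⟩, ⟨dvd_mul_right _ _, hab.ne'⟩, dvd_mul_right _ _, hce⟩
    · rintro ⟨a, b, c⟩ ht ⟨a', b', c'⟩ ht' h
      simp only [Finset.coe_filter, Finset.mem_product, Finset.mem_Icc, Set.mem_ofPred_eq] at ht ht'
      simp only [Sigma.mk.injEq, Prod.mk.injEq, heq_eq_eq] at h
      obtain ⟨⟨h1, -⟩, rfl, rfl⟩ := h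
      rw [Nat.eq_of_mul_eq_mul_left (by omega) h1]
  rw [Finset.card_sigma] at h
  simp only [Finset.card_product] at h
  rw [← d4_eq_sum_divisorsAntidiagonal m hm] at h
  refine le_trans (le_of_eq ?_) (Nat.cast_le.2 h)
  rw [← Finset.sum_boole, Finset.sum_product]
  refine Finset.sum_congr rfl fun a _ => ?_
  rw [Finset.sum_product]

lemma sum_d4_add_abelianCount_ge (N Y : ℕ) :
    (N : ℝ) / 4 * (harmonic Y : ℝ) ^ 3 - (Y : ℝ) ^ 3 * (N.sqrt + 2) ≤
      ∑ n ∈ Finset.Icc 1 N, (d4 (n + abelianCount n) : ℝ) := by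
  have hH : (harmonic Y : ℝ) = ∑ a ∈ Finset.Icc 1 Y, (a : ℝ)⁻¹ := by
    rw [harmonic_eq_sum_Icc]; push_cast; rfl
  calc _ = ∑ a ∈ Finset.Icc 1 Y, ∑ b ∈ Finset.Icc 1 Y, ∑ c ∈ Finset.Icc 1 Y,
        ((N : ℝ) / (4 * ((a * b * c : ℕ) : ℝ)) - N.sqrt - 2) := by
        have : ∀ a b c : ℕ, (N : ℝ) / (4 * ((a * b * c : ℕ) : ℝ)) - N.sqrt - 2 =
            (N : ℝ) / 4 * ((a : ℝ)⁻¹ * ((b : ℝ)⁻¹ * (c : ℝ)⁻¹)) - (N.sqrt + 2) := by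
          intro a b c
          push_cast
          rw [div_eq_mul_inv, mul_inv, mul_inv, mul_inv]; ring
        simp only [this, Finset.sum_sub_distrib, ← Finset.mul_sum, ← Finset.sum_mul,
          Finset.sum_const, Nat.card_Icc, Nat.add_sub_cancel, nsmul_eq_mul, ← hH]
        ring
    _ ≤ ∑ a ∈ Finset.Icc 1 Y, ∑ b ∈ Finset.Icc 1 Y, ∑ c ∈ Finset.Icc 1 Y,
        ∑ n ∈ Finset.Icc 1 N, if Squarefree n ∧ a * b * c ∣ n + 1 then (1 : ℝ) else 0 := by
        refine Finset.sum_le_sum fun a ha => Finset.sum_le_sum fun b hb =>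
          Finset.sum_le_sum fun c hc => sum_squarefree_ge ?_ N
        rw [Finset.mem_Icc] at ha hb hc
        have ha := ha.1
        have hb := hb.1
        have hc := hc.1
        positivity
    _ = ∑ n ∈ Finset.Icc 1 N, ∑ a ∈ Finset.Icc 1 Y, ∑ b ∈ Finset.Icc 1 Y, ∑ c ∈ Finset.Icc 1 Y,
        if Squarefree n ∧ a * b * c ∣ n + 1 then (1 : ℝ) else 0 := by
        symm
        rw [Finset.sum_comm]
        refine Finset.sum_congr rfl fun a _ => ?_
        rw [Finset.sum_comm]
        refine Finset.sum_congr rfl fun b _ => ?_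
        rw [Finset.sum_comm]
    _ ≤ _ := by
        refine Finset.sum_le_sum fun n _ => ?_
        by_cases hs : Squarefree n
        · simp only [hs, true_and]
          rw [abelianCount_of_squarefree hs]
          exact sum_ite_dvd_le_d4 (by omega) Y
        · simp [hs]

lemma sum_d4_add_abelianCount_ge_log {x : ℝ} (hx : 1 ≤ x) :
    x * (Real.log x ^ 3 / 8000 - 3) ≤
      ∑ n ∈ Finset.Icc 1 ⌊x⌋₊, (d4 (n + abelianCount n) : ℝ) := by
  have hx0 : 0 < x := by linarith
  refine le_trans ?_ (sum_d4_add_abelianCount_ge ⌊x⌋₊ ⌊x ^ (1 / 10 : ℝ)⌋₊)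
  have hN : x / 2 ≤ ⌊x⌋₊ := by
    have h1 : (1 : ℝ) ≤ ⌊x⌋₊ := by exact_mod_cast Nat.floor_pos.2 hx
    linarith [Nat.lt_floor_add_one x]
  have hH := Real.log_rpow hx0 (1 / 10) ▸
    log_le_harmonic_floor (x ^ (1 / 10 : ℝ)) (by positivity)
  have hY : (⌊x ^ (1 / 10 : ℝ)⌋₊ : ℝ) ≤ x ^ (1 / 10 : ℝ) := Nat.floor_le (by positivity)
  have hs : ((⌊x⌋₊.sqrt : ℕ) : ℝ) ≤ x ^ (1 / 2 : ℝ) := by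
    rw [← Real.sqrt_eq_rpow]
    exact Real.nat_sqrt_le_real_sqrt.trans (Real.sqrt_le_sqrt (Nat.floor_le hx0.le))
  have hs1 : 1 ≤ x ^ (1 / 2 : ℝ) := Real.one_le_rpow hx (by norm_num)
  have h0 := Real.log_nonneg hx
  have hmain : x / 2 / 4 * (1 / 10 * Real.log x) ^ 3 ≤
      (⌊x⌋₊ : ℝ) / 4 * (harmonic ⌊x ^ (1 / 10 : ℝ)⌋₊ : ℝ) ^ 3 := by gcongr
  have herr : (⌊x ^ (1 / 10 : ℝ)⌋₊ : ℝ) ^ 3 * (⌊x⌋₊.sqrt + 2) ≤ 3 * x := by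
    calc _ ≤ (x ^ (1 / 10 : ℝ)) ^ 3 * (3 * x ^ (1 / 2 : ℝ)) := by
          gcongr; linarith
      _ = 3 * x ^ (4 / 5 : ℝ) := by
          rw [← Real.rpow_natCast (x ^ (1 / 10 : ℝ)), ← Real.rpow_mul hx0.le, mul_left_comm,
            ← Real.rpow_add hx0]
          norm_num
      _ ≤ 3 * x ^ (1 : ℝ) := by gcongr; norm_num
      _ = _ := by rw [Real.rpow_one]
  have : x * (Real.log x ^ 3 / 8000 - 3) = x / 2 / 4 * (1 / 10 * Real.log x) ^ 3 - 3 * x := by ring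
  linarith

open Polynomial in
/-- The polynomial whose evaluation is `cubic p`. -/
noncomputable def cubicPoly (p : Fin 4 → ℝ) : Polynomial ℝ :=
  C (p 0) + C (p 1) * X + C (p 2) * X ^ 2 + C (p 3) * X ^ 3

lemma eval_cubicPoly (p : Fin 4 → ℝ) (L : ℝ) : (cubicPoly p).eval L = cubic p L := by
  simp [cubicPoly, cubic]

lemma degree_cubicPoly_le (p : Fin 4 → ℝ) : (cubicPoly p).degree ≤ 3 := by
  rw [cubicPoly]; compute_degree

open Filter Topology in
lemma cubicPoly_eq_of_asymp {T : ℝ → ℝ} {P P' : Fin 4 → ℝ} {B B' δ : ℝ} (hδ : δ < 1)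
    (h : ∀ x : ℝ, 1 ≤ x → |T x - x * cubic P (Real.log x)| ≤ B * x ^ δ)
    (h' : ∀ x : ℝ, 1 ≤ x → |T x - x * cubic P' (Real.log x)| ≤ B' * x ^ δ) :
    cubicPoly P = cubicPoly P' := by
  have key : Tendsto (fun L => (cubicPoly P - cubicPoly P').eval L) atTop (𝓝 0) := by
    have hlim : Tendsto (fun L : ℝ => (B + B') * Real.exp (-((1 - δ) * L))) atTop (𝓝 0) := by
      have := (Real.tendsto_exp_neg_atTop_nhds_zero.comp
        (tendsto_id.const_mul_atTop (sub_pos.2 hδ))).const_mul (B + B')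
      simpa using this
    refine squeeze_zero_norm' ?_ hlim
    filter_upwards [eventually_ge_atTop 0] with L hL
    have h1 := h (Real.exp L) (Real.one_le_exp hL)
    have h2 := h' (Real.exp L) (Real.one_le_exp hL)
    rw [Real.log_exp, ← Real.exp_mul] at h1 h2
    rw [Polynomial.eval_sub, eval_cubicPoly, eval_cubicPoly, Real.norm_eq_abs]
    have h3 := abs_sub (T (Real.exp L) - Real.exp L * cubic P' L)
      (T (Real.exp L) - Real.exp L * cubic P L)
    have h4 : (T (Real.exp L) - Real.exp L * cubic P' L) -
        (T (Real.exp L) - Real.exp L * cubic P L) = Real.exp L * (cubic P L - cubic P' L) := by ring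
    rw [h4, abs_mul, Real.abs_exp] at h3
    refine le_of_mul_le_mul_left ?_ (Real.exp_pos L)
    have h5 : Real.exp L * ((B + B') * Real.exp (-((1 - δ) * L))) =
        (B + B') * Real.exp (L * δ) := by
      rw [mul_left_comm, ← Real.exp_add]; ring_nf
    rw [h5]
    linarith
  have := ((Polynomial.tendsto_nhds_iff _).1 key).1
  exact sub_eq_zero.1 (Polynomial.leadingCoeff_eq_zero.1 this)

open Filter Topology in
lemma degree_eq_three_of_le_eval {Q : Polynomial ℝ} (hQ : Q.degree ≤ 3) {c C : ℝ} (hc : 0 < c)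
    (h : ∀ L : ℝ, 0 ≤ L → c * L ^ 3 - C ≤ Q.eval L) : Q.degree = 3 := by
  refine hQ.eq_of_not_lt fun hlt => ?_
  have h1 := Polynomial.div_tendsto_atTop_zero_of_degree_lt Q (Polynomial.X ^ 3)
    (by rwa [Polynomial.degree_X_pow])
  have h2 : Tendsto (fun L : ℝ => c - C / L ^ 3) atTop (𝓝 (c - 0)) :=
    tendsto_const_nhds.sub (tendsto_const_nhds.div_atTop (tendsto_pow_atTop (by norm_num)))
  have h3 : c - 0 ≤ 0 := by
    refine le_of_tendsto_of_tendsto h2 h1 ?_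
    filter_upwards [eventually_gt_atTop 0] with L hL
    rw [Polynomial.eval_pow, Polynomial.eval_X, sub_le_iff_le_add, ← add_div,
      le_div_iff₀ (by positivity)]
    linarith [h L hL.le]
  linarith

open Filter in
theorem sum_d4_shift :
    ∃ Q : Polynomial ℝ, Q.degree = 3 ∧ ∀ ε : ℝ, 0 < ε →
      (fun x : ℝ =>
          (∑ n ∈ Finset.Icc 1 ⌊x⌋₊, (d4 (n + abelianCount n) : ℝ)) -
            x * Q.eval (Real.log x))
        =O[atTop] fun x : ℝ => x ^ ((3 : ℝ) / 4 + ε) := by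
  obtain ⟨P₀, B₀, h₀⟩ := exists_sum_shift_asymp (ε := 1 / 16) (by norm_num) (by norm_num)
  refine ⟨cubicPoly P₀, ?_, fun ε hε => ?_⟩
  · refine degree_eq_three_of_le_eval (degree_cubicPoly_le P₀) (c := 1 / 8000) (C := 3 + |B₀|)
      (by norm_num) fun L hL => ?_
    have hx := Real.one_le_exp hL
    have h1 := (abs_le.1 (h₀ _ hx)).2
    have h2 := sum_d4_add_abelianCount_ge_log hx
    have h3 : B₀ * Real.exp L ^ (3 / 4 + 2 * (1 / 16) : ℝ) ≤ |B₀| * Real.exp L := by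
      refine mul_le_mul (le_abs_self _) ?_ (by positivity) (abs_nonneg _)
      conv_rhs => rw [← Real.rpow_one (Real.exp L)]
      exact Real.rpow_le_rpow_of_exponent_le hx (by norm_num)
    rw [Real.log_exp] at h1 h2
    rw [eval_cubicPoly]
    refine le_of_mul_le_mul_left ?_ (Real.exp_pos L)
    linarith
  · obtain ⟨P, B, h⟩ := exists_sum_shift_asymp (ε := min (ε / 2) (1 / 16))
      (lt_min (by linarith) (by norm_num)) ((min_le_right _ _).trans (by norm_num))
    have hB : ∀ (b x s t : ℝ), 1 ≤ x → s ≤ t → b * x ^ s ≤ |b| * x ^ t := fun b x s t hx hst =>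
      mul_le_mul (le_abs_self _) (Real.rpow_le_rpow_of_exponent_le hx hst) (by positivity)
        (abs_nonneg _)
    have hP : cubicPoly P = cubicPoly P₀ :=
      cubicPoly_eq_of_asymp (δ := 7 / 8) (by norm_num)
        (fun x hx => (h x hx).trans (hB _ _ _ _ hx (by linarith [min_le_right (ε / 2) (1 / 16)])))
        (fun x hx => (h₀ x hx).trans (hB _ _ _ _ hx (by norm_num)))
    refine Asymptotics.IsBigO.of_bound |B| ?_
    filter_upwards [eventually_ge_atTop 1] with x hx
    rw [← hP, eval_cubicPoly, Real.norm_eq_abs, Real.norm_eq_abs,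
      abs_of_nonneg (Real.rpow_nonneg (by linarith) _)]
    exact (h x hx).trans (hB _ _ _ _ hx (by linarith [min_le_left (ε / 2) (1 / 16)]))
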